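/- Theorem (A₂^{(1)} Andrews–Gordon identities, modulus K = 3k+4). Let k ≥ 1 and 0 ≤ a,b ≤ k be integers and set K := 3k+4. Then, as formal power series in q: χ̃_{a,b}^K(q) = Σ_{λ_1,…,λ_k ≥ 0; μ_1,…,μ_k ≥ 0} q^{Σ_{i=a+1}^k λ_i + Σ_{i=b+1}^k μ_i}/(q;q)_{λ_1} · ∏_{i=1}^k q^{λ_i²−λ_iμ_i+μ_i²} [λ_i, λ_{i+1}]_q [λ_i−λ_{i+1}+μ_{i+1}+δ_{b,i}, μ_i]_q − Σ_{λ_1,…,λ_k ≥ 0; μ_1,…,μ_k ≥ 0} q^{1+Σ_{i=a}^k λ_i + Σ_{i=b}^k μ_i}/(q;q)_{λ_1} · ∏_{i=1}^k q^{λ_i²−λ_iμ_i+μ_i²} [λ_i, λ_{i+1}]_q [λ_i−λ_{i+1}+μ_{i+1}+δ_{b−1,i}, μ_i]_q, where λ_{k+1} := 0, μ_{k+1} := λ_k, δ is the Kronecker delta, and the convention q^{λ_0} = q^{μ_0} := 0 is used (so the second multisum vanishes when a = 0 or b = 0). Moreover χ̃_{k,k}^K(q) = Σ_{λ_1,…,λ_k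 ≥ 0; μ_1,…,μ_k ≥ 0} (1/(q;q)_{λ_1}) ∏_{i=1}^k q^{λ_i²−λ_iμ_i+μ_i²} [λ_i, λ_{i+1}]_q [λ_i−λ_{i+1}+μ_{i+1}, μ_i]_q with the same conventions. -/

import Mathlib

noncomputable section

namespace Stmt1

/-- `(a; q)_n`, the finite q-Pochhammer symbol. -/
def qPoch (a q : ℂ) (n : ℕ) : ℂ := ∏ j ∈ Finset.range n, (1 - a * q ^ j)

/-- `(a; q)_∞`. -/
def qPochInf (a q : ℂ) : ℂ := ∏' j : ℕ, (1 - a * q ^ j)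

/-- The modified theta function `θ(z; q) = (z;q)_∞ (q/z;q)_∞`. -/
def theta (z q : ℂ) : ℂ := qPochInf z q * qPochInf (q / z) q

/-- The q-binomial coefficient, vanishing unless `0 ≤ m ≤ n`. -/
def qBinom (q : ℂ) (n m : ℤ) : ℂ :=
  if 0 ≤ m ∧ m ≤ n then
    qPoch q q n.toNat / (qPoch q q m.toNat * qPoch q q (n - m).toNat)
  else 0

/-- The normalised character `χ̃_{a,b}^K(q)` of the `𝒲₃(3,K)` vertex operator algebra. -/
def chiT (q : ℂ) (K a b : ℕ) : ℂ :=
  qPochInf (q ^ K) (q ^ K) ^ 2 / qPochInf q q ^ 2 *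
    (theta (q ^ (a + 1)) (q ^ K) * theta (q ^ (b + 1)) (q ^ K) *
      theta (q ^ (a + b + 2)) (q ^ K))

/-- `f₁, …, f_k` read as a sequence indexed by `1, …, k` and extended by zero
(in particular `λ_{k+1} = 0`). -/
def nth {k : ℕ} (f : Fin k → ℕ) (i : ℕ) : ℕ :=
  if h : 1 ≤ i ∧ i ≤ k then f ⟨i - 1, by omega⟩ else 0

/-- `μ_1, …, μ_k` together with the boundary convention `μ_{k+1} := λ_k`. -/
def Mext {k : ℕ} (l m : Fin k → ℕ) (i : ℕ) : ℕ :=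
  if i = k + 1 then nth l k else nth m i

/-- The standing assumption `0 < |q| < 1`. -/
class Nome (q : ℂ) : Prop where
  ne_zero : q ≠ 0
  norm_lt_one : ‖q‖ < 1

/-- `(q; q)_n` for an integer `n`, read as `1` for `n < 0`. -/
def qp (q : ℂ) (n : ℤ) : ℂ := qPoch q q n.toNat

/-- `1 / (q; q)_n` for an integer `n`, which is `0` for `n < 0`. -/
def rq (q : ℂ) (n : ℤ) : ℂ := if n < 0 then 0 else (qPoch q q n.toNat)⁻¹

section Basic

variable {q : ℂ} [hq : Nome q]

lemma zpow_split {a b c : ℤ} (h : a = b + c) : q ^ a = q ^ b * q ^ c := by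
  rw [h, zpow_add₀ hq.ne_zero]

omit hq in
lemma zpow_congr {a b : ℤ} (h : a = b) : q ^ a = q ^ b := by rw [h]

lemma pow_ne_one {n : ℕ} (hn : n ≠ 0) : q ^ n ≠ 1 := by
  intro h
  have h1 : ‖q‖ ^ n = 1 := by rw [← norm_pow, h, norm_one]
  have h2 : ‖q‖ ^ n < 1 := pow_lt_one₀ (norm_nonneg _) hq.norm_lt_one hn
  linarith

lemma zpow_ne_one {n : ℤ} (hn : n ≠ 0) : q ^ n ≠ 1 := by
  intro h
  have h1 : q ^ n.natAbs = 1 := by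
    rcases Int.natAbs_eq n with h2 | h2
    · rw [h2, zpow_natCast] at h
      exact h
    · rw [h2, zpow_neg, zpow_natCast, inv_eq_one] at h
      exact h
  exact pow_ne_one (q := q) (Int.natAbs_ne_zero.mpr hn) h1

lemma one_sub_zpow_ne_zero {n : ℤ} (hn : n ≠ 0) : (1 : ℂ) - q ^ n ≠ 0 :=
  sub_ne_zero.mpr (zpow_ne_one hn).symm

lemma qPoch_succ (a q : ℂ) (n : ℕ) : qPoch a q (n + 1) = qPoch a q n * (1 - a * q ^ n) := by
  simp [qPoch, Finset.prod_range_succ]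

@[simp] lemma qPoch_zero (a q : ℂ) : qPoch a q 0 = 1 := by simp [qPoch]

lemma qPoch_self_ne_zero (n : ℕ) : qPoch q q n ≠ 0 := by
  refine Finset.prod_ne_zero_iff.mpr fun j _ => ?_
  rw [← pow_succ']
  exact sub_ne_zero.mpr (pow_ne_one (Nat.succ_ne_zero j)).symm

omit hq in
lemma rq_neg {n : ℤ} (hn : n < 0) : rq q n = 0 := by simp [rq, hn]

omit hq in
@[simp] lemma rq_zero : rq q 0 = 1 := by simp [rq]

omit hq in
@[simp] lemma qp_zero : qp q 0 = 1 := by simp [qp]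

lemma qp_ne_zero (n : ℤ) : qp q n ≠ 0 := qPoch_self_ne_zero _

lemma qp_mul_rq {n : ℤ} (hn : 0 ≤ n) : qp q n * rq q n = 1 := by
  rw [qp, rq, if_neg (not_lt.mpr hn), mul_inv_cancel₀ (qPoch_self_ne_zero _)]

omit hq in
lemma qp_rec {n : ℤ} (hn : 1 ≤ n) : qp q n = (1 - q ^ n) * qp q (n - 1) := by
  obtain ⟨m, rfl⟩ : ∃ m : ℕ, n = m + 1 := ⟨(n - 1).toNat, by omega⟩
  have h1 : ((m : ℤ) + 1).toNat = m + 1 := by omega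
  have h2 : ((m : ℤ) + 1 - 1).toNat = m := by omega
  rw [qp, qp, h1, h2, qPoch_succ, ← pow_succ']
  norm_cast
  ring

lemma rq_rec (n : ℤ) : (1 - q ^ n) * rq q n = rq q (n - 1) := by
  rcases lt_trichotomy n 0 with h | rfl | h
  · rw [rq_neg h, rq_neg (by omega), mul_zero]
  · simp [rq_neg]
  · have h1 := qp_rec (q := q) (n := n) (by omega)
    have h2 := qp_mul_rq (q := q) (n := n) h.le
    have h3 := qp_mul_rq (q := q) (n := n - 1) (by omega)
    have h4 := qp_ne_zero (q := q) (n - 1)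
    apply mul_left_cancel₀ h4
    linear_combination h2 - h3 - rq q n * h1

/-- The Gaussian binomial coefficient through `qp` and `rq`. -/
lemma qBinom_eq (q : ℂ) (n m : ℤ) :
    qBinom q n m = qp q n * (rq q m * rq q (n - m)) := by
  rw [qBinom]
  split_ifs with h
  · rw [qp, rq, rq, if_neg (by omega), if_neg (by omega), div_eq_mul_inv, mul_inv]
  · rcases not_and_or.mp h with h | h
    · rw [rq_neg (n := m) (by omega)]; ring
    · rw [rq_neg (n := n - m) (by omega)]; ring

end Basic

section Vandermonde

variable {q : ℂ} [hq : Nome q]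

private lemma vandermonde_aux (u : ℕ) : ∀ (R : ℕ) (d : ℤ), u < R →
    ∑ v ∈ Finset.range R, q ^ ((v : ℤ) * (v + d)) * (rq q (u - v) * rq q v * rq q (v + d)) =
      rq q u * rq q (u + d) := by
  induction u with
  | zero =>
    intro R d hR
    rw [Finset.sum_eq_single 0]
    · simp
    · intro v _ hv
      rw [rq_neg (n := ((0 : ℕ) : ℤ) - v) (by omega)]
      ring
    · intro h
      exact absurd (Finset.mem_range.mpr hR) h
  | succ u ih =>
    intro R d hR
    obtain ⟨R, rfl⟩ : ∃ R', R = R' + 1 := ⟨R - 1, by omega⟩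
    have e1 := ih (R + 1) d (by omega)
    have e2 := ih R (d + 1) (by omega)
    apply mul_left_cancel₀ (one_sub_zpow_ne_zero (q := q) (n := ((u + 1 : ℕ) : ℤ)) (by omega))
    have key : (1 - q ^ ((u + 1 : ℕ) : ℤ)) * (∑ v ∈ Finset.range (R + 1), q ^ ((v : ℤ) * (v + d)) *
        (rq q ((u + 1 : ℕ) - v) * rq q v * rq q (v + d))) =
        rq q u * rq q (u + d) + q ^ ((u + 1 : ℕ) + d) * (rq q u * rq q (u + (d + 1))) := by
      rw [← e1, ← e2, Finset.mul_sum, Finset.mul_sum]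
      have h1 : ∀ v : ℕ, (1 - q ^ ((u + 1 : ℕ) : ℤ)) * (q ^ ((v : ℤ) * (v + d)) *
          (rq q ((u + 1 : ℕ) - v) * rq q v * rq q (v + d))) =
          q ^ ((v : ℤ) * (v + d)) * (rq q (u - v) * rq q v * rq q (v + d)) +
          q ^ ((v : ℤ) * (v + d) + (u + 1 - v)) *
            (rq q (u + 1 - v) * rq q (v - 1) * rq q (v + d)) := by
        intro v
        have r1 := rq_rec (q := q) ((u : ℤ) + 1 - v)
        have r2 := rq_rec (q := q) v
        rw [show (u : ℤ) + 1 - v - 1 = u - v by ring] at r1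
        rw [← r1, ← r2, zpow_add₀ hq.ne_zero, zpow_split (q := q) (a := ((u + 1 : ℕ) : ℤ))
          (b := u + 1 - v) (c := v) (by push_cast; ring)]
        push_cast
        ring
      rw [Finset.sum_congr rfl fun v _ => h1 v, Finset.sum_add_distrib]
      congr 1
      rw [Finset.sum_range_succ', Nat.cast_zero, rq_neg (n := (0 : ℤ) - 1) (by omega)]
      simp only [mul_zero, zero_mul, add_zero]
      refine Finset.sum_congr rfl fun v _ => ?_
      rw [zpow_split (q := q) (a := ((v + 1 : ℕ) : ℤ) * ((v + 1 : ℕ) + d) + (u + 1 - (v + 1 : ℕ)))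
        (b := (u + 1 : ℕ) + d) (c := v * (v + (d + 1))) (by push_cast; ring),
        show (u : ℤ) + 1 - (v + 1 : ℕ) = u - v by push_cast; ring,
        show ((v + 1 : ℕ) : ℤ) - 1 = v by push_cast; ring,
        show ((v + 1 : ℕ) : ℤ) + d = v + (d + 1) by push_cast; ring]
      ring
    rw [key]
    have r1 := rq_rec (q := q) ((u : ℤ) + 1)
    have r2 := rq_rec (q := q) ((u : ℤ) + 1 + d)
    rw [show (u : ℤ) + 1 - 1 = u by ring] at r1
    rw [show (u : ℤ) + 1 + d - 1 = u + d by ring] at r2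
    push_cast
    rw [← r1, ← r2, show (u : ℤ) + (d + 1) = u + 1 + d by ring]
    ring

/-- The q-Chu–Vandermonde sum. -/
lemma vandermonde {u : ℤ} {R : ℕ} (hR : u < R) (d : ℤ) :
    ∑ v ∈ Finset.range R, q ^ ((v : ℤ) * (v + d)) * (rq q (u - v) * rq q v * rq q (v + d)) =
      rq q u * rq q (u + d) := by
  rcases lt_or_ge u 0 with h | h
  · rw [rq_neg h, zero_mul]
    refine Finset.sum_eq_zero fun v _ => ?_
    rw [rq_neg (n := u - v) (by omega)]
    ring
  · obtain ⟨n, rfl⟩ := Int.eq_ofNat_of_zero_le h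
    exact vandermonde_aux n R d (by omega)

end Vandermonde

section Whipple

variable {q : ℂ} [hq : Nome q]

lemma qBinom_pascal {n : ℤ} (hn : 0 ≤ n) (m : ℤ) :
    qBinom q (n + 1) m = q ^ m * qBinom q n m + qBinom q n (m - 1) := by
  have r1 := rq_rec (q := q) m
  have r2 := rq_rec (q := q) (n + 1 - m)
  have r3 := qp_rec (q := q) (n := n + 1) (by omega)
  rw [show n + 1 - m - 1 = n - m by ring] at r2
  rw [show n + 1 - 1 = n by ring] at r3
  rw [qBinom_eq, qBinom_eq, qBinom_eq, show n - (m - 1) = n + 1 - m by ring, ← r1, ← r2, r3,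
    zpow_split (q := q) (a := n + 1) (b := m) (c := n + 1 - m) (by ring)]
  ring

lemma qBinom_of_neg (q : ℂ) (n : ℤ) {m : ℤ} (hm : m < 0) : qBinom q n m = 0 := by
  rw [qBinom_eq, rq_neg hm]; ring

lemma qBinom_of_gt (q : ℂ) {n m : ℤ} (hm : n < m) : qBinom q n m = 0 := by
  rw [qBinom_eq, rq_neg (n := n - m) (by omega)]; ring

/-- A finite transformation which trades a Gaussian binomial for a reciprocal factorial. -/
lemma sum_qBinom_eq_sum_rq (N : ℕ) : ∀ {R : ℕ} (_ : N < R) (d : ℤ) {u : ℤ} (_ : u < R),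
    ∑ μ ∈ Finset.range R, q ^ ((μ : ℤ) * (μ - (N - d))) *
        (qBinom q N μ * (rq q u * rq q (u + μ - (N - d)))) =
      ∑ v ∈ Finset.range R, q ^ ((v : ℤ) * (v - (N - d))) *
        (rq q (u - v) * rq q (v + d) * rq q v) := by
  induction N with
  | zero =>
    intro R hN d u hu
    rw [Finset.sum_eq_single 0]
    · have := vandermonde (q := q) hu d
      simp only [Nat.cast_zero, zero_sub, sub_neg_eq_add, zero_mul, zpow_zero, one_mul,
        add_zero] at this ⊢
      rw [qBinom_eq]
      simp only [qp_zero, rq_zero, sub_zero, one_mul]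
      rw [← this]
      refine Finset.sum_congr rfl fun v _ => ?_
      ring
    · intro v _ hv
      rw [qBinom_of_gt q (by omega)]
      ring
    · intro h
      exact absurd (Finset.mem_range.mpr hN) h
  | succ N ih =>
    intro R hN d u hu
    have i1 := ih (R := R) (by omega) d hu
    have i2 := ih (R := R) (by omega) d (u := u - 1) (by omega)
    apply mul_left_cancel₀ (zpow_ne_zero u hq.ne_zero)
    have right : q ^ u * ∑ v ∈ Finset.range R, q ^ ((v : ℤ) * (v - ((N + 1 : ℕ) - d))) *
        (rq q (u - v) * rq q (v + d) * rq q v) =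
        (∑ v ∈ Finset.range R, q ^ ((v : ℤ) * (v - (N - d))) *
          (rq q (u - v) * rq q (v + d) * rq q v)) -
        ∑ v ∈ Finset.range R, q ^ ((v : ℤ) * (v - (N - d))) *
          (rq q (u - 1 - v) * rq q (v + d) * rq q v) := by
      rw [← Finset.sum_sub_distrib, Finset.mul_sum]
      refine Finset.sum_congr rfl fun v _ => ?_
      have r1 := rq_rec (q := q) (u - v)
      rw [show u - v - 1 = u - 1 - v by ring] at r1
      rw [← r1, zpow_split (q := q) (a := u) (b := u - v) (c := v) (by ring),
        zpow_split (q := q) (a := (v : ℤ) * (v - (N - d)))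
          (b := (v : ℤ) * (v - ((N + 1 : ℕ) - d))) (c := v) (by push_cast; ring)]
      ring
    rw [right, ← i1, ← i2, ← Finset.sum_sub_distrib]
    have termwise : ∀ μ : ℕ, q ^ ((μ : ℤ) * (μ - (N - d))) *
          (qBinom q N μ * (rq q u * rq q (u + μ - (N - d)))) -
        q ^ ((μ : ℤ) * (μ - (N - d))) *
          (qBinom q N μ * (rq q (u - 1) * rq q (u - 1 + μ - (N - d)))) =
        q ^ u * (q ^ ((μ : ℤ) * (μ - (N - d))) * qBinom q N μ * rq q u *
          rq q (u + μ - (N - d) - 1)) +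
        q ^ u * (q ^ ((μ : ℤ) * (μ - (N - d)) + μ - (N - d)) * qBinom q N μ * rq q u *
          rq q (u + μ - (N - d))) := by
      intro μ
      have r1 := rq_rec (q := q) u
      have r2 := rq_rec (q := q) (u + μ - (N - d))
      rw [show u - 1 + (μ : ℤ) - (N - d) = u + μ - (N - d) - 1 by ring, ← r1, ← r2,
        zpow_split (q := q) (a := u + μ - (N - d)) (b := u) (c := μ - (N - d)) (by ring),
        zpow_split (q := q) (a := (μ : ℤ) * (μ - (N - d)) + μ - (N - d))
          (b := (μ : ℤ) * (μ - (N - d))) (c := μ - (N - d)) (by ring)]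
      ring
    rw [Finset.sum_congr rfl fun μ _ => termwise μ, Finset.sum_add_distrib, ← Finset.mul_sum,
      ← Finset.mul_sum, ← mul_add]
    congr 1
    have pascal : ∀ μ : ℕ, q ^ ((μ : ℤ) * (μ - ((N + 1 : ℕ) - d))) *
        (qBinom q (N + 1 : ℕ) μ * (rq q u * rq q (u + μ - ((N + 1 : ℕ) - d)))) =
        q ^ ((μ : ℤ) * (μ - (N - d))) * qBinom q N μ * rq q u * rq q (u + μ - (N - d) - 1) +
        q ^ ((μ : ℤ) * (μ - ((N + 1 : ℕ) - d))) * qBinom q N (μ - 1) * rq q u *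
          rq q (u + μ - (N - d) - 1) := by
      intro μ
      have := qBinom_pascal (q := q) (n := N) (by omega) μ
      push_cast
      rw [this, zpow_split (q := q) (a := (μ : ℤ) * (μ - (N - d)))
        (b := (μ : ℤ) * (μ - ((N : ℤ) + 1 - d))) (c := μ) (by ring),
        show u + (μ : ℤ) - (N + 1 - d) = u + μ - (N - d) - 1 by ring]
      ring
    rw [Finset.sum_congr rfl fun μ _ => pascal μ, Finset.sum_add_distrib]
    congr 1
    obtain ⟨R, rfl⟩ : ∃ R', R = R' + 1 := ⟨R - 1, by omega⟩
    rw [Finset.sum_range_succ', Finset.sum_range_succ, qBinom_of_gt q (n := N) (m := R) (by omega),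
      qBinom_of_neg q N (m := ((0 : ℕ) : ℤ) - 1) (by omega)]
    simp only [mul_zero, zero_mul, add_zero]
    refine Finset.sum_congr rfl fun μ _ => ?_
    rw [show ((μ + 1 : ℕ) : ℤ) * ((μ + 1 : ℕ) - ((N + 1 : ℕ) - d)) =
        (μ : ℤ) * (μ - (N - d)) + μ - (N - d) by push_cast; ring,
      show ((μ + 1 : ℕ) : ℤ) - 1 = μ by push_cast; ring,
      show u + ((μ + 1 : ℕ) : ℤ) - (N - d) - 1 = u + μ - (N - d) by push_cast; ring]

end Whipple

/-- The kernel `(q)_{r+s} / ∏ (q)_{r-m} (q)_{s+m}`, the product being over `m = a, b, c`. -/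
def ker (q : ℂ) (r s a b c : ℤ) : ℂ :=
  qp q (r + s) * (rq q (r - a) * rq q (s + a)) * (rq q (r - b) * rq q (s + b)) *
    (rq q (r - c) * rq q (s + c))

/-- The weight in the `A₂` Bailey lemma. -/
def baileyWeight (q : ℂ) (r s t : ℤ) : ℂ := q ^ (r ^ 2 - r * s + s ^ 2 - t * (r - s))

/-- The left-hand side of the `A₂` Bailey lemma, summed over a large box. -/
def baileySum (q : ℂ) (X : Finset ℤ) (L M a b c : ℤ) : ℂ :=
  ∑ r ∈ X, ∑ s ∈ X, baileyWeight q r s (a + b + c) * (rq q (L - r) * rq q (M - s) *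
    ker q r s a b c)

/-- The second elementary symmetric function. -/
def esymm2 (a b c : ℤ) : ℤ := a * b + a * c + b * c

section Bailey

variable {q : ℂ}

lemma ker_swap12 (r s a b c : ℤ) : ker q r s a b c = ker q r s b a c := by
  simp only [ker]; ring

lemma ker_swap13 (r s a b c : ℤ) : ker q r s a b c = ker q r s c b a := by
  simp only [ker]; ring

lemma ker_eq_zero_of_lt {r s a b c : ℤ} (h : r < a ∨ r < b ∨ r < c) : ker q r s a b c = 0 := by
  rcases h with h | h | h
  · rw [ker, rq_neg (n := r - a) (by omega)]; ring
  · rw [ker, rq_neg (n := r - b) (by omega)]; ring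
  · rw [ker, rq_neg (n := r - c) (by omega)]; ring

lemma ker_eq_zero_of_lt' {r s a b c : ℤ} (h : s < -a ∨ s < -b ∨ s < -c) :
    ker q r s a b c = 0 := by
  rcases h with h | h | h
  · rw [ker, rq_neg (n := s + a) (by omega)]; ring
  · rw [ker, rq_neg (n := s + b) (by omega)]; ring
  · rw [ker, rq_neg (n := s + c) (by omega)]; ring

lemma baileySum_swap12 (X : Finset ℤ) (L M a b c : ℤ) :
    baileySum q X L M a b c = baileySum q X L M b a c := by
  simp only [baileySum]
  refine Finset.sum_congr rfl fun r _ => Finset.sum_congr rfl fun s _ => ?_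
  rw [ker_swap12, add_comm a b]

lemma baileySum_swap13 (X : Finset ℤ) (L M a b c : ℤ) :
    baileySum q X L M a b c = baileySum q X L M c b a := by
  simp only [baileySum]
  refine Finset.sum_congr rfl fun r _ => Finset.sum_congr rfl fun s _ => ?_
  rw [ker_swap13, show a + b + c = c + b + a by ring]

variable [hq : Nome q]

lemma rq_sub_rq (n : ℤ) : rq q n - rq q (n - 1) = q ^ n * rq q n := by
  rw [← rq_rec]; ring

lemma ker_raise (r s a b c : ℤ) :
    (1 - q ^ (s + a + 1)) * ker q r s (a + 1) b c = (1 - q ^ (r - a)) * ker q r s a b c := by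
  have r1 := rq_rec (q := q) (s + a + 1)
  have r2 := rq_rec (q := q) (r - a)
  rw [show s + a + 1 - 1 = s + a by ring] at r1
  rw [ker, ker, ← r1, show r - (a + 1) = r - a - 1 by ring, ← r2,
    show s + (a + 1) = s + a + 1 by ring]
  ring

lemma baileySum_rec (X : Finset ℤ) (L M a b c : ℤ) :
    q ^ (-L) * (baileySum q X L M a b c - baileySum q X (L - 1) M a b c) -
        q ^ (-a) * baileySum q X L M a b c =
      q ^ (-M) * (baileySum q X L M (a + 1) b c - baileySum q X L (M - 1) (a + 1) b c) -
        q ^ (a + 1) * baileySum q X L M (a + 1) b c := by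
  simp only [baileySum, mul_sub, Finset.mul_sum, ← Finset.sum_sub_distrib]
  refine Finset.sum_congr rfl fun r _ => Finset.sum_congr rfl fun s _ => ?_
  have e1 := rq_sub_rq (q := q) (L - r)
  have e2 := rq_sub_rq (q := q) (M - s)
  have e3 := ker_raise (q := q) r s a b c
  have w : baileyWeight q r s (a + b + c) * q ^ s =
      baileyWeight q r s (a + 1 + b + c) * q ^ r := by
    rw [baileyWeight, baileyWeight, ← zpow_add₀ hq.ne_zero, ← zpow_add₀ hq.ne_zero]
    congr 1
    ring
  rw [show L - 1 - r = L - r - 1 by ring, show M - 1 - s = M - s - 1 by ring]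
  have hr := zpow_ne_zero r hq.ne_zero
  have hs := zpow_ne_zero s hq.ne_zero
  have w' : baileyWeight q r s (a + 1 + b + c) =
      baileyWeight q r s (a + b + c) * q ^ s * (q ^ r)⁻¹ := by
    rw [w]; field_simp
  rw [w', zpow_neg, zpow_neg, zpow_neg]
  rw [zpow_sub₀ hq.ne_zero] at e1 e2 e3
  rw [zpow_add₀ hq.ne_zero, zpow_add₀ hq.ne_zero, zpow_one] at e3
  rw [zpow_add₀ hq.ne_zero, zpow_one]
  have hL := zpow_ne_zero L hq.ne_zero
  have hM := zpow_ne_zero M hq.ne_zero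
  have ha := zpow_ne_zero a hq.ne_zero
  have f1 : rq q (L - r - 1) = rq q (L - r) * (1 - q ^ L / q ^ r) := by linear_combination -e1
  have f2 : rq q (M - s - 1) = rq q (M - s) * (1 - q ^ M / q ^ s) := by linear_combination -e2
  rw [f1, f2]
  generalize baileyWeight q r s (a + b + c) = ω
  generalize ker q r s (a + 1) b c = k1 at *
  generalize ker q r s a b c = k0 at *
  generalize rq q (L - r) = x1
  generalize rq q (M - s) = x2
  generalize q ^ r = R at *
  generalize q ^ s = S at *
  generalize q ^ L = y1 at *
  generalize q ^ M = y2 at *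
  generalize q ^ a = A at *
  have : ω * x1 * x2 * R⁻¹ * ((1 - S * A * q) * k1 - (1 - R / A) * k0) = 0 := by rw [e3]; ring
  field_simp at this ⊢
  linear_combination (-(y1 * y2)) * this

/-- The closed form of the Bailey sum. -/
def baileyValue (q : ℂ) (L M a b c : ℤ) : ℂ := q ^ (-esymm2 a b c) * ker q L M a b c

omit hq in
lemma baileyValue_swap12 (L M a b c : ℤ) :
    baileyValue q L M a b c = baileyValue q L M b a c := by
  rw [baileyValue, baileyValue, ker_swap12, show esymm2 a b c = esymm2 b a c by
    simp only [esymm2]; ring]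

omit hq in
lemma baileyValue_swap13 (L M a b c : ℤ) :
    baileyValue q L M a b c = baileyValue q L M c b a := by
  rw [baileyValue, baileyValue, ker_swap13, show esymm2 a b c = esymm2 c b a by
    simp only [esymm2]; ring]

lemma baileyValue_rec {L M a : ℤ} (b c : ℤ) (h : 1 ≤ L + M) :
    q ^ (-L) * (baileyValue q L M a b c - baileyValue q (L - 1) M a b c) -
        q ^ (-a) * baileyValue q L M a b c =
      q ^ (-M) * (baileyValue q L M (a + 1) b c - baileyValue q L (M - 1) (a + 1) b c) -
        q ^ (a + 1) * baileyValue q L M (a + 1) b c := by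
  have h1 := qp_rec (q := q) h
  have g1 := rq_rec (q := q) (L - a)
  have g2 := rq_rec (q := q) (L - b)
  have g3 := rq_rec (q := q) (L - c)
  have g4 := rq_rec (q := q) (M + a + 1)
  have g5 := rq_rec (q := q) (M + b)
  have g6 := rq_rec (q := q) (M + c)
  rw [show M + a + 1 - 1 = M + a by ring] at g4
  have e : q ^ (-esymm2 (a + 1) b c) = q ^ (-esymm2 a b c) * (q ^ b)⁻¹ * (q ^ c)⁻¹ := by
    rw [← zpow_neg, ← zpow_neg, ← zpow_add₀ hq.ne_zero, ← zpow_add₀ hq.ne_zero]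
    congr 1
    simp only [esymm2]; ring
  simp only [baileyValue, ker, e, show L - 1 + M = L + M - 1 by ring,
    show L + (M - 1) = L + M - 1 by ring, show L - (a + 1) = L - a - 1 by ring,
    show M + (a + 1) = M + a + 1 by ring, show M - 1 + (a + 1) = M + a by ring,
    show L - 1 - a = L - a - 1 by ring, show L - 1 - b = L - b - 1 by ring,
    show L - 1 - c = L - c - 1 by ring, show M - 1 + b = M + b - 1 by ring,
    show M - 1 + c = M + c - 1 by ring, ← g1, ← g2, ← g3, ← g4, ← g5, ← g6, h1]
  simp only [zpow_neg, zpow_add₀ hq.ne_zero, zpow_sub₀ hq.ne_zero, zpow_one]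
  have hL := zpow_ne_zero L hq.ne_zero
  have hM := zpow_ne_zero M hq.ne_zero
  have ha := zpow_ne_zero a hq.ne_zero
  have hb := zpow_ne_zero b hq.ne_zero
  have hc := zpow_ne_zero c hq.ne_zero
  generalize q ^ L = y1 at *
  generalize q ^ M = y2 at *
  generalize q ^ a = A at *
  generalize q ^ b = B at *
  generalize q ^ c = C at *
  field_simp
  ring

omit hq in
lemma sum_eq_sum_range_shift (X : Finset ℤ) (f : ℤ → ℂ) (d : ℤ) (R : ℕ)
    (h1 : ∀ s, f s ≠ 0 → 0 ≤ s - d ∧ s - d < R) (h2 : ∀ s, f s ≠ 0 → s ∈ X) :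
    ∑ s ∈ X, f s = ∑ v ∈ Finset.range R, f (v + d) := by
  symm
  refine Finset.sum_bij_ne_zero (fun v _ _ => (v : ℤ) + d) (fun v _ h => h2 _ h)
    (fun v _ _ w _ _ h => by simpa using h) (fun s _ h => ?_) (fun _ _ _ => rfl)
  have := h1 s h
  refine ⟨(s - d).toNat, Finset.mem_range.mpr (by omega), ?_, by omega⟩
  rwa [show ((s - d).toNat : ℤ) + d = s by omega]

lemma baileySum_diag {C L M : ℤ} (h1 : -C ≤ L) (h2 : L ≤ C) (h3 : M ≤ C) (h4 : 0 ≤ L + M) :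
    baileySum q (Finset.Icc (-C) C) L M L L L = baileyValue q L M L L L := by
  rw [baileySum, Finset.sum_eq_single L]
  · have hs : ∀ s, baileyWeight q L s (L + L + L) * (rq q (L - L) * rq q (M - s) *
        ker q L s L L L) = q ^ (-(2 * L ^ 2) + s * (s + 2 * L)) *
          (rq q (M - s) * rq q (s + L) ^ 2) := by
      intro s
      rcases lt_or_ge (s + L) 0 with h | h
      · rw [ker, rq_neg h]; ring
      · have := qp_mul_rq (q := q) h
        rw [ker, baileyWeight, sub_self, rq_zero, add_comm L s,
          show L ^ 2 - L * s + s ^ 2 - (L + L + L) * (L - s) = -(2 * L ^ 2) + s * (s + 2 * L) by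
            ring]
        linear_combination q ^ (-(2 * L ^ 2) + s * (s + 2 * L)) * rq q (M - s) *
          rq q (s + L) ^ 2 * this
    rw [Finset.sum_congr rfl fun s _ => hs s, sum_eq_sum_range_shift _ _ (-L) (L + M + 1).toNat]
    · have := vandermonde (q := q) (u := L + M) (R := (L + M + 1).toNat) (by omega) 0
      simp only [add_zero] at this
      rw [baileyValue, ker, sub_self, rq_zero, show esymm2 L L L = 3 * L ^ 2 by
        simp only [esymm2]; ring, add_comm M L]
      have h5 := qp_mul_rq (q := q) h4
      have h6 : ∀ v : ℕ, q ^ (-(2 * L ^ 2) + ((v : ℤ) + -L) * (v + -L + 2 * L)) *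
          (rq q (M - (v + -L)) * rq q (v + -L + L) ^ 2) = q ^ (-(3 * L ^ 2)) *
          (q ^ ((v : ℤ) * v) * (rq q (L + M - v) * rq q v * rq q v)) := by
        intro v
        rw [zpow_split (q := q) (a := -(2 * L ^ 2) + ((v : ℤ) + -L) * (v + -L + 2 * L))
          (b := -(3 * L ^ 2)) (c := v * v) (by ring), show M - ((v : ℤ) + -L) = L + M - v by ring,
          show (v : ℤ) + -L + L = v by ring]
        ring
      rw [Finset.sum_congr rfl fun v _ => h6 v, ← Finset.mul_sum, this]
      linear_combination (-(q ^ (-(3 * L ^ 2)) * rq q (L + M) ^ 2)) * h5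
    · intro s h
      constructor
      · by_contra h'
        rw [rq_neg (n := s + L) (by omega)] at h
        simp at h
      · by_contra h'
        rw [rq_neg (n := M - s) (by omega)] at h
        simp at h
    · intro s h
      rw [Finset.mem_Icc]
      constructor
      · by_contra h'
        rw [rq_neg (n := s + L) (by omega)] at h
        simp at h
      · by_contra h'
        rw [rq_neg (n := M - s) (by omega)] at h
        simp at h
  · intro r _ hr
    refine Finset.sum_eq_zero fun s _ => ?_
    rcases lt_or_gt_of_ne hr with h | h
    · rw [ker_eq_zero_of_lt (by omega)]; ring
    · rw [rq_neg (n := L - r) (by omega)]; ring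
  · intro h
    exact absurd (Finset.mem_Icc.mpr ⟨h1, h2⟩) h

lemma baileySum_step {X : Finset ℤ} {L M a b c : ℤ} (ha : a < L) (hM : -a ≤ M)
    (h1 : baileySum q X (L - 1) M a b c = baileyValue q (L - 1) M a b c)
    (h2 : baileySum q X L M (a + 1) b c = baileyValue q L M (a + 1) b c)
    (h3 : baileySum q X L (M - 1) (a + 1) b c = baileyValue q L (M - 1) (a + 1) b c) :
    baileySum q X L M a b c = baileyValue q L M a b c := by
  have e1 := baileySum_rec (q := q) X L M a b c
  have e2 := baileyValue_rec (q := q) (L := L) (M := M) (a := a) b c (by omega)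
  rw [h1, h2, h3, ← e2] at e1
  have h : q ^ (-L) - q ^ (-a) ≠ 0 := by
    rw [zpow_split (q := q) (a := -a) (b := -L) (c := L - a) (by ring)]
    have := mul_ne_zero (zpow_ne_zero (-L) hq.ne_zero)
      (one_sub_zpow_ne_zero (q := q) (n := L - a) (by omega))
    intro h
    apply this
    rw [← h]; ring
  apply mul_left_cancel₀ h
  linear_combination e1

lemma baileySum_eq_baileyValue (C : ℤ) (n : ℕ) : ∀ L M a b c : ℤ, (3 * L - a - b - c).toNat = n →
    -C ≤ a → -C ≤ b → -C ≤ c → L ≤ C → M ≤ C →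
    baileySum q (Finset.Icc (-C) C) L M a b c = baileyValue q L M a b c := by
  induction n using Nat.strong_induction_on with
  | _ n ih =>
    intro L M a b c hn ha hb hc hL hM
    by_cases h1 : L < a ∨ L < b ∨ L < c
    · rw [baileyValue, ker_eq_zero_of_lt h1, mul_zero]
      refine Finset.sum_eq_zero fun r _ => Finset.sum_eq_zero fun s _ => ?_
      rcases lt_or_ge L r with h | h
      · rw [rq_neg (n := L - r) (by omega)]; ring
      · rw [ker_eq_zero_of_lt (by omega)]; ring
    by_cases h2 : M < -a ∨ M < -b ∨ M < -c
    · rw [baileyValue, ker_eq_zero_of_lt' h2, mul_zero]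
      refine Finset.sum_eq_zero fun r _ => Finset.sum_eq_zero fun s _ => ?_
      rcases lt_or_ge M s with h | h
      · rw [rq_neg (n := M - s) (by omega)]; ring
      · rw [ker_eq_zero_of_lt' (by omega)]; ring
    push Not at h1 h2
    by_cases h3 : a = L ∧ b = L ∧ c = L
    · obtain ⟨rfl, rfl, rfl⟩ := h3
      exact baileySum_diag (by omega) hL hM (by omega)
    have step : ∀ a b c : ℤ, (3 * L - a - b - c).toNat = n → -C ≤ a → -C ≤ b → -C ≤ c → a < L →
        b ≤ L → c ≤ L → -a ≤ M →
        baileySum q (Finset.Icc (-C) C) L M a b c = baileyValue q L M a b c := by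
      intro a b c hn ha hb hc h1 h2 h3 h4
      exact baileySum_step h1 h4
        (ih _ (by omega) (L - 1) M a b c rfl (by omega) (by omega) (by omega) (by omega) (by omega))
        (ih _ (by omega) L M (a + 1) b c rfl (by omega) (by omega) (by omega) (by omega) (by omega))
        (ih _ (by omega) L (M - 1) (a + 1) b c rfl (by omega) (by omega) (by omega) (by omega)
          (by omega))
    by_cases h4 : a < L
    · exact step a b c (by omega) ha hb hc h4 (by omega) (by omega) (by omega)
    by_cases h5 : b < L
    · rw [baileySum_swap12, baileyValue_swap12]
      exact step b a c (by omega) hb ha hc h5 (by omega) (by omega) (by omega)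
    · rw [baileySum_swap13, baileyValue_swap13]
      exact step c b a (by omega) hc hb ha (by omega) (by omega) (by omega) (by omega)

/-- The `A₂` Bailey lemma. -/
lemma bailey {α β a b c L M : ℤ} {R R' : ℕ} (h1 : α ≤ a ∨ α ≤ b ∨ α ≤ c)
    (h2 : a ≤ -β ∨ b ≤ -β ∨ c ≤ -β) (hL : L < R) (hM : M < R') :
    ∑ r ∈ Finset.range R, ∑ s ∈ Finset.range R',
      baileyWeight q (r + α) (s + β) (a + b + c) * (rq q (L - r) * rq q (M - s) *
        ker q (r + α) (s + β) a b c) =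
      q ^ (-esymm2 a b c) * ker q (L + α) (M + β) a b c := by
  obtain ⟨C, hC⟩ : ∃ C : ℤ, -C ≤ a ∧ -C ≤ b ∧ -C ≤ c ∧ L + α ≤ C ∧ M + β ≤ C ∧
      -C ≤ α ∧ -C ≤ β :=
    ⟨|a| + |b| + |c| + |L + α| + |M + β| + |α| + |β|, by
      have := neg_abs_le a
      have := neg_abs_le b
      have := neg_abs_le c
      have := le_abs_self (L + α)
      have := le_abs_self (M + β)
      have := neg_abs_le α
      have := neg_abs_le β
      have := abs_nonneg a
      have := abs_nonneg b
      have := abs_nonneg c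
      have := abs_nonneg α
      have := abs_nonneg β
      have := abs_nonneg (L + α)
      have := abs_nonneg (M + β)
      refine ⟨?_, ?_, ?_, ?_, ?_, ?_, ?_⟩ <;> linarith⟩
  obtain ⟨c1, c2, c3, c4, c5, c6, c7⟩ := hC
  have := baileySum_eq_baileyValue (q := q) C _ (L + α) (M + β) a b c rfl c1 c2 c3 c4 c5
  rw [← baileyValue, ← this, baileySum]
  have inner : ∀ r : ℤ, ∑ s ∈ Finset.Icc (-C) C, baileyWeight q r s (a + b + c) *
      (rq q (L + α - r) * rq q (M + β - s) * ker q r s a b c) =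
      ∑ s ∈ Finset.range R', baileyWeight q r (s + β) (a + b + c) *
      (rq q (L + α - r) * rq q (M - s) * ker q r (s + β) a b c) := by
    intro r
    rw [sum_eq_sum_range_shift _ _ β R']
    · refine Finset.sum_congr rfl fun s _ => ?_
      rw [show M + β - (s + β) = M - s by ring]
    · intro s h
      constructor
      · by_contra h'
        rw [ker_eq_zero_of_lt' (by omega)] at h
        simp at h
      · by_contra h'
        rw [rq_neg (n := M + β - s) (by omega)] at h
        simp at h
    · intro s h
      rw [Finset.mem_Icc]
      constructor
      · by_contra h'
        rw [ker_eq_zero_of_lt' (by omega)] at h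
        simp at h
      · by_contra h'
        rw [rq_neg (n := M + β - s) (by omega)] at h
        simp at h
  rw [Finset.sum_congr rfl fun r _ => inner r, sum_eq_sum_range_shift _ _ α R]
  · refine Finset.sum_congr rfl fun r _ => Finset.sum_congr rfl fun s _ => ?_
    rw [show L + α - (r + α) = L - r by ring]
  · intro r h
    obtain ⟨s, _, h⟩ := Finset.exists_ne_zero_of_sum_ne_zero h
    constructor
    · by_contra h'
      rw [ker_eq_zero_of_lt (by omega)] at h
      simp at h
    · by_contra h'
      rw [rq_neg (n := L + α - r) (by omega)] at h
      simp at h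
  · intro r h
    obtain ⟨s, _, h⟩ := Finset.exists_ne_zero_of_sum_ne_zero h
    rw [Finset.mem_Icc]
    constructor
    · by_contra h'
      rw [ker_eq_zero_of_lt (by omega)] at h
      simp at h
    · by_contra h'
      rw [rq_neg (n := L + α - r) (by omega)] at h
      simp at h

end Bailey

/-- The numerator attached to one permutation in the recursion for the seed sum. -/
def seedNum (R S p a b c : ℂ) : ℂ :=
  b * c * ((1 - S * a) * (1 - S * a * p) * (1 - S * a * p ^ 2) *
    ((c - R) * (c - R * p) * (c - R * p ^ 2))) *
      (S ^ 2 * R * b ^ 2 - (S * R + S ^ 2 * R ^ 2) * b + S * R ^ 2)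

lemma seedNum_alternating (R S p u v w : ℂ) :
    (u - v) * (v - w) * (u - w) *
      ((1 - S * u) * (1 - S * v) * (1 - S * w) * ((u - R) * (v - R) * (w - R)) -
      (1 - R * S * p) * (1 - R * S * p ^ 2) *
        ((1 - S * u) * (1 - S * v) * (1 - S * w) * (u * v * w) + (u - R) * (v - R) * (w - R)) +
      (1 - R * S) * (1 - R * S * p) ^ 2 * (1 - R * S * p ^ 2) ^ 2 * (u * v * w)) =
    seedNum R S p u v w - seedNum R S p w v u + seedNum R S p v w u - seedNum R S p u w v +
      seedNum R S p w u v - seedNum R S p v u w := by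
  simp only [seedNum]
  ring

/-- The first coordinate of the vector `(n₁, n₂, n₃) = (3x + 1, 3y, -3x - 3y - 1)` of the shifted
root lattice. -/
def lat1 (κ : ℤ × ℤ) : ℤ := 3 * κ.1 + 1

/-- The second coordinate of the lattice vector. -/
def lat2 (κ : ℤ × ℤ) : ℤ := 3 * κ.2

/-- The third coordinate of the lattice vector. -/
def lat3 (κ : ℤ × ℤ) : ℤ := -3 * κ.1 - 3 * κ.2 - 1

/-- The quadratic form on the lattice, normalised by `3 * latQ = -e₂(n) - 1`. -/
def latQ (κ : ℤ × ℤ) : ℤ := 3 * κ.1 ^ 2 + 3 * κ.2 ^ 2 + 3 * κ.1 * κ.2 + 2 * κ.1 + κ.2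

lemma lat_sum (κ : ℤ × ℤ) : lat1 κ + lat2 κ + lat3 κ = 0 := by simp only [lat1, lat2, lat3]; ring

lemma esymm2_lat (κ : ℤ × ℤ) : esymm2 (lat1 κ) (lat2 κ) (lat3 κ) = -(3 * latQ κ) - 1 := by
  simp only [esymm2, lat1, lat2, lat3, latQ]; ring

/-- The Vandermonde product `q² (u₁ - u₂) (u₂ - u₃) (u₃ - u₁)` with `uᵢ = q ^ nᵢ`. -/
def latDelta (q : ℂ) (κ : ℤ × ℤ) : ℂ :=
  q ^ 2 * ((q ^ lat1 κ - q ^ lat2 κ) * (q ^ lat2 κ - q ^ lat3 κ) * (q ^ lat3 κ - q ^ lat1 κ))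

lemma summable_of_box {f : ℤ × ℤ → ℂ} (C : ℤ)
    (h : ∀ κ, f κ ≠ 0 → (-C ≤ κ.1 ∧ κ.1 ≤ C) ∧ (-C ≤ κ.2 ∧ κ.2 ≤ C)) : Summable f := by
  refine summable_of_hasFiniteSupport ((Finset.Icc (-C) C ×ˢ Finset.Icc (-C) C).finite_toSet.subset ?_)
  intro κ hκ
  have := h κ hκ
  simpa only [Finset.coe_product, Finset.coe_Icc, Set.mem_prod, Set.mem_Icc] using this

/-- Kernels shifted along the lattice have finite support. -/
lemma summable_ker (q : ℂ) (c : ℤ × ℤ → ℂ) (r s i j l : ℤ) :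
    Summable fun κ => c κ * ker q r s (lat1 κ + i) (lat2 κ + j) (lat3 κ + l) := by
  refine summable_of_box (|r| + |s| + |i| + |j| + |l| + 1) fun κ h => ?_
  have h1 : ¬ (r < lat1 κ + i ∨ r < lat2 κ + j ∨ r < lat3 κ + l) := fun h' => by
    rw [ker_eq_zero_of_lt h', mul_zero] at h; exact h rfl
  have h2 : ¬ (s < -(lat1 κ + i) ∨ s < -(lat2 κ + j) ∨ s < -(lat3 κ + l)) := fun h' => by
    rw [ker_eq_zero_of_lt' h', mul_zero] at h; exact h rfl
  simp only [lat1, lat2, lat3] at h1 h2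
  rcases abs_cases r with ⟨e1, _⟩ | ⟨e1, _⟩ <;> rcases abs_cases s with ⟨e2, _⟩ | ⟨e2, _⟩ <;>
  rcases abs_cases i with ⟨e3, _⟩ | ⟨e3, _⟩ <;> rcases abs_cases j with ⟨e4, _⟩ | ⟨e4, _⟩ <;>
  rcases abs_cases l with ⟨e5, _⟩ | ⟨e5, _⟩ <;> rw [e1, e2, e3, e4, e5] <;> omega

/-- One of the six terms whose alternating sum telescopes over the lattice. -/
def seedTerm (q : ℂ) (r s a b c e : ℤ) : ℂ :=
  q ^ (2 * (c - a) + 4 * e) * (rq q (r - a) * rq q (s + a - 3)) *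
    (rq q (r - c - 3) * rq q (s + c)) * (rq q (r - b) * rq q (s + b)) *
      ((q ^ s) ^ 2 * q ^ r * q ^ b - (q ^ s * q ^ r + (q ^ s) ^ 2 * (q ^ r) ^ 2) +
        q ^ s * (q ^ r) ^ 2 * q ^ (-b))

lemma seedTerm_reflect (q : ℂ) (r s a b c e : ℤ) :
    seedTerm q r s a b c e = seedTerm q r s (c + 3) b (a - 3) (e + c - a + 3) := by
  rw [seedTerm, seedTerm, show 2 * (a - 3 - (c + 3)) + 4 * (e + c - a + 3) =
    2 * (c - a) + 4 * e by ring, show s + (c + 3) - 3 = s + c by ring,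
    show r - (a - 3) - 3 = r - a by ring, show r - (c + 3) = r - c - 3 by ring,
    show s + (a - 3) = s + a - 3 by ring]
  ring

section Seed

variable {q : ℂ} [hq : Nome q]

omit hq in
lemma seedTerm_bound {r s a b c e : ℤ} (h : seedTerm q r s a b c e ≠ 0) :
    (3 - s ≤ a ∧ a ≤ r) ∧ (-s ≤ b ∧ b ≤ r) ∧ (-s ≤ c ∧ c ≤ r - 3) := by
  refine ⟨⟨?_, ?_⟩, ⟨?_, ?_⟩, ?_, ?_⟩ <;> by_contra h' <;> apply h <;> rw [seedTerm]
  · rw [rq_neg (n := s + a - 3) (by omega)]; ring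
  · rw [rq_neg (n := r - a) (by omega)]; ring
  · rw [rq_neg (n := s + b) (by omega)]; ring
  · rw [rq_neg (n := r - b) (by omega)]; ring
  · rw [rq_neg (n := s + c) (by omega)]; ring
  · rw [rq_neg (n := r - c - 3) (by omega)]; ring

omit hq in
/-- The six lattice sums are well defined and equal in pairs. -/
lemma seedTerm_sums (r s : ℤ) (i j l : ℤ × ℤ → ℤ) (v : ℤ × ℤ)
    (hi : ∀ κ, i (κ + v) = i κ - 3) (hj : ∀ κ, j (κ + v) = j κ) (hl : ∀ κ, l (κ + v) = l κ + 3)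
    (hQ : ∀ κ, latQ (κ + v) = latQ κ + l κ - i κ + 3)
    (hb : ∀ κ, ∀ C : ℤ, -C ≤ i κ ∧ i κ ≤ C → -C ≤ j κ ∧ j κ ≤ C → -C ≤ l κ ∧ l κ ≤ C →
      (-C - 1 ≤ κ.1 ∧ κ.1 ≤ C + 1) ∧ (-C - 1 ≤ κ.2 ∧ κ.2 ≤ C + 1)) :
    ∃ S, HasSum (fun κ => seedTerm q r s (i κ) (j κ) (l κ) (latQ κ)) S ∧
      HasSum (fun κ => seedTerm q r s (l κ) (j κ) (i κ) (latQ κ)) S := by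
  have hs : Summable fun κ => seedTerm q r s (i κ) (j κ) (l κ) (latQ κ) := by
    refine summable_of_box (|r| + |s| + 5) fun κ h => ?_
    obtain ⟨h1, h2, h3⟩ := seedTerm_bound h
    have := hb κ (|r| + |s| + 4)
    have a1 := le_abs_self r
    have a2 := le_abs_self s
    have a3 := neg_abs_le r
    have a4 := neg_abs_le s
    have := this (by omega) (by omega) (by omega)
    omega
  refine ⟨_, hs.hasSum, ?_⟩
  rw [← (Equiv.addRight v).hasSum_iff]
  convert hs.hasSum using 1
  funext κ
  simp only [Function.comp, Equiv.coe_addRight, hi, hj, hl, hQ]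
  exact (seedTerm_reflect q r s _ _ _ _).symm

lemma rq_sub_three (n : ℤ) : rq q (n - 3) =
    (1 - q ^ n) * (1 - q ^ n * q⁻¹) * (1 - q ^ n * q⁻¹ ^ 2) * rq q n := by
  have r1 := rq_rec (q := q) n
  have r2 := rq_rec (q := q) (n - 1)
  have r3 := rq_rec (q := q) (n - 2)
  rw [show n - 1 - 1 = n - 2 by ring] at r2
  rw [show n - 2 - 1 = n - 3 by ring] at r3
  have h0 := hq.ne_zero
  rw [← r3, ← r2, ← r1, zpow_sub₀ h0, zpow_sub₀ h0, zpow_one, zpow_ofNat]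
  field_simp

lemma seedTerm_eq {a b c : ℤ} (h : a + b + c = 0) (r s e : ℤ) :
    seedTerm q r s a b c e = q ^ (4 * e) * ((rq q (r - a) * rq q (s + a)) *
      (rq q (r - b) * rq q (s + b)) * (rq q (r - c) * rq q (s + c))) *
        seedNum (q ^ r) (q ^ s) q⁻¹ (q ^ a) (q ^ b) (q ^ c) := by
  have h0 := hq.ne_zero
  have hu : q ^ a * q ^ b * q ^ c = 1 := by
    rw [← zpow_add₀ h0, ← zpow_add₀ h0, h, zpow_zero]
  have ha := zpow_ne_zero a h0
  have hb := zpow_ne_zero b h0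
  have hc := zpow_ne_zero c h0
  have e1 : q ^ (2 * (c - a) + 4 * e) = (q ^ c) ^ 2 / (q ^ a) ^ 2 * q ^ (4 * e) := by
    rw [zpow_add₀ h0, ← zpow_natCast, ← zpow_natCast, ← zpow_mul, ← zpow_mul, ← zpow_sub₀ h0]
    congr 2
    push_cast
    ring
  rw [seedTerm, seedNum, rq_sub_three, rq_sub_three, e1, zpow_neg, zpow_add₀ h0, zpow_sub₀ h0]
  have f1 : (1 - q ^ r / q ^ c) * (1 - q ^ r / q ^ c * q⁻¹) * (1 - q ^ r / q ^ c * q⁻¹ ^ 2) =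
      (q ^ c - q ^ r) * (q ^ c - q ^ r * q⁻¹) * (q ^ c - q ^ r * q⁻¹ ^ 2) * ((q ^ c)⁻¹) ^ 3 := by
    field_simp
  have f2 : (q ^ s) ^ 2 * q ^ r * q ^ b - (q ^ s * q ^ r + (q ^ s) ^ 2 * (q ^ r) ^ 2) +
      q ^ s * (q ^ r) ^ 2 * (q ^ b)⁻¹ = ((q ^ s) ^ 2 * q ^ r * (q ^ b) ^ 2 -
        (q ^ s * q ^ r + (q ^ s) ^ 2 * (q ^ r) ^ 2) * q ^ b + q ^ s * (q ^ r) ^ 2) * (q ^ b)⁻¹ := by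
    field_simp
  have f3 : (q ^ c) ^ 2 / (q ^ a) ^ 2 * ((q ^ c)⁻¹) ^ 3 * (q ^ b)⁻¹ = q ^ b * q ^ c := by
    field_simp
    linear_combination (-(1 + q ^ a * q ^ b * q ^ c)) * hu
  rw [f1, f2]
  generalize rq q (r - a) = x1
  generalize rq q (r - b) = x2
  generalize rq q (r - c) = x3
  generalize rq q (s + a) = x4
  generalize rq q (s + b) = x5
  generalize rq q (s + c) = x6
  rw [← f3]
  generalize (q ^ c) ^ 2 / (q ^ a) ^ 2 = y1
  generalize ((q ^ c)⁻¹) ^ 3 = y2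
  generalize (q ^ b)⁻¹ = y3
  generalize (q ^ s) ^ 2 * q ^ r * (q ^ b) ^ 2 -
        (q ^ s * q ^ r + (q ^ s) ^ 2 * (q ^ r) ^ 2) * q ^ b + q ^ s * (q ^ r) ^ 2 = y4
  generalize (q ^ c - q ^ r) * (q ^ c - q ^ r * q⁻¹) * (q ^ c - q ^ r * q⁻¹ ^ 2) = y5
  ring

lemma ker_pred_pred (r s a b c : ℤ) (h : a + b + c = 0) (hN : 2 ≤ r + s) :
    (q ^ a - q ^ b) * (q ^ b - q ^ c) * (q ^ a - q ^ c) *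
      (ker q (r - 1) (s - 1) a b c -
        (1 - q ^ r * q ^ s * q⁻¹ ^ 2) * (ker q r (s - 1) a b c + ker q (r - 1) s a b c) +
        (1 - q ^ r * q ^ s * q⁻¹) * (1 - q ^ r * q ^ s * q⁻¹ ^ 2) ^ 2 * ker q r s a b c) =
    qp q (r + s - 2) * ((rq q (r - a) * rq q (s + a)) *
      (rq q (r - b) * rq q (s + b)) * (rq q (r - c) * rq q (s + c))) *
    (seedNum (q ^ r) (q ^ s) q⁻¹ (q ^ a) (q ^ b) (q ^ c) -
      seedNum (q ^ r) (q ^ s) q⁻¹ (q ^ c) (q ^ b) (q ^ a) +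
      seedNum (q ^ r) (q ^ s) q⁻¹ (q ^ b) (q ^ c) (q ^ a) -
      seedNum (q ^ r) (q ^ s) q⁻¹ (q ^ a) (q ^ c) (q ^ b) +
      seedNum (q ^ r) (q ^ s) q⁻¹ (q ^ c) (q ^ a) (q ^ b) -
      seedNum (q ^ r) (q ^ s) q⁻¹ (q ^ b) (q ^ a) (q ^ c)) := by
  have h0 := hq.ne_zero
  have hu : q ^ a * q ^ b * q ^ c = 1 := by
    rw [← zpow_add₀ h0, ← zpow_add₀ h0, h, zpow_zero]
  have ha := zpow_ne_zero a h0
  have hb := zpow_ne_zero b h0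
  have hc := zpow_ne_zero c h0
  rw [← seedNum_alternating, hu]
  have p1 : qp q (r + s) = (1 - q ^ r * q ^ s) * qp q (r + s - 1) := by
    rw [← zpow_add₀ h0, qp_rec (by omega)]
  have p2 : qp q (r + s - 1) = (1 - q ^ r * q ^ s * q⁻¹) * qp q (r + s - 2) := by
    rw [← zpow_add₀ h0, ← zpow_sub_one₀ h0, qp_rec (by omega), show r + s - 1 - 1 = r + s - 2 by ring]
  have er : ∀ m : ℤ, rq q (r - 1 - m) = (1 - q ^ r / q ^ m) * rq q (r - m) := by
    intro m
    rw [← zpow_sub₀ h0, rq_rec, show r - 1 - m = r - m - 1 by ring]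
  have es : ∀ m : ℤ, rq q (s - 1 + m) = (1 - q ^ s * q ^ m) * rq q (s + m) := by
    intro m
    rw [← zpow_add₀ h0, rq_rec, show s - 1 + m = s + m - 1 by ring]
  set Q := (rq q (r - a) * rq q (s + a)) * (rq q (r - b) * rq q (s + b)) *
    (rq q (r - c) * rq q (s + c)) with hQ
  set PS := (1 - q ^ s * q ^ a) * (1 - q ^ s * q ^ b) * (1 - q ^ s * q ^ c) with hPS
  have e1 : (q ^ a - q ^ r) * (q ^ b - q ^ r) * (q ^ c - q ^ r) =
      (1 - q ^ r / q ^ a) * (1 - q ^ r / q ^ b) * (1 - q ^ r / q ^ c) := by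
    have : (1 - q ^ r / q ^ a) * (1 - q ^ r / q ^ b) * (1 - q ^ r / q ^ c) =
      (q ^ a - q ^ r) * (q ^ b - q ^ r) * (q ^ c - q ^ r) / (q ^ a * q ^ b * q ^ c) := by
      field_simp
    rw [this, hu, div_one]
  set PR := (q ^ a - q ^ r) * (q ^ b - q ^ r) * (q ^ c - q ^ r) with hPR
  have k0 : ker q r s a b c = qp q (r + s) * Q := by rw [ker, hQ]; ring
  have k1 : ker q (r - 1) s a b c = qp q (r + s - 1) * PR * Q := by
    rw [ker, hQ, e1, er, er, er, show r - 1 + s = r + s - 1 by ring]; ring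
  have k2 : ker q r (s - 1) a b c = qp q (r + s - 1) * PS * Q := by
    rw [ker, hQ, es, es, es, show r + (s - 1) = r + s - 1 by ring, hPS]; ring
  have k3 : ker q (r - 1) (s - 1) a b c = qp q (r + s - 2) * PS * PR * Q := by
    rw [ker, hQ, es, es, es, er, er, er, e1, show r - 1 + (s - 1) = r + s - 2 by ring, hPS]; ring
  rw [k0, k1, k2, k3, p1, p2]
  ring

/-- The left-hand side of the seed identity. -/
def seedSum (q : ℂ) (r s : ℤ) : ℂ :=
  ∑' κ, q ^ (4 * latQ κ) * latDelta q κ * ker q r s (lat1 κ) (lat2 κ) (lat3 κ)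

omit hq in
lemma hasSum_seedSum (r s : ℤ) :
    HasSum (fun κ => q ^ (4 * latQ κ) * latDelta q κ * ker q r s (lat1 κ) (lat2 κ) (lat3 κ))
      (seedSum q r s) := by
  have := summable_ker q (fun κ => q ^ (4 * latQ κ) * latDelta q κ) r s 0 0 0
  simp only [add_zero] at this
  exact this.hasSum

lemma seedSum_rec (r s : ℤ) (hN : 2 ≤ r + s) :
    seedSum q (r - 1) (s - 1) -
        (1 - q ^ r * q ^ s * q⁻¹ ^ 2) * (seedSum q r (s - 1) + seedSum q (r - 1) s) +
        (1 - q ^ r * q ^ s * q⁻¹) * (1 - q ^ r * q ^ s * q⁻¹ ^ 2) ^ 2 * seedSum q r s = 0 := by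
  have lhs := ((hasSum_seedSum (q := q) (r - 1) (s - 1)).sub
    (((hasSum_seedSum (q := q) r (s - 1)).add (hasSum_seedSum (q := q) (r - 1) s)).mul_left
      (1 - q ^ r * q ^ s * q⁻¹ ^ 2))).add ((hasSum_seedSum (q := q) r s).mul_left
      ((1 - q ^ r * q ^ s * q⁻¹) * (1 - q ^ r * q ^ s * q⁻¹ ^ 2) ^ 2))
  obtain ⟨A, a1, a2⟩ := seedTerm_sums (q := q) r s lat1 lat2 lat3 (-1, 0)
    (fun κ => by simp only [lat1, Prod.fst_add]; ring)
    (fun κ => by simp only [lat2, Prod.snd_add]; ring)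
    (fun κ => by simp only [lat3, Prod.fst_add, Prod.snd_add]; ring)
    (fun κ => by simp only [latQ, lat1, lat3, Prod.fst_add, Prod.snd_add]; ring)
    (fun κ C => by simp only [lat1, lat2, lat3]; omega)
  obtain ⟨B, b1, b2⟩ := seedTerm_sums (q := q) r s lat2 lat3 lat1 (1, -1)
    (fun κ => by simp only [lat2, Prod.snd_add]; ring)
    (fun κ => by simp only [lat3, Prod.fst_add, Prod.snd_add]; ring)
    (fun κ => by simp only [lat1, Prod.fst_add]; ring)
    (fun κ => by simp only [latQ, lat1, lat2, Prod.fst_add, Prod.snd_add]; ring)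
    (fun κ C => by simp only [lat1, lat2, lat3]; omega)
  obtain ⟨D, d1, d2⟩ := seedTerm_sums (q := q) r s lat3 lat1 lat2 (0, 1)
    (fun κ => by simp only [lat3, Prod.fst_add, Prod.snd_add]; ring)
    (fun κ => by simp only [lat1, Prod.fst_add]; ring)
    (fun κ => by simp only [lat2, Prod.snd_add]; ring)
    (fun κ => by simp only [latQ, lat3, lat2, Prod.fst_add, Prod.snd_add]; ring)
    (fun κ C => by simp only [lat1, lat2, lat3]; omega)
  have rhs := ((((((a1.sub a2).add b1).sub d2).add d1).sub b2).mul_left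
    (-(q ^ 2 * qp q (r + s - 2))))
  rw [show A - A + B - D + D - B = 0 by ring, mul_zero] at rhs
  rw [← lhs.tsum_eq, ← rhs.tsum_eq]
  refine tsum_congr fun κ => ?_
  have k := ker_pred_pred (q := q) r s _ _ _ (lat_sum κ) hN
  have h1 := lat_sum κ
  have e1 := seedTerm_eq (q := q) (a := lat1 κ) (b := lat2 κ) (c := lat3 κ) (by omega) r s (latQ κ)
  have e2 := seedTerm_eq (q := q) (a := lat3 κ) (b := lat2 κ) (c := lat1 κ) (by omega) r s (latQ κ)
  have e3 := seedTerm_eq (q := q) (a := lat2 κ) (b := lat3 κ) (c := lat1 κ) (by omega) r s (latQ κ)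
  have e4 := seedTerm_eq (q := q) (a := lat2 κ) (b := lat1 κ) (c := lat3 κ) (by omega) r s (latQ κ)
  have e5 := seedTerm_eq (q := q) (a := lat3 κ) (b := lat1 κ) (c := lat2 κ) (by omega) r s (latQ κ)
  have e6 := seedTerm_eq (q := q) (a := lat1 κ) (b := lat3 κ) (c := lat2 κ) (by omega) r s (latQ κ)
  rw [e1, e2, e3, e4, e5, e6, latDelta]
  generalize seedNum _ _ _ (q ^ lat1 κ) (q ^ lat2 κ) (q ^ lat3 κ) = w1 at *
  generalize seedNum _ _ _ (q ^ lat3 κ) (q ^ lat2 κ) (q ^ lat1 κ) = w2 at *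
  generalize seedNum _ _ _ (q ^ lat2 κ) (q ^ lat3 κ) (q ^ lat1 κ) = w3 at *
  generalize seedNum _ _ _ (q ^ lat2 κ) (q ^ lat1 κ) (q ^ lat3 κ) = w4 at *
  generalize seedNum _ _ _ (q ^ lat3 κ) (q ^ lat1 κ) (q ^ lat2 κ) = w5 at *
  generalize seedNum _ _ _ (q ^ lat1 κ) (q ^ lat3 κ) (q ^ lat2 κ) = w6 at *
  linear_combination (-(q ^ 2) * q ^ (4 * latQ κ)) * k

omit hq in
lemma seedSum_zero_left (s : ℤ) : seedSum q 0 s = 0 := by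
  refine (tsum_congr fun κ => ?_).trans tsum_zero
  have := lat_sum κ
  rw [ker_eq_zero_of_lt, mul_zero]
  simp only [lat1, lat2, lat3] at this ⊢
  omega

omit hq in
lemma seedSum_zero_right (r : ℤ) : seedSum q r 0 = 0 := by
  refine (tsum_congr fun κ => ?_).trans tsum_zero
  have := lat_sum κ
  rw [ker_eq_zero_of_lt', mul_zero]
  simp only [lat1, lat2, lat3] at this ⊢
  omega

lemma seedSum_one_one : seedSum q 1 1 = (1 - q)⁻¹ := by
  have h0 := hq.ne_zero
  rw [seedSum, tsum_eq_single (0, 0)]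
  · have h1 := one_sub_zpow_ne_zero (q := q) (n := 1) (by norm_num)
    have h2 := one_sub_zpow_ne_zero (q := q) (n := 2) (by norm_num)
    have r1 := rq_rec (q := q) 1
    have r2 := rq_rec (q := q) 2
    have p1 := qp_mul_rq (q := q) (n := 2) (by norm_num)
    have e : q ^ (4 * latQ (0, 0)) * latDelta q (0, 0) = (q - 1) ^ 2 * (1 - q ^ 2) := by
      simp only [latDelta, latQ, lat1, lat2, lat3]
      norm_num
      field_simp
    rw [e, ker]
    simp only [lat1, lat2, lat3]
    norm_num at r1 r2 p1 h1 h2 ⊢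
    have e1 : rq q 1 = (1 - q)⁻¹ := eq_inv_of_mul_eq_one_right r1
    have e2 : rq q 2 = (1 - q ^ 2)⁻¹ * (1 - q)⁻¹ := by
      rw [← e1, ← r2]; field_simp
    have e3 : qp q 2 * rq q 2 * rq q 2 = (1 - q ^ 2)⁻¹ * (1 - q)⁻¹ := by rw [p1, e2, one_mul]
    rw [e1]
    calc _ = (q - 1) ^ 2 * (1 - q ^ 2) * (qp q 2 * rq q 2 * rq q 2) * ((1 - q)⁻¹) ^ 2 := by ring
      _ = _ := by
        rw [e3]
        field_simp
        ring
  · intro κ hκ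
    rw [ker_eq_zero_of_lt, mul_zero]
    have : ¬ (κ.1 = 0 ∧ κ.2 = 0) := fun h => hκ (Prod.ext h.1 h.2)
    simp only [lat1, lat2, lat3]
    omega

lemma seedSum_eq_aux (n : ℕ) : ∀ r s : ℤ, 0 ≤ r → 0 ≤ s → r + s = n →
    seedSum q r s = rq q (r - 1) * rq q (s - 1) * rq q (r + s - 1) := by
  induction n using Nat.strong_induction_on with
  | _ n ih =>
    intro r s hr hs hn
    rcases hr.eq_or_lt with rfl | hr
    · rw [seedSum_zero_left, rq_neg (n := 0 - 1) (by omega)]; ring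
    rcases hs.eq_or_lt with rfl | hs
    · rw [seedSum_zero_right, rq_neg (n := 0 - 1) (by omega)]; ring
    by_cases h11 : r = 1 ∧ s = 1
    · obtain ⟨rfl, rfl⟩ := h11
      have r1 := rq_rec (q := q) 1
      norm_num at r1 ⊢
      rw [seedSum_one_one]
      exact (eq_inv_of_mul_eq_one_right r1).symm
    have h0 := hq.ne_zero
    have hrec := seedSum_rec (q := q) r s (by omega)
    rw [ih (n - 2) (by omega) (r - 1) (s - 1) (by omega) (by omega) (by omega),
      ih (n - 1) (by omega) r (s - 1) (by omega) (by omega) (by omega),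
      ih (n - 1) (by omega) (r - 1) s (by omega) (by omega) (by omega)] at hrec
    have f1 : q ^ r * q ^ s * q⁻¹ = q ^ (r + s - 1) := by
      rw [zpow_sub₀ h0, zpow_add₀ h0, zpow_one]; rfl
    have f2 : q ^ r * q ^ s * q⁻¹ ^ 2 = q ^ (r + s - 2) := by
      rw [zpow_sub₀ h0, zpow_add₀ h0, zpow_ofNat, inv_pow]; rfl
    have n1 := one_sub_zpow_ne_zero (q := q) (n := r + s - 1) (by omega)
    have n2 := one_sub_zpow_ne_zero (q := q) (n := r + s - 2) (by omega)
    rw [f1, f2] at hrec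
    have g1 := rq_rec (q := q) (r - 1)
    have g2 := rq_rec (q := q) (s - 1)
    have g3 := rq_rec (q := q) (r + s - 1)
    have g4 := rq_rec (q := q) (r + s - 2)
    rw [show r + s - 1 - 1 = r + s - 2 by ring] at g3
    rw [show r - 1 + (s - 1) - 1 = r + s - 2 - 1 by ring, show r + (s - 1) - 1 = r + s - 2 by ring,
      show r - 1 + s - 1 = r + s - 2 by ring, ← g4, ← g3, ← g2, ← g1] at hrec
    have f3 : q ^ (r + s - 2) = q ^ (r - 1) * q ^ (s - 1) := by
      rw [← zpow_add₀ h0]; congr 1; ring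
    apply mul_left_cancel₀ (mul_ne_zero n1 (pow_ne_zero 2 n2))
    rw [f3] at hrec n2 ⊢
    linear_combination hrec

/-- The seed identity: the initial value of the iteration of the Bailey lemma. -/
lemma seedSum_eq {r s : ℤ} (hr : 0 ≤ r) (hs : 0 ≤ s) :
    seedSum q r s = rq q (r - 1) * rq q (s - 1) * rq q (r + s - 1) :=
  seedSum_eq_aux (r + s).toNat r s hr hs (by omega)

end Seed

section Contiguous

variable {q : ℂ} [hq : Nome q]

lemma ker_contiguous {L M : ℤ} (h : 0 ≤ L + M) (a b c : ℤ) :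
    (1 - q ^ (L - a)) * (q ^ b - q ^ c) * ker q (L + 1) M (a + 1) b c =
      q ^ b * ker q L M (a + 1) b (c - 1) - q ^ c * ker q L M (a + 1) (b - 1) c := by
  have h0 := hq.ne_zero
  have hb := zpow_ne_zero b h0
  have hc := zpow_ne_zero c h0
  have p1 := qp_rec (q := q) (n := L + M + 1) (by omega)
  have g1 := rq_rec (q := q) (L - a)
  have g2 := rq_rec (q := q) (L - b + 1)
  have g3 := rq_rec (q := q) (L - c + 1)
  have g4 := rq_rec (q := q) (M + b)
  have g5 := rq_rec (q := q) (M + c)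
  simp only [ker, show L + 1 + M = L + M + 1 by ring, show L + 1 - (a + 1) = L - a by ring,
    show L - (a + 1) = L - a - 1 by ring, show L + 1 - b = L - b + 1 by ring,
    show L + 1 - c = L - c + 1 by ring, show L - (b - 1) = L - b + 1 by ring,
    show L - (c - 1) = L - c + 1 by ring, show M + (b - 1) = M + b - 1 by ring,
    show M + (c - 1) = M + c - 1 by ring]
  rw [show L - b + 1 - 1 = L - b by ring] at g2
  rw [show L - c + 1 - 1 = L - c by ring] at g3
  rw [show L + M + 1 - 1 = L + M by ring] at p1
  rw [p1, ← g1, ← g2, ← g3, ← g4, ← g5]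
  rw [zpow_add₀ h0 (L + M), zpow_add₀ h0 L M, zpow_add₀ h0 (L - b), zpow_add₀ h0 (L - c),
    zpow_add₀ h0 M b, zpow_add₀ h0 M c, zpow_sub₀ h0 L b, zpow_sub₀ h0 L c, zpow_one]
  generalize q ^ L = R at *
  generalize q ^ M = S at *
  generalize q ^ b = u at *
  generalize q ^ c = v at *
  generalize q ^ (L - a) = w
  generalize rq q (L - a) = x1
  generalize rq q (L - b + 1) = x2
  generalize rq q (L - c + 1) = x3
  generalize rq q (M + b) = x4
  generalize rq q (M + c) = x5
  generalize rq q (M + (a + 1)) = x6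
  field_simp
  ring

lemma ker_lower (r s a b c : ℤ) : ker q r (s - 1) (a + 1) b c =
    qp q (r + s - 1) * (rq q (r - a) * rq q (s + a) * (rq q (r - b) * rq q (s + b)) *
      (rq q (r - c) * rq q (s + c))) *
        ((1 - q ^ r / q ^ a) * (1 - q ^ s * q ^ b) * (1 - q ^ s * q ^ c)) := by
  have h0 := hq.ne_zero
  have g1 := rq_rec (q := q) (r - a)
  have g2 := rq_rec (q := q) (s + b)
  have g3 := rq_rec (q := q) (s + c)
  rw [zpow_sub₀ h0] at g1
  rw [zpow_add₀ h0] at g2 g3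
  simp only [ker, show r + (s - 1) = r + s - 1 by ring, show r - (a + 1) = r - a - 1 by ring,
    show s - 1 + (a + 1) = s + a by ring, show s - 1 + b = s + b - 1 by ring,
    show s - 1 + c = s + c - 1 by ring]
  rw [← g1, ← g2, ← g3]
  ring

lemma ker_lower_sum {r s : ℤ} (h : 1 ≤ r + s) (a b c : ℤ) :
    (q ^ a - q ^ b) * (q ^ b - q ^ c) * (q ^ c - q ^ a) * ker q r s a b c =
      -((q ^ a) ^ 2 * (q ^ b - q ^ c) * ker q r (s - 1) (a + 1) b c +
        (q ^ b) ^ 2 * (q ^ c - q ^ a) * ker q r (s - 1) (b + 1) c a +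
        (q ^ c) ^ 2 * (q ^ a - q ^ b) * ker q r (s - 1) (c + 1) a b) := by
  have h0 := hq.ne_zero
  have ha := zpow_ne_zero a h0
  have hb := zpow_ne_zero b h0
  have hc := zpow_ne_zero c h0
  rw [ker_lower, ker_lower, ker_lower, ker, qp_rec h, zpow_add₀ h0]
  generalize q ^ a = u at *
  generalize q ^ b = v at *
  generalize q ^ c = w at *
  field_simp
  ring

lemma ker_lower_sum' {r s : ℤ} (h : 1 ≤ r + s) (a b c : ℤ) :
    q ^ s * ((q ^ a - q ^ b) * (q ^ b - q ^ c) * (q ^ c - q ^ a) * ker q r s a b c) =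
      -(q ^ a * (q ^ b - q ^ c) * ker q r (s - 1) (a + 1) b c +
        q ^ b * (q ^ c - q ^ a) * ker q r (s - 1) (b + 1) c a +
        q ^ c * (q ^ a - q ^ b) * ker q r (s - 1) (c + 1) a b) := by
  have h0 := hq.ne_zero
  have ha := zpow_ne_zero a h0
  have hb := zpow_ne_zero b h0
  have hc := zpow_ne_zero c h0
  rw [ker_lower, ker_lower, ker_lower, ker, qp_rec h, zpow_add₀ h0]
  generalize q ^ a = u at *
  generalize q ^ b = v at *
  generalize q ^ c = w at *
  field_simp
  ring

end Contiguous

/-- The indicator of `a = 0`, as an integer. -/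
def ind (a : ℕ) : ℤ := if a = 0 then 1 else 0

/-- One step of the iteration of the `A₂` Bailey lemma. -/
def baileyStep (q : ℂ) (x y : ℤ) (f : ℕ → ℕ → ℂ) (L M : ℕ) : ℂ :=
  ∑ r ∈ Finset.range (L + 1), ∑ s ∈ Finset.range (M + 1),
    q ^ ((r : ℤ) ^ 2 - r * s + s ^ 2 + x * r + y * s) *
      (rq q ((L : ℤ) - r) * rq q ((M : ℤ) - s) * f r s)

/-- The finite multisums produced by the Bailey chain. -/
def chain (q : ℂ) : ℕ → ℕ → ℕ → ℕ → ℕ → ℂ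
  | 0, _, b, L, M => rq q L * rq q M * rq q (L + M + ind b)
  | k + 1, a, b, L, M => baileyStep q (ind a) (ind b) (chain q k (a - 1) (b - 1)) L M

/-- The sum of a function of a triple over its three cyclic rotations. -/
def cyc (g : ℤ → ℤ → ℤ → ℂ) (κ : ℤ × ℤ) : ℂ :=
  g (lat1 κ) (lat2 κ) (lat3 κ) + g (lat2 κ) (lat3 κ) (lat1 κ) + g (lat3 κ) (lat1 κ) (lat2 κ)

lemma HasSum.of_eq {ι : Type*} {f g : ι → ℂ} {s t : ℂ} (h : HasSum f s) (hg : ∀ i, g i = f i)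
    (ht : t = s) : HasSum g t := by
  rwa [funext hg, ht]

section Chain

variable {q : ℂ}

lemma chain_succ (k a b L M : ℕ) : chain q (k + 1) a b L M =
    baileyStep q (ind a) (ind b) (chain q k (a - 1) (b - 1)) L M := rfl

lemma baileyStep_sub (x y : ℤ) (f g : ℕ → ℕ → ℂ) (L M : ℕ) :
    baileyStep q x y (fun r s => f r s - g r s) L M =
      baileyStep q x y f L M - baileyStep q x y g L M := by
  simp only [baileyStep, ← Finset.sum_sub_distrib, mul_sub]

lemma baileyStep_add (x y : ℤ) (f g : ℕ → ℕ → ℂ) (L M : ℕ) :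
    baileyStep q x y (fun r s => f r s + g r s) L M =
      baileyStep q x y f L M + baileyStep q x y g L M := by
  simp only [baileyStep, ← Finset.sum_add_distrib, mul_add]

lemma baileyStep_smul (x y : ℤ) (c : ℂ) (f : ℕ → ℕ → ℂ) (L M : ℕ) :
    baileyStep q x y (fun r s => c * f r s) L M = c * baileyStep q x y f L M := by
  simp only [baileyStep, Finset.mul_sum]
  exact Finset.sum_congr rfl fun r _ => Finset.sum_congr rfl fun s _ => by ring

lemma baileyStep_swap (x y : ℤ) (f : ℕ → ℕ → ℂ) (L M : ℕ) :
    baileyStep q x y f L M = baileyStep q y x (fun r s => f s r) M L := by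
  rw [baileyStep, Finset.sum_comm]
  refine Finset.sum_congr rfl fun r _ => Finset.sum_congr rfl fun s _ => ?_
  rw [show (s : ℤ) ^ 2 - s * r + r ^ 2 + x * s + y * r =
    (r : ℤ) ^ 2 - r * s + s ^ 2 + y * r + x * s by ring]
  ring

lemma hasSum_baileyStep {ι : Type*} (x y : ℤ) {g : ι → ℕ → ℕ → ℂ} {f : ℕ → ℕ → ℂ}
    (h : ∀ r s, HasSum (fun κ => g κ r s) (f r s)) (L M : ℕ) :
    HasSum (fun κ => baileyStep q x y (g κ) L M) (baileyStep q x y f L M) :=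
  hasSum_sum fun r _ => hasSum_sum fun s _ => ((h r s).mul_left _).mul_left _

lemma chain_swap (k : ℕ) : ∀ a b L M : ℕ, a ≤ k → b ≤ k →
    chain q k a b L M = chain q k b a M L := by
  induction k with
  | zero =>
    intro a b L M ha hb
    obtain rfl : a = 0 := by omega
    obtain rfl : b = 0 := by omega
    rw [chain, chain, add_comm (M : ℤ)]
    ring
  | succ k ih =>
    intro a b L M ha hb
    rw [chain_succ, chain_succ, baileyStep_swap]
    congr 1
    funext r s
    exact ih _ _ _ _ (by omega) (by omega)

variable [hq : Nome q]

lemma baileyStep_ker {α β a b c : ℤ} (x y : ℤ) (h1 : α ≤ a ∨ α ≤ b ∨ α ≤ c)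
    (h2 : a ≤ -β ∨ b ≤ -β ∨ c ≤ -β) (hx : 2 * α - β - (a + b + c) = x)
    (hy : 2 * β - α + (a + b + c) = y) (L M : ℕ) :
    baileyStep q x y (fun r s => ker q (r + α) (s + β) a b c) L M =
      q ^ (-esymm2 a b c - (α ^ 2 - α * β + β ^ 2 - (a + b + c) * (α - β))) *
        ker q (L + α) (M + β) a b c := by
  have h0 := hq.ne_zero
  rw [zpow_sub₀ h0, div_mul_eq_mul_div, ← bailey (q := q) (R := L + 1) (R' := M + 1) h1 h2
    (by omega) (by omega), baileyStep, Finset.sum_div]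
  refine Finset.sum_congr rfl fun r _ => ?_
  rw [Finset.sum_div]
  refine Finset.sum_congr rfl fun s _ => ?_
  rw [baileyWeight, mul_div_right_comm, ← zpow_sub₀ h0]
  congr 2
  subst hx hy
  ring

/-- The value of the chain `F(k, 0, 0)`. -/
lemma hasSum_chain_zero_zero (k : ℕ) : ∀ L M : ℕ,
    HasSum (fun κ => q ^ ((3 * k + 4) * latQ κ) * latDelta q κ *
      ker q (L + 1) (M + 1) (lat1 κ) (lat2 κ) (lat3 κ)) (chain q k 0 0 L M) := by
  induction k with
  | zero =>
    intro L M
    have h := hasSum_seedSum (q := q) (L + 1) (M + 1)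
    rw [seedSum_eq (by omega) (by omega)] at h
    rw [chain]
    convert h using 1
    · funext κ
      norm_num
    · rw [ind, if_pos rfl]
      congr 2 <;> congr 1 <;> ring
  | succ k ih =>
    intro L M
    rw [chain_succ]
    have h := hasSum_baileyStep (q := q) (ind 0) (ind 0) ih L M
    convert h using 1
    funext κ
    symm
    have hl := lat_sum κ
    have i1 : ind 0 = 1 := rfl
    rw [baileyStep_smul, baileyStep_ker (α := 1) (β := 1) (ind 0) (ind 0) (by
      simp only [lat1, lat2, lat3]; omega) (by simp only [lat1, lat2, lat3]; omega) (by
      omega) (by omega), esymm2_lat, hl]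
    rw [zpow_split (q := q) (a := (3 * ((k + 1 : ℕ) : ℤ) + 4) * latQ κ)
      (b := (3 * (k : ℤ) + 4) * latQ κ) (c := -(-(3 * latQ κ) - 1) - 1) (by push_cast; ring)]
    norm_num
    ring

/-- A summand of the expansion of `chain q k 0 c`. -/
def chainTerm (q : ℂ) (k c e d : ℤ) (L M x y z : ℤ) : ℂ :=
  q ^ (2 + 2 * x + (3 * k + 4) * e + c * (1 + x) - d * (1 + x)) * (q ^ y - q ^ z) *
    ker q (L + 1) M (x + 1) y z

lemma baileyStep_chainTerm {x y z e : ℤ} (hl : x + y + z = 0)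
    (hQ : esymm2 x y z = -(3 * e) - 1) (k c d : ℤ) (L M : ℕ) :
    baileyStep q 1 0 (fun r s => chainTerm q k c e d r s x y z) L M =
      chainTerm q (k + 1) (c + 1) e d L M x y z := by
  have h := baileyStep_ker (q := q) (α := 1) (β := 0) (a := x + 1) (b := y) (c := z) 1 0 (by omega)
    (by omega) (by omega) (by omega) L M
  simp only [add_zero] at h
  simp only [chainTerm]
  rw [baileyStep_smul, h]
  rw [zpow_split (q := q) (a := 2 + 2 * x + (3 * (k + 1) + 4) * e + (c + 1) * (1 + x) - d * (1 + x))
    (b := 2 + 2 * x + (3 * k + 4) * e + c * (1 + x) - d * (1 + x))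
    (c := -esymm2 (x + 1) y z - (1 ^ 2 - 1 * 0 + 0 ^ 2 - (x + 1 + y + z) * (1 - 0)))]
  · ring
  · have : esymm2 (x + 1) y z = esymm2 x y z - x := by
      simp only [esymm2]; linear_combination hl
    rw [this, hQ]
    linear_combination (-1) * hl

lemma baileyStep_cyc_chainTerm (κ : ℤ × ℤ) (k c d : ℤ) (L M : ℕ) :
    baileyStep q 1 0 (fun r s => -cyc (chainTerm q k c (latQ κ) d r s) κ) L M =
      -cyc (chainTerm q (k + 1) (c + 1) (latQ κ) d L M) κ := by
  have hl := lat_sum κ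
  have hQ := esymm2_lat κ
  have h1 := baileyStep_chainTerm (q := q) hl hQ k c d L M
  have h2 := baileyStep_chainTerm (q := q) (x := lat2 κ) (y := lat3 κ) (z := lat1 κ) (e := latQ κ)
    (by linear_combination hl) (by rw [← hQ]; simp only [esymm2]; ring) k c d L M
  have h3 := baileyStep_chainTerm (q := q) (x := lat3 κ) (y := lat1 κ) (z := lat2 κ) (e := latQ κ)
    (by linear_combination hl) (by rw [← hQ]; simp only [esymm2]; ring) k c d L M
  simp only [cyc, ← h1, ← h2, ← h3]
  rw [← baileyStep_add, ← baileyStep_add]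
  simpa only [neg_one_mul] using baileyStep_smul (q := q) 1 0 (-1) _ L M

lemma chainTerm_zero (k e L M x y z : ℤ) : chainTerm q k 0 e 0 L M x y z =
    q ^ 2 * q ^ ((3 * k + 4) * e) *
      ((q ^ x) ^ 2 * (q ^ y - q ^ z) * ker q (L + 1) M (x + 1) y z) := by
  have h0 := hq.ne_zero
  rw [chainTerm, zpow_split (q := q) (a := 2 + 2 * x + (3 * k + 4) * e + 0 * (1 + x) - 0 * (1 + x))
    (b := 2 + x + x) (c := (3 * k + 4) * e) (by ring), zpow_add₀ h0, zpow_add₀ h0, zpow_ofNat]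
  ring

lemma chainTerm_zero' (k e L M x y z : ℤ) : chainTerm q k 0 e 1 L M x y z =
    q * q ^ ((3 * k + 4) * e) * (q ^ x * (q ^ y - q ^ z) * ker q (L + 1) M (x + 1) y z) := by
  have h0 := hq.ne_zero
  rw [chainTerm, zpow_split (q := q) (a := 2 + 2 * x + (3 * k + 4) * e + 0 * (1 + x) - 1 * (1 + x))
    (b := 1 + x) (c := (3 * k + 4) * e) (by ring), zpow_add₀ h0, zpow_one]
  ring

lemma hasSum_chain_zero (k c : ℕ) : ∀ L M : ℕ,
    HasSum (fun κ => -cyc (chainTerm q ((k + c : ℕ) : ℤ) c (latQ κ) 0 L M) κ)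
      (chain q (k + c) 0 c L M) := by
  induction c with
  | zero =>
    intro L M
    refine HasSum.of_eq (hasSum_chain_zero_zero (q := q) k L M) (fun κ => ?_) rfl
    have h := ker_lower_sum (q := q) (r := L + 1) (s := M + 1) (by omega) (lat1 κ) (lat2 κ) (lat3 κ)
    rw [add_sub_cancel_right] at h
    simp only [cyc, Nat.cast_zero, chainTerm_zero, latDelta, add_zero]
    linear_combination (-q ^ 2 * q ^ ((3 * (k : ℤ) + 4) * latQ κ)) * h
  | succ c ih =>
    intro L M
    refine HasSum.of_eq (hasSum_baileyStep (q := q) 1 0 ih L M) (fun κ => ?_) rfl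
    rw [baileyStep_cyc_chainTerm]
    norm_num [add_assoc]

lemma hasSum_chain_zero' (k c : ℕ) : ∀ L M : ℕ,
    HasSum (fun κ => -cyc (chainTerm q ((k + c : ℕ) : ℤ) c (latQ κ) 1 L M) κ)
      (q ^ (ind c * M) * chain q (k + c) 0 (c - 1) L M) := by
  have h0 := hq.ne_zero
  induction c with
  | zero =>
    intro L M
    refine HasSum.of_eq ((hasSum_chain_zero_zero (q := q) k L M).mul_left (q ^ (ind 0 * M)))
      (fun κ => ?_) rfl
    have h := ker_lower_sum' (q := q) (r := L + 1) (s := M + 1) (by omega) (lat1 κ) (lat2 κ) (lat3 κ)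
    rw [add_sub_cancel_right, zpow_add₀ h0, zpow_one] at h
    have i0 : ind 0 = 1 := rfl
    simp only [cyc, Nat.cast_zero, chainTerm_zero', latDelta, add_zero, i0, one_mul]
    linear_combination (-q * q ^ ((3 * (k : ℤ) + 4) * latQ κ)) * h
  | succ c ih =>
    intro L M
    refine HasSum.of_eq (hasSum_baileyStep (q := q) 1 0 ih L M) (fun κ => ?_) ?_
    · rw [baileyStep_cyc_chainTerm]
      norm_num [add_assoc]
    · have i1 : ind (c + 1) = 0 := rfl
      have i0 : ind 0 = 1 := rfl
      rw [i1, zero_mul, zpow_zero, one_mul, ← add_assoc, chain_succ, baileyStep, baileyStep]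
      refine Finset.sum_congr rfl fun r _ => Finset.sum_congr rfl fun s _ => ?_
      rw [Nat.add_sub_cancel, i0, zpow_add₀ h0 _ (ind c * s)]
      simp only [zero_mul, add_zero, zero_tsub]
      ring

/-- The combination of two chains which has a manifestly symmetric expansion. -/
def chainDiff (q : ℂ) (k a b L M : ℕ) : ℂ :=
  chain q k a b L M - q ^ (1 + ind a * L + ind b * M) * chain q k (a - 1) (b - 1) L M

/-- A summand of the expansion of `chainDiff`. -/
def diffTerm (q : ℂ) (k a b e : ℤ) (L M x y z : ℤ) : ℂ :=
  q ^ ((3 * k + 4) * e + (b + 1) * (1 + x) + (a + 1) * (1 - y)) * ker q L M (x + 1) (y - 1) z -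
  q ^ ((3 * k + 4) * e + (b + 1) * (1 + x) + (a + 1) * (1 - z)) * ker q L M (x + 1) y (z - 1)

lemma baileyStep_diffTerm {x y z e : ℤ} (hl : x + y + z = 0)
    (hQ : esymm2 x y z = -(3 * e) - 1) (k a b : ℤ) (L M : ℕ) :
    baileyStep q 0 0 (fun r s => diffTerm q k a b e r s x y z) L M =
      diffTerm q (k + 1) (a + 1) (b + 1) e L M x y z := by
  have h1 := baileyStep_ker (q := q) (α := 0) (β := 0) (a := x + 1) (b := y - 1) (c := z) 0 0
    (by omega) (by omega) (by omega) (by omega) L M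
  have h2 := baileyStep_ker (q := q) (α := 0) (β := 0) (a := x + 1) (b := y) (c := z - 1) 0 0
    (by omega) (by omega) (by omega) (by omega) L M
  simp only [add_zero] at h1 h2
  simp only [diffTerm]
  rw [baileyStep_sub, baileyStep_smul, baileyStep_smul, h1, h2, ← mul_assoc, ← mul_assoc,
    ← zpow_add₀ hq.ne_zero, ← zpow_add₀ hq.ne_zero]
  have e1 : esymm2 (x + 1) (y - 1) z = -(3 * e) - 1 + y - x - 1 := by
    rw [← hQ]; simp only [esymm2]; ring
  have e2 : esymm2 (x + 1) y (z - 1) = -(3 * e) - 1 + z - x - 1 := by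
    rw [← hQ]; simp only [esymm2]; ring
  rw [e1, e2]
  congr 3 <;> ring

lemma chainTerm_sub_chainTerm {x y z : ℤ} (hl : x + y + z = 0) (k c e : ℤ) (L M : ℕ) :
    chainTerm q k c e 0 L M x y z - q ^ (1 + (L : ℤ)) * chainTerm q k c e 1 L M x y z =
      diffTerm q k 0 c e L M x y z * -1 := by
  have h0 := hq.ne_zero
  have h := ker_contiguous (q := q) (L := L) (M := M) (by omega) x y z
  have e1 : q ^ (1 + (L : ℤ)) * q ^ (2 + 2 * x + (3 * k + 4) * e + c * (1 + x) - 1 * (1 + x)) =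
      q ^ (2 + 2 * x + (3 * k + 4) * e + c * (1 + x) - 0 * (1 + x)) * q ^ (L - x) := by
    rw [← zpow_add₀ h0, ← zpow_add₀ h0]; congr 1; ring
  have e2 : q ^ ((3 * k + 4) * e + (c + 1) * (1 + x) + (0 + 1) * (1 - y)) =
      q ^ (2 + 2 * x + (3 * k + 4) * e + c * (1 + x) - 0 * (1 + x)) * q ^ z := by
    rw [← zpow_add₀ h0]; congr 1; linear_combination -hl
  have e3 : q ^ ((3 * k + 4) * e + (c + 1) * (1 + x) + (0 + 1) * (1 - z)) =
      q ^ (2 + 2 * x + (3 * k + 4) * e + c * (1 + x) - 0 * (1 + x)) * q ^ y := by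
    rw [← zpow_add₀ h0]; congr 1; linear_combination -hl
  simp only [chainTerm, diffTerm]
  rw [e2, e3, ← mul_assoc, ← mul_assoc, e1]
  linear_combination q ^ (2 + 2 * x + (3 * k + 4) * e + c * (1 + x) - 0 * (1 + x)) * h

lemma chainDiff_succ (k a b L M : ℕ) :
    chainDiff q (k + 1) (a + 1) (b + 1) L M = baileyStep q 0 0 (chainDiff q k a b) L M := by
  have h0 := hq.ne_zero
  have i1 : ∀ n, ind (n + 1) = 0 := fun n => rfl
  rw [chainDiff, i1, i1]
  simp only [Nat.add_sub_cancel, zero_mul, add_zero, zpow_one]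
  rw [chain_succ, chain_succ, i1, i1, ← baileyStep_smul]
  have : baileyStep q (ind a) (ind b) (fun r s => q * chain q k (a - 1) (b - 1) r s) L M =
      baileyStep q 0 0 (fun r s => q ^ (1 + ind a * r + ind b * s) *
        chain q k (a - 1) (b - 1) r s) L M := by
    simp only [baileyStep]
    refine Finset.sum_congr rfl fun r _ => Finset.sum_congr rfl fun s _ => ?_
    rw [zpow_split (q := q) (a := (r : ℤ) ^ 2 - r * s + s ^ 2 + ind a * r + ind b * s)
      (b := (r : ℤ) ^ 2 - r * s + s ^ 2 + 0 * r + 0 * s)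
      (c := ind a * r + ind b * s) (by ring), add_assoc 1, zpow_add₀ h0 1, zpow_one]
    ring
  rw [this, ← baileyStep_sub]
  rfl

lemma hasSum_chainDiff (k c a : ℕ) : ∀ L M : ℕ,
    HasSum (fun κ => cyc (diffTerm q ((k + c + a : ℕ) : ℤ) a ((c + a : ℕ) : ℤ) (latQ κ) L M) κ)
      (chainDiff q (k + c + a) a (c + a) L M) := by
  have h0 := hq.ne_zero
  induction a with
  | zero =>
    intro L M
    refine HasSum.of_eq ((hasSum_chain_zero (q := q) k c L M).sub
      ((hasSum_chain_zero' (q := q) k c L M).mul_left (q ^ (1 + (L : ℤ))))) (fun κ => ?_) ?_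
    · have hl := lat_sum κ
      have h1 := chainTerm_sub_chainTerm (q := q) hl ((k + c : ℕ) : ℤ) c (latQ κ) L M
      have h2 := chainTerm_sub_chainTerm (q := q) (x := lat2 κ) (y := lat3 κ) (z := lat1 κ)
        (by linear_combination hl) ((k + c : ℕ) : ℤ) c (latQ κ) L M
      have h3 := chainTerm_sub_chainTerm (q := q) (x := lat3 κ) (y := lat1 κ) (z := lat2 κ)
        (by linear_combination hl) ((k + c : ℕ) : ℤ) c (latQ κ) L M
      simp only [cyc, add_zero, Nat.cast_zero]
      linear_combination h1 + h2 + h3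
    · have i0 : ind 0 = 1 := rfl
      simp only [chainDiff, add_zero, i0, one_mul, zero_tsub]
      rw [zpow_add₀ h0 (1 + (L : ℤ)), mul_assoc]
  | succ a ih =>
    intro L M
    refine HasSum.of_eq (hasSum_baileyStep (q := q) 0 0 ih L M) (fun κ => ?_) ?_
    · have hl := lat_sum κ
      have hQ := esymm2_lat κ
      have h1 := baileyStep_diffTerm (q := q) hl hQ ((k + c + a : ℕ) : ℤ) a ((c + a : ℕ) : ℤ) L M
      have h2 := baileyStep_diffTerm (q := q) (x := lat2 κ) (y := lat3 κ) (z := lat1 κ)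
        (e := latQ κ) (by linear_combination hl) (by rw [← hQ]; simp only [esymm2]; ring)
        ((k + c + a : ℕ) : ℤ) a ((c + a : ℕ) : ℤ) L M
      have h3 := baileyStep_diffTerm (q := q) (x := lat3 κ) (y := lat1 κ) (z := lat2 κ)
        (e := latQ κ) (by linear_combination hl) (by rw [← hQ]; simp only [esymm2]; ring)
        ((k + c + a : ℕ) : ℤ) a ((c + a : ℕ) : ℤ) L M
      simp only [cyc]
      rw [baileyStep_add, baileyStep_add, h1, h2, h3]
      push_cast
      simp only [add_assoc]
    · rw [← add_assoc, ← add_assoc, chainDiff_succ]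

/-- On the diagonal the difference is itself a chain. -/
lemma chainDiff_diag (k : ℕ) : ∀ L M, chainDiff q k k k L M = chain q k k (k + 1) L M := by
  induction k with
  | zero =>
    intro L M
    have g := rq_rec (q := q) (L + M + 1)
    have i0 : ind 0 = 1 := rfl
    have i1 : ind (0 + 1) = 0 := rfl
    rw [add_sub_cancel_right] at g
    simp only [chainDiff, chain, i0, i1, one_mul, add_zero]
    rw [← g, show (1 : ℤ) + L + M = L + M + 1 by ring]
    ring
  | succ k ih =>
    intro L M
    rw [chainDiff_succ, chain_succ]
    congr 1
    funext r s
    exact ih r s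

end Chain

/-- The indicator of `b = 1`, as a natural number. -/
def del (b : ℕ) : ℕ := if b = 1 then 1 else 0

/-- The quadratic exponent attached to one pair of summation variables. -/
def quadExp (a b : ℕ) (l m : ℤ) : ℤ := l ^ 2 - l * m + m ^ 2 + ind a * l + ind b * m

/-- The part of the Andrews-Gordon multisum that follows a given first pair `(l, m)`. -/
def tail (q : ℂ) : ℕ → ℕ → ℕ → ℕ → ℕ → ℂ
  | 0, _, b, l, m => rq q l * qBinom q (2 * l + del b) m
  | k + 1, a, b, l, m => ∑ l' ∈ Finset.range (l + 1), ∑ m' ∈ Finset.range (2 * l + k + 2),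
      rq q ((l : ℤ) - l') * qBinom q ((l : ℤ) - l' + m' + del b) m *
        (q ^ quadExp (a - 1) (b - 1) l' m' * tail q k (a - 1) (b - 1) l' m')

lemma del_le (b : ℕ) : del b ≤ 1 := by unfold del; split <;> omega

lemma tail_eq_zero (q : ℂ) (k : ℕ) : ∀ a b l m : ℕ, 2 * l + k + 2 ≤ m → tail q k a b l m = 0 := by
  induction k with
  | zero =>
    intro a b l m h
    have := del_le b
    rw [tail, qBinom_of_gt q (by omega), mul_zero]
  | succ k ih =>
    intro a b l m h
    rw [tail]
    refine Finset.sum_eq_zero fun l' hl => Finset.sum_eq_zero fun m' hm => ?_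
    have := del_le b
    rw [Finset.mem_range] at hl hm
    by_cases h' : 2 * l' + k + 2 ≤ m'
    · rw [ih _ _ _ _ h']; ring
    · rw [qBinom_of_gt q (by omega)]; ring

section Tail

variable {q : ℂ} [hq : Nome q]

lemma del_sub (b : ℕ) : (del b : ℤ) - ind (b - 1) = -ind b := by
  rcases b with _ | _ | b <;> simp [del, ind]

/-- The inner summation over `m`. -/
lemma sum_qBinom_range {N M B : ℕ} {d l y : ℤ} (hN : N < B) (hM : M < B) (h : N - d = l - y) :
    ∑ m ∈ Finset.range B, q ^ ((m : ℤ) ^ 2 - l * m + y * m) *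
      (qBinom q N m * (rq q M * rq q (M + m - l + y))) =
    ∑ s ∈ Finset.range (M + 1), q ^ ((s : ℤ) ^ 2 - l * s + y * s) *
      (rq q ((M : ℤ) - s) * (rq q s * rq q (s + d))) := by
  have w := sum_qBinom_eq_sum_rq (q := q) N hN d (u := M) (by omega)
  calc _ = ∑ m ∈ Finset.range B, q ^ ((m : ℤ) * (m - (N - d))) *
      (qBinom q N m * (rq q M * rq q (M + m - (N - d)))) := by
        refine Finset.sum_congr rfl fun m _ => ?_
        rw [h, show (m : ℤ) * (m - (l - y)) = (m : ℤ) ^ 2 - l * m + y * m by ring,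
          show (M : ℤ) + m - (l - y) = M + m - l + y by ring]
    _ = _ := by
        rw [w]
        symm
        rw [← Finset.sum_subset (Finset.range_subset_range.mpr (show M + 1 ≤ B from hM))]
        · refine Finset.sum_congr rfl fun s _ => ?_
          rw [h, show (s : ℤ) * (s - (l - y)) = (s : ℤ) ^ 2 - l * s + y * s by ring]
          ring
        · intro s _ hs
          rw [Finset.mem_range] at hs
          rw [rq_neg (n := (M : ℤ) - s) (by omega)]
          ring

/-- The multisum with two finite parameters. -/
lemma sum_tail (k : ℕ) : ∀ a b L M B : ℕ, 3 * L + k + M + 10 ≤ B →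
    ∑ l ∈ Finset.range (L + 1), ∑ m ∈ Finset.range B,
      rq q ((L : ℤ) - l) * (rq q M * rq q (M + m - l + ind b)) *
        (q ^ quadExp a b l m * tail q k a b l m) = chain q (k + 1) a b L M := by
  have h0 := hq.ne_zero
  have split : ∀ a b (l m : ℕ), q ^ quadExp a b l m =
      q ^ ((l : ℤ) ^ 2 + ind a * l) * q ^ ((m : ℤ) ^ 2 - l * m + ind b * m) := by
    intro a b l m
    rw [← zpow_add₀ h0, quadExp]
    congr 1
    ring
  induction k with
  | zero =>
    intro a b L M B hB
    rw [chain_succ, baileyStep]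
    refine Finset.sum_congr rfl fun l hl => ?_
    rw [Finset.mem_range] at hl
    have hd := del_le b
    have hds := del_sub b
    have w := sum_qBinom_range (q := q) (N := 2 * l + del b) (M := M) (B := B) (l := l) (y := ind b)
      (d := l + ind (b - 1)) (by omega) (by omega) (by push_cast; omega)
    calc _ = rq q ((L : ℤ) - l) * rq q l * q ^ ((l : ℤ) ^ 2 + ind a * l) * ∑ m ∈ Finset.range B,
          q ^ ((m : ℤ) ^ 2 - l * m + ind b * m) *
            (qBinom q (2 * l + del b : ℕ) m * (rq q M * rq q (M + m - l + ind b))) := by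
          rw [Finset.mul_sum]
          refine Finset.sum_congr rfl fun m _ => ?_
          rw [split, tail]
          push_cast
          ring
      _ = _ := by
          rw [w, Finset.mul_sum]
          refine Finset.sum_congr rfl fun s _ => ?_
          rw [show (l : ℤ) ^ 2 - l * s + s ^ 2 + ind a * l + ind b * s = quadExp a b l s from rfl,
            split, chain, show (s : ℤ) + (l + ind (b - 1)) = l + s + ind (b - 1) by ring]
          ring
  | succ k ih =>
    intro a b L M B hB
    rw [chain_succ, baileyStep]
    refine Finset.sum_congr rfl fun l hl => ?_
    rw [Finset.mem_range] at hl
    have hd := del_le b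
    have hds := del_sub b
    have key : ∀ l' ∈ Finset.range (l + 1), ∀ m' ∈ Finset.range (2 * l + k + 2),
        ∑ m ∈ Finset.range B, q ^ ((m : ℤ) ^ 2 - l * m + ind b * m) *
          (qBinom q ((l : ℤ) - l' + m' + del b) m * (rq q M * rq q (M + m - l + ind b))) =
        ∑ s ∈ Finset.range (M + 1), q ^ ((s : ℤ) ^ 2 - l * s + ind b * s) *
          (rq q ((M : ℤ) - s) * (rq q s * rq q (s + m' - l' + ind (b - 1)))) := by
      intro l' hl' m' hm'
      rw [Finset.mem_range] at hl' hm'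
      have w := sum_qBinom_range (q := q) (N := l - l' + m' + del b) (M := M) (B := B) (l := l)
        (y := ind b) (d := m' - l' + ind (b - 1)) (by omega) (by omega) (by
          push_cast [Nat.cast_sub (show l' ≤ l by omega)]; linear_combination hds)
      rw [show ((l : ℤ) - l' + m' + del b) = ((l - l' + m' + del b : ℕ) : ℤ) by
        push_cast [Nat.cast_sub (show l' ≤ l by omega)]; ring, w]
      refine Finset.sum_congr rfl fun s _ => ?_
      rw [show (s : ℤ) + (m' - l' + ind (b - 1)) = s + m' - l' + ind (b - 1) by ring]
    calc _ = rq q ((L : ℤ) - l) * q ^ ((l : ℤ) ^ 2 + ind a * l) *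
          ∑ l' ∈ Finset.range (l + 1), ∑ m' ∈ Finset.range (2 * l + k + 2),
            rq q ((l : ℤ) - l') * (q ^ quadExp (a - 1) (b - 1) l' m' *
              tail q k (a - 1) (b - 1) l' m') *
            ∑ m ∈ Finset.range B, q ^ ((m : ℤ) ^ 2 - l * m + ind b * m) *
              (qBinom q ((l : ℤ) - l' + m' + del b) m *
                (rq q M * rq q (M + m - l + ind b))) := by
          simp only [Finset.mul_sum]
          simp only [tail, Finset.mul_sum, split a b]
          rw [Finset.sum_comm]
          refine Finset.sum_congr rfl fun l' _ => ?_
          rw [Finset.sum_comm]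
          refine Finset.sum_congr rfl fun m' _ => Finset.sum_congr rfl fun m _ => ?_
          ring
      _ = rq q ((L : ℤ) - l) * q ^ ((l : ℤ) ^ 2 + ind a * l) *
          ∑ s ∈ Finset.range (M + 1), q ^ ((s : ℤ) ^ 2 - l * s + ind b * s) * rq q ((M : ℤ) - s) *
            ∑ l' ∈ Finset.range (l + 1), ∑ m' ∈ Finset.range (2 * l + k + 2),
              rq q ((l : ℤ) - l') * (rq q s * rq q (s + m' - l' + ind (b - 1))) *
                (q ^ quadExp (a - 1) (b - 1) l' m' * tail q k (a - 1) (b - 1) l' m') := by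
          rw [Finset.sum_congr rfl fun l' hl' => Finset.sum_congr rfl fun m' hm' => by
            rw [key l' hl' m' hm']]
          congr 1
          simp only [Finset.mul_sum]
          symm
          rw [Finset.sum_comm]
          refine Finset.sum_congr rfl fun l' _ => ?_
          rw [Finset.sum_comm]
          refine Finset.sum_congr rfl fun m' _ => Finset.sum_congr rfl fun s _ => ?_
          ring
      _ = _ := by
          rw [Finset.mul_sum]
          refine Finset.sum_congr rfl fun s hs => ?_
          rw [Finset.mem_range] at hs
          rw [show (l : ℤ) ^ 2 - l * s + s ^ 2 + ind a * l + ind b * s = quadExp a b l s from rfl,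
            split, ← ih (a - 1) (b - 1) l s (3 * L + k + M + 10) (by omega)]
          rw [Finset.sum_congr rfl fun l' hl' => Finset.sum_subset
            (Finset.range_subset_range.mpr (show 2 * l + k + 2 ≤ 3 * L + k + M + 10 by omega))
            fun m' _ hm' => by
              rw [Finset.mem_range] at hl' hm'
              rw [tail_eq_zero q k _ _ _ _ (by omega)]; ring]
          ring

end Tail

section Analysis

open Filter Topology

lemma summable_norm_qPoch {q : ℂ} (a : ℂ) (hq : ‖q‖ < 1) : Summable fun j : ℕ => ‖-(a * q ^ j)‖ := by
  simp only [norm_neg, norm_mul, norm_pow]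
  exact (summable_geometric_of_lt_one (norm_nonneg q) hq).mul_left _

lemma tendsto_qPoch {q : ℂ} (a : ℂ) (hq : ‖q‖ < 1) :
    Tendsto (qPoch a q) atTop (𝓝 (qPochInf a q)) := by
  have h := (multipliable_one_add_of_summable (summable_norm_qPoch a hq)).hasProd.tendsto_prod_nat
  simp only [← sub_eq_add_neg] at h
  exact h

section Limits

variable {q : ℂ} [hq : Nome q]

lemma qPochInf_self_ne_zero : qPochInf q q ≠ 0 := by
  have h := tprod_one_add_ne_zero_of_summable (f := fun j : ℕ => -(q * q ^ j)) (fun j => by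
    rw [← sub_eq_add_neg, ← pow_succ']
    exact sub_ne_zero.mpr (pow_ne_one (Nat.succ_ne_zero j)).symm)
    (summable_norm_qPoch q hq.norm_lt_one)
  simp only [← sub_eq_add_neg] at h
  exact h

lemma tendsto_toNat : Tendsto Int.toNat atTop atTop :=
  tendsto_atTop.mpr fun b => by
    filter_upwards [eventually_ge_atTop (b : ℤ)] with n hn
    omega

lemma tendsto_qp : Tendsto (qp q) atTop (𝓝 (qPochInf q q)) :=
  (tendsto_qPoch q hq.norm_lt_one).comp tendsto_toNat

lemma tendsto_rq : Tendsto (rq q) atTop (𝓝 (qPochInf q q)⁻¹) := by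
  refine ((tendsto_qp (q := q)).inv₀ qPochInf_self_ne_zero).congr' ?_
  filter_upwards [eventually_ge_atTop 0] with n hn
  rw [rq, if_neg (by omega), qp]

variable (q) in
lemma exists_bound : ∃ C : ℝ, 1 ≤ C ∧ (∀ n, ‖rq q n‖ ≤ C) ∧ (∀ n, ‖qp q n‖ ≤ C) ∧
    ∀ n m, ‖qBinom q n m‖ ≤ C := by
  have h1 := tendsto_qPoch q hq.norm_lt_one
  obtain ⟨A, hA⟩ := h1.norm.bddAbove_range
  obtain ⟨B, hB⟩ := (h1.inv₀ qPochInf_self_ne_zero).norm.bddAbove_range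
  have hA' : ∀ n, ‖qp q n‖ ≤ A := fun n => hA ⟨n.toNat, rfl⟩
  have hB0 : 0 ≤ B := (norm_nonneg _).trans (hB ⟨0, rfl⟩)
  have hB' : ∀ n, ‖rq q n‖ ≤ B := fun n => by
    rw [rq]
    split_ifs
    · rwa [norm_zero]
    · exact hB ⟨n.toNat, rfl⟩
  refine ⟨max 1 (max A (max B (A * (B * B)))), le_max_left _ _, fun n => (hB' n).trans (by simp),
    fun n => (hA' n).trans (by simp), fun n m => ?_⟩
  have hA0 : 0 ≤ A := (norm_nonneg _).trans (hA' 0)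
  rw [qBinom_eq, norm_mul, norm_mul]
  refine le_trans ?_ ((le_max_right B _).trans ((le_max_right A _).trans (le_max_right 1 _)))
  gcongr
  · exact hA' _
  · exact hB' _
  · exact hB' _

/-- Comparison of a power of `q` with a geometric sequence. -/
lemma norm_zpow_le {e : ℤ} {n : ℕ} (h : n ≤ 2 * e) : ‖q ^ e‖ ≤ √‖q‖ ^ n := by
  have h0 : 0 < √‖q‖ := Real.sqrt_pos.mpr (norm_pos_iff.mpr hq.ne_zero)
  have h1 : √‖q‖ ≤ 1 := Real.sqrt_le_one.mpr hq.norm_lt_one.le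
  rw [norm_zpow]
  nth_rewrite 1 [← Real.sq_sqrt (norm_nonneg q)]
  rw [← zpow_natCast, ← zpow_mul, ← zpow_natCast]
  exact zpow_le_zpow_right_of_le_one₀ h0 h1 (by exact_mod_cast h)

variable (q) in
lemma summable_sqrt_pow : Summable fun n : ℕ => √‖q‖ ^ n :=
  summable_geometric_of_lt_one (Real.sqrt_nonneg _)
    ((Real.sqrt_lt' one_pos).mpr (by simpa using hq.norm_lt_one))

variable (q) in
lemma summable_sqrt_pow_prod : Summable fun p : ℕ × ℕ => √‖q‖ ^ (p.1 + p.2) := by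
  simp only [pow_add]
  exact (summable_sqrt_pow q).mul_of_nonneg (summable_sqrt_pow q)
    (fun n => pow_nonneg (Real.sqrt_nonneg _) n) (fun n => pow_nonneg (Real.sqrt_nonneg _) n)

omit hq in
lemma ind_nonneg (a : ℕ) : 0 ≤ ind a := by unfold ind; split <;> omega

omit hq in
lemma le_two_mul_quadExp (a b l m : ℕ) : ((l + m : ℕ) : ℤ) ≤ 2 * quadExp a b l m := by
  have h1 := mul_nonneg (ind_nonneg a) (Int.natCast_nonneg l)
  have h2 := mul_nonneg (ind_nonneg b) (Int.natCast_nonneg m)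
  have h3 : (l : ℤ) ≤ l ^ 2 := by exact_mod_cast Nat.le_self_pow two_ne_zero l
  have h4 : (m : ℤ) ≤ m ^ 2 := by exact_mod_cast Nat.le_self_pow two_ne_zero m
  rw [quadExp]
  push_cast
  nlinarith [sq_nonneg ((l : ℤ) - m)]

variable (q) in
lemma exists_tail_bound (k : ℕ) : ∃ C : ℝ, 0 ≤ C ∧ ∀ a b l m, ‖tail q k a b l m‖ ≤ C := by
  obtain ⟨C, hC, hr, -, hb⟩ := exists_bound q
  have hC0 : 0 ≤ C := zero_le_one.trans hC
  induction k with
  | zero =>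
    refine ⟨C * C, by positivity, fun a b l m => ?_⟩
    rw [tail, norm_mul]
    gcongr
    · exact hr _
    · exact hb _ _
  | succ k ih =>
    obtain ⟨D, hD, ih⟩ := ih
    have hs := summable_sqrt_pow_prod q
    refine ⟨C * C * D * ∑' p : ℕ × ℕ, √‖q‖ ^ (p.1 + p.2),
      mul_nonneg (by positivity) (tsum_nonneg fun p => by positivity), fun a b l m => ?_⟩
    rw [tail, ← Finset.sum_product']
    refine (norm_sum_le _ _).trans ?_
    rw [← tsum_mul_left]
    refine le_trans (Finset.sum_le_sum fun p _ => ?_)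
      ((hs.mul_left (C * C * D)).sum_le_tsum _ fun p _ => by positivity)
    rw [norm_mul, norm_mul, norm_mul]
    calc _ ≤ C * C * (√‖q‖ ^ (p.1 + p.2) * D) := by
          gcongr
          · exact hr _
          · exact hb _ _
          · exact norm_zpow_le (le_two_mul_quadExp _ _ _ _)
          · exact ih _ _ _ _
      _ = _ := by ring

/-- The infinite multisum obtained from the chain. -/
def multisum (q : ℂ) (k a b : ℕ) : ℂ :=
  ∑' p : ℕ × ℕ, q ^ quadExp a b p.1 p.2 * tail q k a b p.1 p.2

lemma chain_eq_tsum (k a b L M : ℕ) : chain q (k + 1) a b L M = ∑' p : ℕ × ℕ,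
    rq q ((L : ℤ) - p.1) * (rq q M * rq q (M + p.2 - p.1 + ind b)) *
      (q ^ quadExp a b p.1 p.2 * tail q k a b p.1 p.2) := by
  rw [← sum_tail (q := q) k a b L M _ le_rfl, ← Finset.sum_product', tsum_eq_sum]
  rintro ⟨l, m⟩ hp
  simp only [Finset.mem_product, Finset.mem_range, not_and_or, not_lt] at hp
  by_cases hl : l ≤ L
  · rw [tail_eq_zero q k _ _ _ _ (by simp only; omega), mul_zero, mul_zero]
  · rw [rq_neg (n := (L : ℤ) - l) (by omega), zero_mul, zero_mul]

lemma tendsto_natCast_add (f : ℕ → ℤ) (c : ℤ) (h : ∀ n : ℕ, f n = n + c) : Tendsto f atTop atTop := by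
  rw [funext h]
  exact tendsto_atTop_add_const_right _ _ tendsto_natCast_atTop_atTop

lemma tendsto_chain (k a b : ℕ) : Tendsto (fun n => chain q (k + 1) a b n n) atTop
    (𝓝 ((qPochInf q q)⁻¹ ^ 3 * multisum q k a b)) := by
  obtain ⟨C, hC, hr, -, -⟩ := exists_bound q
  have hC0 : 0 ≤ C := zero_le_one.trans hC
  obtain ⟨D, hD, ht⟩ := exists_tail_bound q k
  rw [multisum, ← tsum_mul_left]
  simp only [chain_eq_tsum]
  refine tendsto_tsum_of_dominated_convergence
    ((summable_sqrt_pow_prod q).mul_left (C * (C * C) * D)) (fun p => ?_)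
    (Eventually.of_forall fun n p => ?_)
  · rw [pow_three]
    refine Tendsto.mul_const _ ?_
    refine (tendsto_rq.comp (tendsto_natCast_add _ (-p.1) fun n => by ring)).mul
      ((tendsto_rq.comp (tendsto_natCast_add _ 0 fun n => by ring)).mul
        (tendsto_rq.comp (tendsto_natCast_add _ (p.2 - p.1 + ind b) fun n => by ring)))
  · rw [norm_mul, norm_mul, norm_mul, norm_mul]
    calc _ ≤ C * (C * C) * (√‖q‖ ^ (p.1 + p.2) * D) := by
          gcongr
          · exact hr _
          · exact hr _
          · exact hr _
          · exact norm_zpow_le (le_two_mul_quadExp _ _ _ _)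
          · exact ht _ _ _ _
      _ = _ := by ring

lemma multisum_swap {k a b : ℕ} (ha : a ≤ k + 1) (hb : b ≤ k + 1) :
    multisum q k a b = multisum q k b a := by
  have h1 := tendsto_chain (q := q) k a b
  have h2 := tendsto_chain (q := q) k b a
  simp only [fun n => chain_swap (q := q) (k + 1) a b n n ha hb] at h1
  exact mul_left_cancel₀ (pow_ne_zero 3 (inv_ne_zero qPochInf_self_ne_zero))
    (tendsto_nhds_unique h1 h2)

lemma tendsto_chainDiff (k a b : ℕ) : Tendsto (fun n => chainDiff q (k + 1) a b n n) atTop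
    (𝓝 ((qPochInf q q)⁻¹ ^ 3 * (multisum q k a b -
      if a = 0 ∨ b = 0 then 0 else q * multisum q k (a - 1) (b - 1)))) := by
  rw [mul_sub]
  refine (tendsto_chain k a b).sub ?_
  have h := tendsto_chain (q := q) k (a - 1) (b - 1)
  have h0 := hq.ne_zero
  split_ifs with hab
  · have hp : Tendsto (fun n : ℕ => q ^ (1 + ind a * n + ind b * n)) atTop (𝓝 0) := by
      refine squeeze_zero_norm (a := fun n : ℕ => √‖q‖ ^ n) (fun n => norm_zpow_le ?_) ?_
      · have := ind_nonneg a
        have := ind_nonneg b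
        have h1 : 1 ≤ ind a + ind b := by
          rcases hab with rfl | rfl
          · have : ind 0 = 1 := rfl
            omega
          · have : ind 0 = 1 := rfl
            omega
        nlinarith [Int.natCast_nonneg n]
      · exact (summable_sqrt_pow q).tendsto_atTop_zero
    simpa only [zero_mul, mul_zero] using hp.mul h
  · rw [not_or] at hab
    have e : ∀ n : ℕ, q ^ (1 + ind a * n + ind b * n) = q := fun n => by
      rw [ind, if_neg hab.1, ind, if_neg hab.2]; simp
    simp only [e]
    convert h.const_mul q using 2
    ring

lemma multisum_diag (k : ℕ) : multisum q k (k + 1) (k + 2) = multisum q k (k + 1) (k + 1) -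
    q * multisum q k k k := by
  have h1 := tendsto_chain (q := q) k (k + 1) (k + 2)
  have h2 := tendsto_chainDiff (q := q) k (k + 1) (k + 1)
  simp only [chainDiff_diag] at h2
  rw [if_neg (by omega)] at h2
  exact mul_left_cancel₀ (pow_ne_zero 3 (inv_ne_zero qPochInf_self_ne_zero))
    (tendsto_nhds_unique h1 h2)

/-- A lower bound making lattice sums converge. -/
lemma latQ_add_le (A : ℤ) (hA : 1 ≤ A) (c₁ c₂ : ℤ) (κ : ℤ × ℤ) :
    (κ.1.natAbs + κ.2.natAbs : ℤ) ≤
      2 * (A * latQ κ + c₁ * κ.1 + c₂ * κ.2 + ((2 * A + |c₁| + 1) ^ 2 + (A + |c₂| + 1) ^ 2)) := by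
  have key : ∀ t u v : ℤ, |u| ≤ v → 1 ≤ v → |t| ≤ t ^ 2 + 2 * (u * t) + 2 * (v + 1) ^ 2 := by
    intro t u v hu hv
    rw [abs_le] at hu
    rcases abs_cases t with ⟨h, h'⟩ | ⟨h, h'⟩ <;> rw [h] <;> nlinarith [sq_nonneg (t - 1 - v),
      sq_nonneg (t + 1 + v)]
  have k1 := key κ.1 (2 * A + c₁) (2 * A + |c₁|) (by
    refine (abs_add_le _ _).trans ?_
    rw [abs_of_nonneg (by omega : 0 ≤ 2 * A)]) (by have := abs_nonneg c₁; omega)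
  have k2 := key κ.2 (A + c₂) (A + |c₂|) (by
    refine (abs_add_le _ _).trans ?_
    rw [abs_of_nonneg (by omega : 0 ≤ A)]) (by have := abs_nonneg c₂; omega)
  rw [Int.natCast_natAbs, Int.natCast_natAbs, latQ]
  have : κ.1 ^ 2 + κ.2 ^ 2 ≤ 2 * (A * (3 * κ.1 ^ 2 + 3 * κ.2 ^ 2 + 3 * κ.1 * κ.2)) := by
    have h1 : κ.1 ^ 2 + κ.2 ^ 2 ≤ 2 * (3 * κ.1 ^ 2 + 3 * κ.2 ^ 2 + 3 * κ.1 * κ.2) := by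
      nlinarith [sq_nonneg (κ.1 + κ.2), sq_nonneg κ.1, sq_nonneg κ.2]
    have h2 : 0 ≤ 3 * κ.1 ^ 2 + 3 * κ.2 ^ 2 + 3 * κ.1 * κ.2 := by
      nlinarith [sq_nonneg κ.1, sq_nonneg κ.2]
    nlinarith
  nlinarith

variable (q) in
lemma summable_sqrt_pow_int : Summable fun n : ℤ => √‖q‖ ^ n.natAbs := by
  have h := summable_sqrt_pow q
  refine Summable.of_nat_of_neg ?_ ?_
  · simpa using h
  · simpa using h

/-- Theta series over the lattice converge absolutely. -/
lemma summable_lat {A : ℤ} (hA : 1 ≤ A) (f : ℤ × ℤ → ℤ) (c₀ c₁ c₂ : ℤ)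
    (hf : ∀ κ, f κ = A * latQ κ + c₁ * κ.1 + c₂ * κ.2 + c₀) : Summable fun κ => ‖q ^ f κ‖ := by
  have h0 := hq.ne_zero
  set C := (2 * A + |c₁| + 1) ^ 2 + (A + |c₂| + 1) ^ 2 with hC
  have hs : Summable fun κ : ℤ × ℤ => √‖q‖ ^ (κ.1.natAbs + κ.2.natAbs) := by
    simp only [pow_add]
    exact (summable_sqrt_pow_int q).mul_of_nonneg (summable_sqrt_pow_int q)
      (fun n => pow_nonneg (Real.sqrt_nonneg _) _) (fun n => pow_nonneg (Real.sqrt_nonneg _) _)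
  refine Summable.of_nonneg_of_le (fun κ => norm_nonneg _) (fun κ => ?_)
    (hs.mul_left ‖q ^ (c₀ - C)‖)
  rw [zpow_split (q := q) (a := f κ) (b := c₀ - C) (c := A * latQ κ + c₁ * κ.1 + c₂ * κ.2 + C) (by
    rw [hf]; ring), norm_mul]
  gcongr
  refine norm_zpow_le ?_
  rw [Nat.cast_add]
  exact latQ_add_le A hA c₁ c₂ κ

end Limits

/-- Pointwise convergence of a sequence of families under a summable majorant. -/
def DominatedLimit {ι : Type*} (g : ℕ → ι → ℂ) (G : ι → ℂ) : Prop :=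
  ∃ B : ι → ℝ, Summable B ∧ (∀ n i, ‖g n i‖ ≤ B i) ∧ ∀ i, Tendsto (g · i) atTop (𝓝 (G i))

namespace DominatedLimit

variable {ι : Type*} {g h : ℕ → ι → ℂ} {G H : ι → ℂ}

lemma add (hg : DominatedLimit g G) (hh : DominatedLimit h H) :
    DominatedLimit (fun n i => g n i + h n i) (fun i => G i + H i) := by
  obtain ⟨B, h1, h2, h3⟩ := hg
  obtain ⟨D, h4, h5, h6⟩ := hh
  exact ⟨fun i => B i + D i, h1.add h4,
    fun n i => (norm_add_le _ _).trans (add_le_add (h2 n i) (h5 n i)), fun i => (h3 i).add (h6 i)⟩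

lemma sub (hg : DominatedLimit g G) (hh : DominatedLimit h H) :
    DominatedLimit (fun n i => g n i - h n i) (fun i => G i - H i) := by
  obtain ⟨B, h1, h2, h3⟩ := hg
  obtain ⟨D, h4, h5, h6⟩ := hh
  exact ⟨fun i => B i + D i, h1.add h4,
    fun n i => (norm_sub_le _ _).trans (add_le_add (h2 n i) (h5 n i)), fun i => (h3 i).sub (h6 i)⟩

lemma tendsto_tsum (hg : DominatedLimit g G) :
    Tendsto (fun n => ∑' i, g n i) atTop (𝓝 (∑' i, G i)) := by
  obtain ⟨B, h1, h2, h3⟩ := hg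
  exact tendsto_tsum_of_dominated_convergence h1 h3 (Eventually.of_forall h2)

end DominatedLimit

section Limits

variable {q : ℂ} [hq : Nome q]

lemma tendsto_intCast_natCast_add (c : ℤ) : Tendsto (fun n : ℕ => (n : ℤ) + c) atTop atTop :=
  tendsto_atTop_add_const_right _ _ tendsto_natCast_atTop_atTop

lemma tendsto_ker (a b c : ℤ) : Tendsto (fun n : ℕ => ker q n n a b c) atTop
    (𝓝 ((qPochInf q q)⁻¹ ^ 5)) := by
  have h0 := qPochInf_self_ne_zero (q := q)
  have hr : ∀ c : ℤ, Tendsto (fun n : ℕ => rq q ((n : ℤ) + c)) atTop (𝓝 (qPochInf q q)⁻¹) :=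
    fun c => tendsto_rq.comp (tendsto_intCast_natCast_add c)
  have hs : ∀ c : ℤ, Tendsto (fun n : ℕ => rq q ((n : ℤ) - c)) atTop (𝓝 (qPochInf q q)⁻¹) :=
    fun c => by simpa only [sub_eq_add_neg] using hr (-c)
  have hp : Tendsto (fun n : ℕ => qp q ((n : ℤ) + n)) atTop (𝓝 (qPochInf q q)) :=
    tendsto_qp.comp (tendsto_natCast_atTop_atTop.atTop_add_atTop tendsto_natCast_atTop_atTop)
  have h := ((hp.mul ((hs a).mul (hr a))).mul ((hs b).mul (hr b))).mul ((hs c).mul (hr c))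
  have e : qPochInf q q * ((qPochInf q q)⁻¹ * (qPochInf q q)⁻¹) *
      ((qPochInf q q)⁻¹ * (qPochInf q q)⁻¹) * ((qPochInf q q)⁻¹ * (qPochInf q q)⁻¹) =
      (qPochInf q q)⁻¹ ^ 5 := by
    field_simp
  rw [e] at h
  exact h

lemma dominatedLimit_zpow_mul_ker {f : ℤ × ℤ → ℤ} (hf : Summable fun κ => ‖q ^ f κ‖)
    (x y z : ℤ × ℤ → ℤ) :
    DominatedLimit (fun n κ => q ^ f κ * ker q (n : ℕ) (n : ℕ) (x κ) (y κ) (z κ))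
      (fun κ => q ^ f κ * (qPochInf q q)⁻¹ ^ 5) := by
  obtain ⟨C, hC, hr, hp, -⟩ := exists_bound q
  have hC0 : 0 ≤ C := zero_le_one.trans hC
  refine ⟨fun κ => ‖q ^ f κ‖ * (C * (C * C) * (C * C) * (C * C)), hf.mul_right _,
    fun n κ => ?_, fun κ => (tendsto_ker _ _ _).const_mul _⟩
  simp only [ker, norm_mul]
  gcongr <;> first | exact hr _ | exact hp _

/-- The limit of `diffTerm`, without the kernel's limiting constant. -/
def thetaTerm (q : ℂ) (k a b e : ℤ) (x y z : ℤ) : ℂ :=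
  q ^ ((3 * k + 4) * e + (b + 1) * (1 + x) + (a + 1) * (1 - y)) -
  q ^ ((3 * k + 4) * e + (b + 1) * (1 + x) + (a + 1) * (1 - z))

lemma dominatedLimit_diffTerm {k : ℤ} (hk : 0 ≤ k) (a b : ℤ) :
    DominatedLimit (fun n κ => cyc (diffTerm q k a b (latQ κ) (n : ℕ) (n : ℕ)) κ)
      (fun κ => cyc (thetaTerm q k a b (latQ κ)) κ * (qPochInf q q)⁻¹ ^ 5) := by
  have hA : 1 ≤ 3 * k + 4 := by omega
  have key : ∀ x y : ℤ × ℤ → ℤ, (∃ c₀ c₁ c₂, ∀ κ, x κ = c₁ * κ.1 + c₂ * κ.2 + c₀) →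
      (∃ c₀ c₁ c₂, ∀ κ, y κ = c₁ * κ.1 + c₂ * κ.2 + c₀) → Summable fun κ =>
        ‖q ^ ((3 * k + 4) * latQ κ + (b + 1) * (1 + x κ) + (a + 1) * (1 - y κ))‖ := by
    rintro x y ⟨c₀, c₁, c₂, hx⟩ ⟨d₀, d₁, d₂, hy⟩
    refine summable_lat hA _ ((b + 1) * (1 + c₀) + (a + 1) * (1 - d₀))
      ((b + 1) * c₁ - (a + 1) * d₁) ((b + 1) * c₂ - (a + 1) * d₂) fun κ => ?_
    rw [hx, hy]
    ring
  have h1 : ∃ c₀ c₁ c₂, ∀ κ, lat1 κ = c₁ * κ.1 + c₂ * κ.2 + c₀ :=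
    ⟨1, 3, 0, fun κ => by simp only [lat1]; ring⟩
  have h2 : ∃ c₀ c₁ c₂, ∀ κ, lat2 κ = c₁ * κ.1 + c₂ * κ.2 + c₀ :=
    ⟨0, 0, 3, fun κ => by simp only [lat2]; ring⟩
  have h3 : ∃ c₀ c₁ c₂, ∀ κ, lat3 κ = c₁ * κ.1 + c₂ * κ.2 + c₀ :=
    ⟨-1, -3, -3, fun κ => by simp only [lat3]; ring⟩
  have main : ∀ x y z : ℤ × ℤ → ℤ, (∃ c₀ c₁ c₂, ∀ κ, x κ = c₁ * κ.1 + c₂ * κ.2 + c₀) →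
      (∃ c₀ c₁ c₂, ∀ κ, y κ = c₁ * κ.1 + c₂ * κ.2 + c₀) →
      (∃ c₀ c₁ c₂, ∀ κ, z κ = c₁ * κ.1 + c₂ * κ.2 + c₀) →
      DominatedLimit (fun n κ => diffTerm q k a b (latQ κ) (n : ℕ) (n : ℕ) (x κ) (y κ) (z κ))
        (fun κ => thetaTerm q k a b (latQ κ) (x κ) (y κ) (z κ) * (qPochInf q q)⁻¹ ^ 5) := by
    intro x y z hx hy hz
    simp only [thetaTerm, sub_mul]
    exact (dominatedLimit_zpow_mul_ker (key x y hx hy) _ _ _).sub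
      (dominatedLimit_zpow_mul_ker (key x z hx hz) _ _ _)
  simp only [cyc, add_mul]
  exact ((main _ _ _ h1 h2 h3).add (main _ _ _ h2 h3 h1)).add (main _ _ _ h3 h1 h2)

/-- The multisum side expressed by an `A₂` theta series. -/
lemma multisum_sub_eq_tsum {k a b : ℕ} (hab : a ≤ b) (hb : b ≤ k + 1) :
    multisum q k a b - (if a = 0 ∨ b = 0 then 0 else q * multisum q k (a - 1) (b - 1)) =
      (qPochInf q q)⁻¹ ^ 2 *
        ∑' κ, cyc (thetaTerm q ((k + 1 : ℕ) : ℤ) a b (latQ κ)) κ := by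
  have h1 := tendsto_chainDiff (q := q) k a b
  have h2 := (dominatedLimit_diffTerm (q := q) (k := ((k + 1 : ℕ) : ℤ)) (by omega) a b).tendsto_tsum
  obtain ⟨c, rfl⟩ := Nat.exists_eq_add_of_le' hab
  obtain ⟨d, hd⟩ := Nat.exists_eq_add_of_le' hb
  have e : d + c + a = k + 1 := by omega
  have h3 := hasSum_chainDiff (q := q) d c a
  rw [e] at h3
  simp only [fun n : ℕ => (h3 n n).tsum_eq] at h2
  have h4 := tendsto_nhds_unique h1 h2
  rw [tsum_mul_right] at h4
  refine mul_left_cancel₀ (pow_ne_zero 3 (inv_ne_zero (qPochInf_self_ne_zero (q := q)))) ?_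
  rw [h4]
  ring

end Limits

/-- The triangular number `j (j - 1) / 2`. -/
def tri (j : ℤ) : ℤ := j * (j - 1) / 2

lemma two_mul_tri (j : ℤ) : 2 * tri j = j * (j - 1) :=
  Int.mul_ediv_cancel' (Int.even_mul_pred_self j).two_dvd

lemma tri_sub_one (j : ℤ) : tri (j - 1) = tri j - (j - 1) := by
  have h1 := two_mul_tri (j - 1)
  have h2 := two_mul_tri j
  have : 2 * tri (j - 1) = 2 * (tri j - (j - 1)) := by linear_combination h1 - h2
  omega

lemma tri_add_one (j : ℤ) : tri (j + 1) = tri j + j := by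
  have h := tri_sub_one (j + 1)
  rw [add_sub_cancel_right] at h
  omega

section Theta

variable {q : ℂ} [hq : Nome q]

variable (q) in
lemma Nome.pow {K : ℕ} (hK : 1 ≤ K) : Nome (q ^ K) where
  ne_zero := pow_ne_zero _ hq.ne_zero
  norm_lt_one := by
    rw [norm_pow]
    exact pow_lt_one₀ (norm_nonneg _) hq.norm_lt_one (by omega)

/-- The coefficient of `x ^ j` in the finite form of the Jacobi triple product. -/
def jacobiCoeff (q : ℂ) (N : ℕ) (j : ℤ) : ℂ :=
  (-1) ^ j * (qp q (2 * N) * (rq q (N - j) * rq q (N + j))) * q ^ tri j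

lemma jacobiCoeff_succ (N : ℕ) (j : ℤ) : jacobiCoeff q (N + 1) j =
    (1 + q ^ (2 * N + 1)) * jacobiCoeff q N j - q ^ N * jacobiCoeff q N (j - 1) -
      q ^ (N + 1) * jacobiCoeff q N (j + 1) := by
  have h0 := hq.ne_zero
  have hm : (-1 : ℂ) ≠ 0 := by norm_num
  have a1 := rq_rec (q := q) (N + 1 - j)
  have a2 := rq_rec (q := q) (N - j)
  have b1 := rq_rec (q := q) (N + 1 + j)
  have b2 := rq_rec (q := q) (N + j)
  have c1 := qp_rec (q := q) (n := 2 * N + 2) (by omega)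
  have c2 := qp_rec (q := q) (n := 2 * N + 1) (by omega)
  rw [show (N : ℤ) + 1 - j - 1 = N - j by ring] at a1
  rw [show (N : ℤ) + 1 + j - 1 = N + j by ring] at b1
  rw [show 2 * (N : ℤ) + 2 - 1 = 2 * N + 1 by ring] at c1
  rw [show 2 * (N : ℤ) + 1 - 1 = 2 * N by ring] at c2
  simp only [jacobiCoeff]
  rw [tri_sub_one, tri_add_one, show (N : ℤ) - (j - 1) = N + 1 - j by ring,
    show (N : ℤ) + (j - 1) = N + j - 1 by ring, show (N : ℤ) - (j + 1) = N - j - 1 by ring,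
    show (N : ℤ) + (j + 1) = N + 1 + j by ring, Nat.cast_succ,
    show 2 * ((N : ℤ) + 1) = 2 * N + 2 by ring, c1, c2, ← a2, ← a1, ← b2, ← b1,
    zpow_sub_one₀ hm, zpow_add_one₀ hm]
  have e1 : q ^ (2 * (N : ℤ) + 2) = (q ^ N) ^ 2 * q ^ 2 := by
    rw [← pow_mul, ← pow_add, ← zpow_natCast]
    exact zpow_congr (by push_cast; ring)
  have e2 : q ^ (2 * (N : ℤ) + 1) = (q ^ N) ^ 2 * q := by
    rw [← pow_mul, ← pow_succ, ← zpow_natCast]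
    exact zpow_congr (by push_cast; ring)
  have e3 : q ^ (2 * N + 1) = (q ^ N) ^ 2 * q := by ring
  have e4 : q ^ ((N : ℤ) + 1 - j) = q ^ N * q / q ^ j := by
    rw [← pow_succ, ← zpow_natCast, ← zpow_sub₀ h0]
    exact zpow_congr (by push_cast; ring)
  have e5 : q ^ ((N : ℤ) + 1 + j) = q ^ N * q * q ^ j := by
    rw [← pow_succ, ← zpow_natCast, ← zpow_add₀ h0]
    exact zpow_congr (by push_cast; ring)
  have e6 : q ^ ((N : ℤ) - j) = q ^ N / q ^ j := by
    rw [← zpow_natCast, ← zpow_sub₀ h0]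
  have e7 : q ^ ((N : ℤ) + j) = q ^ N * q ^ j := by
    rw [← zpow_natCast, ← zpow_add₀ h0]
  have e8 : q ^ (tri j - (j - 1)) = q ^ tri j * q / q ^ j := by
    rw [← zpow_add_one₀ h0, ← zpow_sub₀ h0]
    exact zpow_congr (by ring)
  have e9 : q ^ (tri j + j) = q ^ tri j * q ^ j := zpow_add₀ h0 _ _
  rw [e1, e2, e3, e4, e5, e6, e7, e8, e9, pow_succ q N]
  have hv : q ^ j ≠ 0 := zpow_ne_zero _ h0
  generalize q ^ j = v at *
  generalize q ^ N = u
  generalize q ^ tri j = t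
  generalize (-1 : ℂ) ^ j = s
  generalize rq q _ = R
  generalize rq q _ = S
  generalize qp q _ = P
  field_simp
  ring

lemma hasSum_jacobiCoeff {x : ℂ} (hx : x ≠ 0) (N : ℕ) :
    HasSum (fun j : ℤ => jacobiCoeff q N j * x ^ j) (qPoch x q N * qPoch (q / x) q N) := by
  induction N with
  | zero =>
    refine HasSum.of_eq (hasSum_single (f := fun j : ℤ => jacobiCoeff q 0 j * x ^ j) 0
      fun j hj => ?_) (fun _ => rfl) ?_
    · simp only [jacobiCoeff]
      rcases lt_or_gt_of_ne hj with h | h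
      · rw [rq_neg (n := ((0 : ℕ) : ℤ) + j) (by simpa using h)]; simp
      · rw [rq_neg (n := ((0 : ℕ) : ℤ) - j) (by simpa using h)]; simp
    · simp [jacobiCoeff, qPoch_zero, rq_zero, qp_zero, tri]
  | succ N ih =>
    have h1 := ih.mul_left (1 + q ^ (2 * N + 1))
    have h2 := (((Equiv.subRight (1 : ℤ)).hasSum_iff).mpr ih).mul_left (q ^ N * x)
    have h3 := (((Equiv.addRight (1 : ℤ)).hasSum_iff).mpr ih).mul_left (q ^ (N + 1) / x)
    refine HasSum.of_eq ((h1.sub h2).sub h3) (fun j => ?_) ?_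
    · simp only [Function.comp, Equiv.subRight_apply, Equiv.coe_addRight]
      rw [jacobiCoeff_succ, zpow_sub_one₀ hx, zpow_add_one₀ hx]
      field_simp
    · rw [qPoch_succ, qPoch_succ]
      field_simp
      ring

lemma summable_tri {K : ℕ} (hK : 1 ≤ K) (m : ℤ) :
    Summable fun j : ℤ => ‖q ^ (K * tri j + m * j)‖ := by
  set D : ℤ := K + 2 * |m| + 1 with hD
  refine Summable.of_nonneg_of_le (fun j => norm_nonneg _) (fun j => ?_)
    ((summable_sqrt_pow_int q).mul_left ‖q ^ (-D ^ 2)‖)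
  rw [zpow_split (q := q) (a := K * tri j + m * j) (b := -D ^ 2) (c := K * tri j + m * j + D ^ 2)
    (by ring), norm_mul]
  gcongr
  refine norm_zpow_le ?_
  have h1 := two_mul_tri j
  have h2 : |m * j| = |m| * |j| := abs_mul m j
  have h3 := neg_abs_le (m * j)
  have h4 := le_abs_self j
  have hK' : (1 : ℤ) ≤ K := by exact_mod_cast hK
  have h5 : 0 ≤ |m| := abs_nonneg m
  have h6 : 0 ≤ |j| := abs_nonneg j
  have h7 : |j| ^ 2 = j ^ 2 := sq_abs j
  rw [Int.natCast_natAbs]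
  have h8 : (K : ℤ) * j ≤ K * |j| := by gcongr
  have h9 : 2 * (K * tri j + m * j + D ^ 2) = K * (j * (j - 1)) + 2 * (m * j) + 2 * D ^ 2 := by
    rw [← h1]; ring
  have h10 : j ^ 2 ≤ K * j ^ 2 := le_mul_of_one_le_left (sq_nonneg j) hK'
  rw [h9]
  nlinarith [sq_nonneg (D - |j|)]

/-- The Jacobi triple product identity, for powers of `q`. -/
lemma hasSum_theta {K : ℕ} (hK : 1 ≤ K) (m : ℤ) :
    HasSum (fun j : ℤ => (-1) ^ j * q ^ (K * tri j + m * j))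
      (qPochInf (q ^ K) (q ^ K) * theta (q ^ m) (q ^ K)) := by
  have h0 := hq.ne_zero
  have hp := Nome.pow q hK
  have hx : q ^ m ≠ 0 := zpow_ne_zero _ h0
  have hP := qPochInf_self_ne_zero (q := q ^ K)
  have e : ∀ j : ℤ, (q ^ K) ^ tri j * (q ^ m) ^ j = q ^ (K * tri j + m * j) := fun j => by
    rw [← zpow_natCast, ← zpow_mul, ← zpow_mul, ← zpow_add₀ h0]
  have hs := summable_tri (q := q) hK m
  have hd : DominatedLimit (fun N j => jacobiCoeff (q ^ K) N j * (q ^ m) ^ j)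
      (fun j => (-1) ^ j * q ^ (K * tri j + m * j) * (qPochInf (q ^ K) (q ^ K))⁻¹) := by
    obtain ⟨C, hC, hr, hp, -⟩ := exists_bound (q ^ K)
    have hC0 : 0 ≤ C := zero_le_one.trans hC
    refine ⟨_, hs.mul_left (1 * (C * (C * C))), fun n j => ?_, fun j => ?_⟩
    · simp only [jacobiCoeff]
      rw [← e, mul_assoc _ ((q ^ K) ^ tri j), norm_mul]
      gcongr
      rw [norm_mul, norm_mul, norm_mul, norm_zpow, norm_neg, norm_one, one_zpow]
      gcongr <;> first | exact hr _ | exact hp _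
    · have h1 : Tendsto (fun n : ℕ => qp (q ^ K) (2 * (n : ℤ))) atTop
          (𝓝 (qPochInf (q ^ K) (q ^ K))) :=
        tendsto_qp.comp (tendsto_natCast_atTop_atTop.const_mul_atTop' two_pos)
      have h2 : Tendsto (fun n : ℕ => rq (q ^ K) ((n : ℤ) + j)) atTop
          (𝓝 (qPochInf (q ^ K) (q ^ K))⁻¹) := tendsto_rq.comp (tendsto_intCast_natCast_add _)
      have h3 : Tendsto (fun n : ℕ => rq (q ^ K) ((n : ℤ) - j)) atTop
          (𝓝 (qPochInf (q ^ K) (q ^ K))⁻¹) := tendsto_rq.comp (tendsto_intCast_natCast_add _)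
      have h4 := ((((h1.mul (h3.mul h2)).const_mul ((-1) ^ j)).mul_const ((q ^ K) ^ tri j))).mul_const
        ((q ^ m) ^ j)
      simp only [jacobiCoeff]
      convert h4 using 2
      rw [← e]
      field_simp
  have h1 := hd.tendsto_tsum
  simp only [fun N => (hasSum_jacobiCoeff (q := q ^ K) hx N).tsum_eq] at h1
  have h2 := tendsto_nhds_unique h1
    ((tendsto_qPoch (q ^ m) hp.norm_lt_one).mul (tendsto_qPoch (q ^ K / q ^ m) hp.norm_lt_one))
  rw [tsum_mul_right] at h2
  rw [theta, ← h2, mul_comm, mul_assoc, inv_mul_cancel₀ hP, mul_one]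
  refine Summable.hasSum (Summable.of_norm ?_)
  simpa using hs

end Theta

lemma tri_sub (l h : ℤ) : tri (l - h) = tri l + tri h + h - l * h := by
  have h1 := two_mul_tri (l - h)
  have h2 := two_mul_tri l
  have h3 := two_mul_tri h
  have : 2 * tri (l - h) = 2 * (tri l + tri h + h - l * h) := by linear_combination h1 - h2 - h3
  omega

lemma qPoch_three_mul (p : ℂ) (N : ℕ) : qPoch p p (3 * N) =
    qPoch (p ^ 3) (p ^ 3) N * (qPoch (p ^ 2) (p ^ 3) N * qPoch p (p ^ 3) N) := by
  induction N with
  | zero => simp [qPoch]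
  | succ N ih =>
    rw [mul_add_one, qPoch_succ, qPoch_succ, qPoch_succ, qPoch_succ, qPoch_succ, qPoch_succ, ih]
    ring

lemma qPochInf_eq_mul {p : ℂ} (hp : ‖p‖ < 1) : qPochInf p p =
    qPochInf (p ^ 3) (p ^ 3) * (qPochInf (p ^ 2) (p ^ 3) * qPochInf p (p ^ 3)) := by
  have hp3 : ‖p ^ 3‖ < 1 := by
    rw [norm_pow]
    exact pow_lt_one₀ (norm_nonneg _) hp three_ne_zero
  have h1 := (tendsto_qPoch p hp).comp (tendsto_id.const_mul_atTop' (three_pos (α := ℕ)))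
  have h2 := (tendsto_qPoch (p ^ 3) hp3).mul ((tendsto_qPoch (p ^ 2) hp3).mul (tendsto_qPoch p hp3))
  refine tendsto_nhds_unique h1 (h2.congr fun N => ?_)
  exact (qPoch_three_mul p N).symm

section Macdonald

variable {q : ℂ} [hq : Nome q]

/-- The general term of the inner theta series in the `A₂` Macdonald identity. -/
def innerTerm (q : ℂ) (K : ℕ) (s l : ℤ) : ℂ := (-1) ^ l * q ^ (K * (3 * tri l + 2 * l - s * l))

lemma hasSum_innerTerm_shift {K : ℕ} {e : ℤ} {S : ℂ} (hS : HasSum (innerTerm q K e) S) (h : ℤ) :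
    HasSum (innerTerm q K (3 * h + e))
      ((-1) ^ h * q ^ (-(K * (3 * tri h + h + e * h))) * S) := by
  have h0 := hq.ne_zero
  have hm : (-1 : ℂ) ≠ 0 := by norm_num
  refine HasSum.of_eq (((Equiv.subRight h).hasSum_iff.mpr hS).mul_left
    ((-1) ^ h * q ^ (-(K * (3 * tri h + h + e * h))))) (fun l => ?_) rfl
  simp only [Function.comp, Equiv.subRight_apply, innerTerm]
  rw [tri_sub, mul_mul_mul_comm, ← zpow_add₀ hm, ← zpow_add₀ h0]
  congr 1
  · exact congrArg _ (by ring)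
  · exact zpow_congr (by ring)

lemma hasSum_innerTerm_zero {K : ℕ} (hK : 1 ≤ K) :
    HasSum (innerTerm q K 0) (qPochInf (q ^ K) (q ^ K)) := by
  have h0 := hq.ne_zero
  have h := hasSum_theta (q := q) (K := 3 * K) (by omega) (2 * K)
  refine HasSum.of_eq h (fun l => ?_) ?_
  · rw [innerTerm]
    congr 1
    exact zpow_congr (by push_cast; ring)
  · have e1 : q ^ (3 * K) = (q ^ K) ^ 3 := by ring
    have e2 : q ^ (2 * (K : ℤ)) = (q ^ K) ^ 2 := by
      rw [← pow_mul, ← zpow_natCast]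
      exact zpow_congr (by push_cast; ring)
    have e3 : (q ^ K) ^ 3 / (q ^ K) ^ 2 = q ^ K := by
      field_simp
    rw [theta, e1, e2, e3, ← qPochInf_eq_mul (Nome.pow q hK).norm_lt_one]

lemma hasSum_innerTerm_one {K : ℕ} (hK : 1 ≤ K) :
    HasSum (innerTerm q K 1) (qPochInf (q ^ K) (q ^ K)) := by
  refine HasSum.of_eq ((Equiv.neg ℤ).hasSum_iff.mpr (hasSum_innerTerm_zero (q := q) hK))
    (fun l => ?_) rfl
  have h := tri_sub 0 l
  have h1 : tri 0 = 0 := rfl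
  simp only [Function.comp, Equiv.neg_apply, innerTerm]
  rw [zpow_neg, ← inv_zpow, inv_neg, inv_one]
  congr 1
  refine zpow_congr ?_
  rw [zero_sub, h1] at h
  rw [h]
  ring

lemma hasSum_innerTerm_two {K : ℕ} (hK : 1 ≤ K) : HasSum (innerTerm q K 2) 0 := by
  have hs : Summable (innerTerm q K 2) := by
    refine Summable.of_norm ((summable_tri (q := q) (K := 3 * K) (by omega) 0).congr fun l => ?_)
    rw [innerTerm, norm_mul, norm_zpow (-1), norm_neg, norm_one, one_zpow, one_mul]
    congr 1
    exact zpow_congr (by push_cast; ring)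
  obtain ⟨S, hS⟩ := hs
  have h1 : HasSum (innerTerm q K 2) (-S) := by
    refine HasSum.of_eq ((Equiv.subLeft (1 : ℤ)).hasSum_iff.mpr hS).neg (fun l => ?_) rfl
    have h := tri_sub 1 l
    have h1 : tri 1 = 0 := rfl
    simp only [Function.comp, Equiv.subLeft_apply, innerTerm]
    rw [zpow_sub₀ (by norm_num), zpow_one, div_eq_mul_inv, ← inv_zpow, inv_neg, inv_one, neg_one_mul,
      neg_mul, neg_neg]
    congr 1
    refine zpow_congr ?_
    rw [h, h1]
    ring
  have h2 : S = 0 := self_eq_neg.mp (hS.unique h1)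
  rwa [h2] at hS

/-- The term of the `A₂` theta product after summation along the diagonal direction. -/
def outerTerm (q : ℂ) (K : ℕ) (m₁ m₂ : ℤ) (p : ℤ × ℤ) : ℂ :=
  (-1) ^ (p.1 + p.2) * q ^ (K * (tri p.1 + tri p.2) + m₁ * p.1 + m₂ * p.2) *
    ∑' l, innerTerm q K (p.1 + p.2) l

lemma outerTerm_eq_of_zero {K : ℕ} (hK : 1 ≤ K) (m₁ m₂ : ℤ) {A B h E : ℤ} (hAB : A + B = 3 * h)
    (hE : 2 * E = A ^ 2 - A + B ^ 2 - B - 3 * h ^ 2 + h) :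
    outerTerm q K m₁ m₂ (A, B) = q ^ (K * E + m₂ * B + m₁ * A) * qPochInf (q ^ K) (q ^ K) := by
  have h0 := hq.ne_zero
  have h1 := hasSum_innerTerm_shift (hasSum_innerTerm_zero (q := q) hK) h
  have hE' : E = tri A + tri B - 3 * tri h - h := by
    have := two_mul_tri A
    have := two_mul_tri B
    have := two_mul_tri h
    have : 2 * E = 2 * (tri A + tri B - 3 * tri h - h) := by linarith
    omega
  rw [outerTerm]
  simp only
  rw [hAB, ← add_zero (3 * h), h1.tsum_eq, add_zero, ← mul_assoc]
  congr 1
  rw [mul_mul_mul_comm, ← zpow_add₀ (by norm_num), ← zpow_add₀ h0,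
    Even.neg_one_zpow ⟨2 * h, by ring⟩, one_mul]
  refine zpow_congr ?_
  rw [hE']
  ring

lemma outerTerm_eq_of_one {K : ℕ} (hK : 1 ≤ K) (m₁ m₂ : ℤ) {A B h E : ℤ} (hAB : A + B = 3 * h + 1)
    (hE : 2 * E = A ^ 2 - A + B ^ 2 - B - 3 * h ^ 2 - h) :
    outerTerm q K m₁ m₂ (A, B) = -(q ^ (K * E + m₂ * B + m₁ * A) * qPochInf (q ^ K) (q ^ K)) := by
  have h0 := hq.ne_zero
  have h1 := hasSum_innerTerm_shift (hasSum_innerTerm_one (q := q) hK) h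
  have hE' : E = tri A + tri B - 3 * tri h - 2 * h := by
    have := two_mul_tri A
    have := two_mul_tri B
    have := two_mul_tri h
    have : 2 * E = 2 * (tri A + tri B - 3 * tri h - 2 * h) := by linarith
    omega
  rw [outerTerm]
  simp only
  rw [hAB, h1.tsum_eq, ← mul_assoc]
  rw [mul_mul_mul_comm, ← zpow_add₀ (by norm_num), ← zpow_add₀ h0,
    Odd.neg_one_zpow ⟨2 * h, by ring⟩, neg_one_mul, neg_mul]
  congr 2
  refine zpow_congr ?_
  rw [hE']
  ring

lemma outerTerm_eq_of_two {K : ℕ} (hK : 1 ≤ K) (m₁ m₂ : ℤ) {A B h : ℤ}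
    (hAB : A + B = 3 * h + 2) : outerTerm q K m₁ m₂ (A, B) = 0 := by
  have h1 := hasSum_innerTerm_shift (hasSum_innerTerm_two (q := q) hK) h
  rw [outerTerm]
  simp only
  rw [hAB, h1.tsum_eq, mul_zero, mul_zero]

lemma hasSum_outerTerm {K : ℕ} (hK : 1 ≤ K) (m₁ m₂ : ℤ) :
    HasSum (outerTerm q K m₁ m₂) (qPochInf (q ^ K) (q ^ K) ^ 3 *
      (theta (q ^ m₁) (q ^ K) * theta (q ^ m₂) (q ^ K) * theta (q ^ (m₁ + m₂)) (q ^ K))) := by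
  have h0 := hq.ne_zero
  have hm : (-1 : ℂ) ≠ 0 := by norm_num
  obtain ⟨F, hF⟩ : ∃ F : ℤ → ℤ → ℂ, ∀ m j, F m j = (-1) ^ j * q ^ (K * tri j + m * j) :=
    ⟨_, fun _ _ => rfl⟩
  have hn : ∀ m : ℤ, Summable fun j : ℤ => ‖F m j‖ := fun m => by
    simpa [hF] using summable_tri (q := q) hK m
  have ht : ∀ m : ℤ, HasSum (F m) (qPochInf (q ^ K) (q ^ K) * theta (q ^ m) (q ^ K)) := fun m =>
    HasSum.of_eq (hasSum_theta hK m) (hF m) rfl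
  have s12 : Summable fun x : ℤ × ℤ => F m₁ x.1 * F m₂ x.2 :=
    summable_mul_of_summable_norm (hn m₁) (hn m₂)
  have s123 : Summable fun x : (ℤ × ℤ) × ℤ => F m₁ x.1.1 * F m₂ x.1.2 * F (m₁ + m₂) x.2 :=
    summable_mul_of_summable_norm (f := fun x : ℤ × ℤ => F m₁ x.1 * F m₂ x.2) (g := F (m₁ + m₂))
      (Summable.mul_norm (hn m₁) (hn m₂)) (hn _)
  have h123 := ((ht m₁).mul (ht m₂) s12).mul (ht (m₁ + m₂)) s123
  let φ : (ℤ × ℤ) × ℤ ≃ (ℤ × ℤ) × ℤ :=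
    { toFun := fun x => ((x.1.1 - x.2, x.1.2 - x.2), x.2)
      invFun := fun x => ((x.1.1 + x.2, x.1.2 + x.2), x.2)
      left_inv := fun x => by simp
      right_inv := fun x => by simp }
  have h := φ.hasSum_iff.mpr h123
  have e : ∀ x : (ℤ × ℤ) × ℤ,
      F m₁ (x.1.1 - x.2) * F m₂ (x.1.2 - x.2) * F (m₁ + m₂) x.2 =
      (-1) ^ (x.1.1 + x.1.2) * q ^ (K * (tri x.1.1 + tri x.1.2) + m₁ * x.1.1 + m₂ * x.1.2) *
        innerTerm q K (x.1.1 + x.1.2) x.2 := by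
    rintro ⟨⟨A, B⟩, l⟩
    simp only [innerTerm, hF]
    have hc : ∀ a b c d e f : ℂ, a * b * (c * d) * (e * f) = a * c * e * (b * d * f) := by
      intros; ring
    rw [hc, mul_mul_mul_comm ((-1) ^ (A + B)), ← zpow_add₀ hm,
      ← zpow_add₀ hm, ← zpow_add₀ hm, ← zpow_add₀ h0, ← zpow_add₀ h0, ← zpow_add₀ h0, tri_sub,
      tri_sub]
    congr 1
    · rw [show A - l + (B - l) + l = A + B + l - 2 * l by ring, zpow_sub₀ hm, zpow_mul]
      norm_num
    · exact zpow_congr (by ring)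
  have h' := HasSum.of_eq h (g := fun x : (ℤ × ℤ) × ℤ => (-1) ^ (x.1.1 + x.1.2) *
    q ^ (K * (tri x.1.1 + tri x.1.2) + m₁ * x.1.1 + m₂ * x.1.2) *
    innerTerm q K (x.1.1 + x.1.2) x.2) (fun x => (e x).symm) rfl
  refine HasSum.of_eq (h'.prod_fiberwise fun p => ((h'.summable.prod_factor p).hasSum))
    (fun p => ?_) (by ring)
  rw [outerTerm]
  exact tsum_mul_left.symm

omit hq in
lemma HasSum.split_mod_three {g : ℤ × ℤ → ℂ} {S : ℂ} (hg : HasSum g S) :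
    HasSum (fun κ : ℤ × ℤ => ∑ r : Fin 3, ∑ s : Fin 3, g (3 * κ.1 + (r : ℕ), 3 * κ.2 + (s : ℕ)))
      S := by
  let φ : (ℤ × ℤ) × (Fin 3 × Fin 3) ≃ ℤ × ℤ := (Equiv.prodProdProdComm _ _ _ _).trans
    ((Int.divModEquiv 3).symm.prodCongr (Int.divModEquiv 3).symm)
  have h := (φ.hasSum_iff.mpr hg).prod_fiberwise (fun κ => hasSum_fintype _)
  refine HasSum.of_eq h (fun κ => ?_) rfl
  rw [Fintype.sum_prod_type]
  simp [φ, Int.divModEquiv, mul_comm]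

/-- The `A₂` Macdonald identity. -/
lemma hasSum_cyc_thetaTerm (k a b : ℕ) :
    HasSum (fun κ => cyc (thetaTerm q k a b (latQ κ)) κ)
      (qPochInf (q ^ (3 * k + 4)) (q ^ (3 * k + 4)) ^ 2 *
        (theta (q ^ (a + 1)) (q ^ (3 * k + 4)) * theta (q ^ (b + 1)) (q ^ (3 * k + 4)) *
          theta (q ^ (a + b + 2)) (q ^ (3 * k + 4)))) := by
  have hK : 1 ≤ 3 * k + 4 := by omega
  have hp := Nome.pow q hK
  set P := qPochInf (q ^ (3 * k + 4)) (q ^ (3 * k + 4)) with hP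
  have hP0 : P ≠ 0 := qPochInf_self_ne_zero
  have h1 := hasSum_outerTerm (q := q) hK (a + 1) (b + 1)
  obtain ⟨g, hg⟩ : ∃ g, g = outerTerm q (3 * k + 4) (a + 1) (b + 1) := ⟨_, rfl⟩
  rw [← hg, ← hP] at h1
  have h2 := HasSum.split_mod_three h1
  have hs : ∀ r s : ℤ, HasSum (fun κ : ℤ × ℤ => g (3 * κ.1 + r, 3 * κ.2 + s))
      (∑' κ : ℤ × ℤ, g (3 * κ.1 + r, 3 * κ.2 + s)) := fun r s =>
    (h1.summable.comp_injective (i := fun κ : ℤ × ℤ => (3 * κ.1 + r, 3 * κ.2 + s))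
      fun x y h => by
        simp only [Prod.mk.injEq] at h
        exact Prod.ext (by omega) (by omega)).hasSum
  have z : ∀ κ : ℤ × ℤ, g (3 * κ.1 + 0, 3 * κ.2 + 2) = 0 ∧ g (3 * κ.1 + 1, 3 * κ.2 + 1) = 0 ∧
      g (3 * κ.1 + 2, 3 * κ.2 + 0) = 0 := fun κ => by
    rw [hg]
    refine ⟨?_, ?_, ?_⟩ <;>
      exact outerTerm_eq_of_two hK _ _ (h := κ.1 + κ.2) (by ring)
  have h3 := h2.unique (HasSum.of_eq
    ((((((hs 0 0).add (hs 0 1)).add (hs 1 0)).add (hs 1 2)).add (hs 2 1)).add (hs 2 2))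
    (fun κ => by
      obtain ⟨z1, z2, z3⟩ := z κ
      simp only [Fin.sum_univ_three]
      simp only [Fin.val_zero, Fin.val_one, Fin.val_two, Nat.cast_zero, Nat.cast_one,
        Nat.cast_ofNat, z1, z2, z3]
      ring) rfl)
  let φ₁ : ℤ × ℤ ≃ ℤ × ℤ := ⟨fun κ => (-κ.1, -κ.1 - κ.2), fun κ => (-κ.1, κ.1 - κ.2),
    fun κ => by simp, fun κ => by simp⟩
  let φ₂ : ℤ × ℤ ≃ ℤ × ℤ := ⟨fun κ => (-κ.1, κ.2), fun κ => (-κ.1, κ.2),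
    fun κ => by simp, fun κ => by simp⟩
  let φ₃ : ℤ × ℤ ≃ ℤ × ℤ := ⟨fun κ => (-κ.2, -κ.1 - κ.2), fun κ => (κ.1 - κ.2, -κ.1),
    fun κ => Prod.ext (by simp only; ring) (by simp only; ring), fun κ => by simp⟩
  let φ₄ : ℤ × ℤ ≃ ℤ × ℤ := ⟨fun κ => (-κ.2, κ.1), fun κ => (κ.2, -κ.1),
    fun κ => by simp, fun κ => by simp⟩
  let φ₅ : ℤ × ℤ ≃ ℤ × ℤ := ⟨fun κ => (κ.1 + κ.2, κ.2), fun κ => (κ.1 - κ.2, κ.2),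
    fun κ => by simp, fun κ => by simp⟩
  let φ₆ : ℤ × ℤ ≃ ℤ × ℤ := ⟨fun κ => (κ.1 + κ.2, κ.1), fun κ => (κ.2, κ.1 - κ.2),
    fun κ => by simp, fun κ => by simp⟩
  have h4 := (((((φ₁.hasSum_iff.mpr (hs 0 0)).add (φ₂.hasSum_iff.mpr (hs 0 1))).add
    (φ₃.hasSum_iff.mpr (hs 1 0))).add (φ₄.hasSum_iff.mpr (hs 1 2))).add
    (φ₅.hasSum_iff.mpr (hs 2 1))).add (φ₆.hasSum_iff.mpr (hs 2 2))
  rw [← h3] at h4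
  refine HasSum.of_eq (h4.mul_left P⁻¹) (fun κ => ?_) ?_
  · have e1 := outerTerm_eq_of_zero (q := q) hK (a + 1) (b + 1) (A := 3 * -κ.1 + 0)
      (B := 3 * (-κ.1 - κ.2) + 0) (h := -2 * κ.1 - κ.2) (E := latQ κ) (by ring)
      (by rw [latQ]; ring)
    have e2 := outerTerm_eq_of_one (q := q) hK (a + 1) (b + 1) (A := 3 * -κ.1 + 0)
      (B := 3 * κ.2 + 1) (h := κ.2 - κ.1) (E := latQ κ) (by ring) (by rw [latQ]; ring)
    have e3 := outerTerm_eq_of_one (q := q) hK (a + 1) (b + 1) (A := 3 * -κ.2 + 1)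
      (B := 3 * (-κ.1 - κ.2) + 0) (h := -κ.1 - 2 * κ.2) (E := latQ κ) (by ring)
      (by rw [latQ]; ring)
    have e4 := outerTerm_eq_of_zero (q := q) hK (a + 1) (b + 1) (A := 3 * -κ.2 + 1)
      (B := 3 * κ.1 + 2) (h := κ.1 - κ.2 + 1) (E := latQ κ) (by ring) (by rw [latQ]; ring)
    have e5 := outerTerm_eq_of_zero (q := q) hK (a + 1) (b + 1) (A := 3 * (κ.1 + κ.2) + 2)
      (B := 3 * κ.2 + 1) (h := κ.1 + 2 * κ.2 + 1) (E := latQ κ) (by ring) (by rw [latQ]; ring)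
    have e6 := outerTerm_eq_of_one (q := q) hK (a + 1) (b + 1) (A := 3 * (κ.1 + κ.2) + 2)
      (B := 3 * κ.1 + 2) (h := 2 * κ.1 + κ.2 + 1) (E := latQ κ) (by ring) (by rw [latQ]; ring)
    have hX : ∀ A B x y : ℤ, B = 1 + x → A = 1 - y →
        q ^ (((3 * k + 4 : ℕ) : ℤ) * latQ κ + (b + 1) * B + (a + 1) * A) =
        q ^ ((3 * (k : ℤ) + 4) * latQ κ + (b + 1) * (1 + x) + (a + 1) * (1 - y)) := by
      rintro A B x y rfl rfl
      exact zpow_congr (by push_cast; ring)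
    rw [hX _ _ (lat3 κ) (lat1 κ) (by simp only [lat3]; ring) (by simp only [lat1]; ring)] at e1
    rw [hX _ _ (lat2 κ) (lat1 κ) (by simp only [lat2]; ring) (by simp only [lat1]; ring)] at e2
    rw [hX _ _ (lat3 κ) (lat2 κ) (by simp only [lat3]; ring) (by simp only [lat2]; ring)] at e3
    rw [hX _ _ (lat1 κ) (lat2 κ) (by simp only [lat1]; ring) (by simp only [lat2]; ring)] at e4
    rw [hX _ _ (lat2 κ) (lat3 κ) (by simp only [lat2]; ring) (by simp only [lat3]; ring)] at e5
    rw [hX _ _ (lat1 κ) (lat3 κ) (by simp only [lat1]; ring) (by simp only [lat3]; ring)] at e6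
    rw [← hg] at e1 e2 e3 e4 e5 e6
    simp only [Function.comp, φ₁, φ₂, φ₃, φ₄, φ₅, φ₆, Equiv.coe_fn_mk]
    rw [e1, e2, e3, e4, e5, e6, cyc, thetaTerm, thetaTerm, thetaTerm, ← hP]
    field_simp
    ring
  · have e1 : q ^ ((a : ℤ) + 1) = q ^ (a + 1) := by exact_mod_cast zpow_natCast q (a + 1)
    have e2 : q ^ ((b : ℤ) + 1) = q ^ (b + 1) := by exact_mod_cast zpow_natCast q (b + 1)
    have e3 : q ^ ((a : ℤ) + 1 + (b + 1)) = q ^ (a + b + 2) := by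
      rw [← zpow_natCast]
      exact zpow_congr (by push_cast; ring)
    rw [e1, e2, e3]
    field_simp

end Macdonald

section Unroll

lemma nth_cons_one {k : ℕ} (l : ℕ) (f : Fin k → ℕ) :
    nth (Fin.cons l f : Fin (k + 1) → ℕ) 1 = l := by
  simp [nth]

lemma nth_cons_succ {k i : ℕ} (hi : 1 ≤ i) (l : ℕ) (f : Fin k → ℕ) :
    nth (Fin.cons l f : Fin (k + 1) → ℕ) (i + 1) = nth f i := by
  obtain ⟨j, rfl⟩ := Nat.exists_eq_add_of_le' hi
  unfold nth
  by_cases h : j + 1 ≤ k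
  · rw [dif_pos ⟨by omega, by omega⟩, dif_pos ⟨by omega, h⟩]
    exact Fin.cons_succ (α := fun _ => ℕ) l f ⟨j, h⟩
  · rw [dif_neg (by omega), dif_neg (by omega)]

lemma Mext_cons_succ {k i : ℕ} (hk : 1 ≤ k) (hi : 1 ≤ i) (l m : ℕ) (f g : Fin k → ℕ) :
    Mext (Fin.cons l f : Fin (k + 1) → ℕ) (Fin.cons m g : Fin (k + 1) → ℕ) (i + 1) =
      Mext f g i := by
  unfold Mext
  rw [nth_cons_succ hi, nth_cons_succ hk]
  simp only [add_left_inj]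

lemma sum_Icc_nth_cons {k : ℕ} (a l : ℕ) (f : Fin k → ℕ) :
    ∑ i ∈ Finset.Icc (a + 1) (k + 1), nth (Fin.cons l f : Fin (k + 1) → ℕ) i =
      (if a = 0 then l else 0) + ∑ i ∈ Finset.Icc (a - 1 + 1) k, nth f i := by
  have key : ∀ c, ∑ i ∈ Finset.Ico (c + 1 + 1) (k + 1 + 1),
      nth (Fin.cons l f : Fin (k + 1) → ℕ) i = ∑ i ∈ Finset.Ico (c + 1) (k + 1), nth f i := by
    intro c
    rw [← Finset.sum_Ico_add']
    refine Finset.sum_congr rfl fun i hi => nth_cons_succ ?_ _ _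
    rw [Finset.mem_Ico] at hi
    omega
  simp only [← Finset.Ico_add_one_right_eq_Icc]
  cases a with
  | zero =>
    rw [Finset.sum_eq_sum_Ico_succ_bot (by omega), zero_add, nth_cons_one, if_pos rfl]
    congr 1
    exact key 0
  | succ a =>
    rw [if_neg (by omega), zero_add, key]
    simp

lemma prod_Icc_one_succ (h : ℕ → ℂ) (k : ℕ) :
    ∏ i ∈ Finset.Icc 1 (k + 1), h i = h 1 * ∏ i ∈ Finset.Icc 1 k, h (i + 1) := by
  simp only [← Finset.Ico_add_one_right_eq_Icc]
  rw [Finset.prod_eq_prod_Ico_succ_bot (by omega), ← Finset.prod_Ico_add']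

/-- The summand of the Andrews-Gordon multisum. -/
def summand (q : ℂ) (k a b : ℕ) (p : (Fin k → ℕ) × (Fin k → ℕ)) : ℂ :=
  q ^ ((∑ i ∈ Finset.Icc (a + 1) k, nth p.1 i) + ∑ i ∈ Finset.Icc (b + 1) k, nth p.2 i) /
      qPoch q q (nth p.1 1) *
    ∏ i ∈ Finset.Icc 1 k,
      (q ^ (nth p.1 i ^ 2 + nth p.2 i ^ 2 - nth p.1 i * nth p.2 i) *
        qBinom q (nth p.1 i) (nth p.1 (i + 1)) *
        qBinom q ((nth p.1 i : ℤ) - (nth p.1 (i + 1) : ℤ) +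
            (Mext p.1 p.2 (i + 1) : ℤ) + (if b = i then 1 else 0))
          (nth p.2 i))

lemma cast_quad (l m : ℕ) : ((l ^ 2 + m ^ 2 - l * m : ℕ) : ℤ) = l ^ 2 + m ^ 2 - l * m := by
  have h : l * m ≤ l ^ 2 + m ^ 2 := by nlinarith [Nat.zero_le (l * m), two_mul_le_add_sq (l : ℤ) m]
  push_cast [Nat.cast_sub h]
  ring

lemma cast_del (b : ℕ) : ((del b : ℕ) : ℤ) = if b = 1 then 1 else 0 := by
  unfold del; split <;> simp

variable {q : ℂ} [hq : Nome q]

lemma pow_mul_pow_quad (a b l m s : ℕ) :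
    q ^ ((if a = 0 then l else 0) + (if b = 0 then m else 0) + s) * q ^ (l ^ 2 + m ^ 2 - l * m) =
      q ^ quadExp a b l m * q ^ s := by
  have h0 := hq.ne_zero
  rw [← pow_add, ← zpow_natCast, ← zpow_natCast, ← zpow_add₀ h0, Nat.cast_add, cast_quad]
  refine zpow_congr ?_
  rw [quadExp, ind, ind]
  split_ifs <;> push_cast <;> ring

omit hq in
lemma inv_qPoch_eq_rq (n : ℕ) : (qPoch q q n)⁻¹ = rq q n := by
  rw [rq, if_neg (by omega), Int.toNat_natCast]

lemma summand_one (a b l m : ℕ) (f g : Fin 0 → ℕ) :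
    summand q 1 a b (Fin.cons l f, Fin.cons m g) = q ^ quadExp a b l m * tail q 0 a b l m := by
  have h1 := pow_mul_pow_quad (q := q) a b l m 0
  have hM : Mext (Fin.cons l f : Fin 1 → ℕ) (Fin.cons m g : Fin 1 → ℕ) (1 + 1) = l := by
    rw [Mext, if_pos rfl, nth_cons_one]
  have hn : nth f 1 = 0 := by simp [nth]
  have key : ∀ (c n : ℕ) (h : Fin 0 → ℕ), ∑ i ∈ Finset.Icc (c + 1) 1,
      nth (Fin.cons n h : Fin 1 → ℕ) i = if c = 0 then n else 0 := by
    intro c n h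
    have e := sum_Icc_nth_cons c n h
    rw [Finset.Icc_eq_empty_of_lt (a := c - 1 + 1) (by omega), Finset.sum_empty, add_zero] at e
    exact e
  rw [summand]
  simp only [Finset.Icc_self, Finset.prod_singleton]
  rw [key, key, hM, nth_cons_one, nth_cons_one, nth_cons_succ le_rfl, hn, tail, div_eq_mul_inv,
    inv_qPoch_eq_rq, ← cast_del]
  have hb : qBinom q l (0 : ℕ) = 1 := by
    rw [qBinom_eq, Nat.cast_zero, rq_zero, one_mul, sub_zero, qp_mul_rq (by omega)]
  rw [hb, Nat.cast_zero, show (l : ℤ) - 0 + l + del b = 2 * l + del b by ring]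
  rw [add_zero, pow_zero, mul_one] at h1
  rw [← h1]
  ring

lemma summand_cons (k a b l m : ℕ) (f g : Fin (k + 1) → ℕ) :
    summand q (k + 2) a b (Fin.cons l f, Fin.cons m g) = q ^ quadExp a b l m *
      (rq q ((l : ℤ) - nth f 1) * qBinom q ((l : ℤ) - nth f 1 + nth g 1 + del b) m *
        summand q (k + 1) (a - 1) (b - 1) (f, g)) := by
  have h1 := pow_mul_pow_quad (q := q) a b l m
    ((∑ i ∈ Finset.Icc (a - 1 + 1) (k + 1), nth f i) + ∑ i ∈ Finset.Icc (b - 1 + 1) (k + 1), nth g i)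
  rw [summand, summand]
  simp only
  rw [prod_Icc_one_succ, sum_Icc_nth_cons, sum_Icc_nth_cons]
  have hM : Mext (Fin.cons l f : Fin (k + 2) → ℕ) (Fin.cons m g : Fin (k + 2) → ℕ) (1 + 1) =
      nth g 1 := by
    rw [Mext_cons_succ (by omega) le_rfl, Mext, if_neg (by omega)]
  have hP : ∀ i ∈ Finset.Icc 1 (k + 1),
      (q ^ (nth (Fin.cons l f : Fin (k + 2) → ℕ) (i + 1) ^ 2 +
          nth (Fin.cons m g : Fin (k + 2) → ℕ) (i + 1) ^ 2 -
          nth (Fin.cons l f : Fin (k + 2) → ℕ) (i + 1) *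
            nth (Fin.cons m g : Fin (k + 2) → ℕ) (i + 1)) *
        qBinom q (nth (Fin.cons l f : Fin (k + 2) → ℕ) (i + 1))
          (nth (Fin.cons l f : Fin (k + 2) → ℕ) (i + 1 + 1)) *
        qBinom q ((nth (Fin.cons l f : Fin (k + 2) → ℕ) (i + 1) : ℤ) -
            (nth (Fin.cons l f : Fin (k + 2) → ℕ) (i + 1 + 1) : ℤ) +
            (Mext (Fin.cons l f : Fin (k + 2) → ℕ) (Fin.cons m g : Fin (k + 2) → ℕ)
              (i + 1 + 1) : ℤ) + (if b = i + 1 then 1 else 0))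
          (nth (Fin.cons m g : Fin (k + 2) → ℕ) (i + 1))) =
      q ^ (nth f i ^ 2 + nth g i ^ 2 - nth f i * nth g i) * qBinom q (nth f i) (nth f (i + 1)) *
        qBinom q ((nth f i : ℤ) - (nth f (i + 1) : ℤ) + (Mext f g (i + 1) : ℤ) +
          (if b - 1 = i then 1 else 0)) (nth g i) := by
    intro i hi
    rw [Finset.mem_Icc] at hi
    rw [nth_cons_succ hi.1, nth_cons_succ hi.1, nth_cons_succ (by omega),
      Mext_cons_succ (by omega) (by omega)]
    simp only [show b = i + 1 ↔ b - 1 = i by omega]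
  rw [Finset.prod_congr rfl hP, hM, nth_cons_one, nth_cons_one, nth_cons_succ le_rfl, div_eq_mul_inv,
    div_eq_mul_inv, inv_qPoch_eq_rq, inv_qPoch_eq_rq, ← cast_del, qBinom_eq q l]
  have h2 := qp_mul_rq (q := q) (n := l) (by omega)
  rw [show ∀ x y z w : ℕ, x + y + (z + w) = x + z + (y + w) by intros; ring]
  generalize Finset.prod (M := ℂ) (Finset.Icc 1 (k + 1)) _ = P
  linear_combination (rq q l * qp q l * rq q (nth f 1) * rq q (l - nth f 1) *
    qBinom q ((l : ℤ) - nth f 1 + nth g 1 + del b) m * P) * h1 + (q ^ quadExp a b l m *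
      q ^ ((∑ i ∈ Finset.Icc (a - 1 + 1) (k + 1), nth f i) +
        ∑ i ∈ Finset.Icc (b - 1 + 1) (k + 1), nth g i) * rq q (nth f 1) * rq q (l - nth f 1) *
    qBinom q ((l : ℤ) - nth f 1 + nth g 1 + del b) m * P) * h2

/-- Prepending entries to both sequences of a pair. -/
def consPair (k : ℕ) :
    (ℕ × ℕ) × ((Fin k → ℕ) × (Fin k → ℕ)) ≃ (Fin (k + 1) → ℕ) × (Fin (k + 1) → ℕ) :=
  (Equiv.prodProdProdComm _ _ _ _).trans
    (Equiv.prodCongr (Fin.consEquiv fun _ => ℕ) (Fin.consEquiv fun _ => ℕ))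

lemma consPair_apply {k : ℕ} (p : (ℕ × ℕ) × ((Fin k → ℕ) × (Fin k → ℕ))) :
    consPair k p = (Fin.cons p.1.1 p.2.1, Fin.cons p.1.2 p.2.2) := rfl

lemma sum_consPair {k : ℕ} (p : (ℕ × ℕ) × ((Fin k → ℕ) × (Fin k → ℕ))) :
    (∑ i, (consPair k p).1 i) + ∑ i, (consPair k p).2 i =
      (p.1.1 + p.1.2) + ((∑ i, p.2.1 i) + ∑ i, p.2.2 i) := by
  simp only [consPair_apply, Fin.sum_univ_succ, Fin.cons_zero, Fin.cons_succ]
  omega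

variable (q) in
lemma summable_sqrt_pow_sum (k : ℕ) : Summable fun p : (Fin k → ℕ) × (Fin k → ℕ) =>
    √‖q‖ ^ ((∑ i, p.1 i) + ∑ i, p.2 i) := by
  induction k with
  | zero => exact (hasSum_fintype _).summable
  | succ k ih =>
    rw [← (consPair k).summable_iff]
    have h := (summable_sqrt_pow_prod q).mul_of_nonneg ih
      (fun _ => pow_nonneg (Real.sqrt_nonneg _) _) (fun _ => pow_nonneg (Real.sqrt_nonneg _) _)
    refine h.congr fun p => ?_
    rw [Function.comp_apply, sum_consPair, pow_add _ (_ + _)]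

lemma exists_summand_bound (k : ℕ) : ∃ C : ℝ, 0 ≤ C ∧ ∀ a b p,
    ‖summand q (k + 1) a b p‖ ≤ C * √‖q‖ ^ ((∑ i, p.1 i) + ∑ i, p.2 i) := by
  obtain ⟨C, hC, hr, -, hb⟩ := exists_bound q
  have hC0 : 0 ≤ C := zero_le_one.trans hC
  induction k with
  | zero =>
    obtain ⟨D, hD, ht⟩ := exists_tail_bound q 0
    refine ⟨D, hD, fun a b p => ?_⟩
    obtain ⟨p, rfl⟩ := (consPair 0).surjective p
    rw [sum_consPair, consPair_apply, summand_one, norm_mul, mul_comm]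
    simp only [Finset.univ_eq_empty, Finset.sum_empty, add_zero]
    gcongr
    · exact ht _ _ _ _
    · exact norm_zpow_le (le_two_mul_quadExp _ _ _ _)
  | succ k ih =>
    obtain ⟨D, hD, ih⟩ := ih
    refine ⟨C * C * D, by positivity, fun a b p => ?_⟩
    obtain ⟨p, rfl⟩ := (consPair (k + 1)).surjective p
    rw [sum_consPair, consPair_apply, summand_cons, norm_mul, norm_mul, norm_mul,
      pow_add _ (_ + _)]
    calc _ ≤ √‖q‖ ^ (p.1.1 + p.1.2) *
          (C * C * (D * √‖q‖ ^ ((∑ i, p.2.1 i) + ∑ i, p.2.2 i))) := by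
          gcongr
          · exact norm_zpow_le (le_two_mul_quadExp _ _ _ _)
          · exact hr _
          · exact hb _ _
          · exact ih _ _ p.2
      _ = _ := by ring

lemma summable_summand (k a b : ℕ) : Summable (summand q (k + 1) a b) := by
  obtain ⟨C, -, h⟩ := exists_summand_bound (q := q) k
  exact Summable.of_norm_bounded ((summable_sqrt_pow_sum q (k + 1)).mul_left C) fun p => h a b p

lemma hasSum_summand_cons (k : ℕ) : ∀ a b l m : ℕ,
    HasSum (fun p : (Fin k → ℕ) × (Fin k → ℕ) =>
      summand q (k + 1) a b (Fin.cons l p.1, Fin.cons m p.2))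
      (q ^ quadExp a b l m * tail q k a b l m) := by
  induction k with
  | zero =>
    intro a b l m
    let _ : Unique ((Fin 0 → ℕ) × (Fin 0 → ℕ)) := Unique.mk' _
    exact HasSum.of_eq (hasSum_unique _) (fun i => rfl) (summand_one a b l m _ _).symm
  | succ k ih =>
    intro a b l m
    have hs : Summable fun p : (Fin (k + 1) → ℕ) × (Fin (k + 1) → ℕ) =>
        summand q (k + 2) a b (Fin.cons l p.1, Fin.cons m p.2) := by
      have h := (consPair (k + 1)).summable_iff.mpr (summable_summand (q := q) (k + 1) a b)
      exact h.prod_factor (l, m)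
    have h1 : ∀ c : ℕ × ℕ, HasSum (fun p : (Fin k → ℕ) × (Fin k → ℕ) =>
        summand q (k + 2) a b (Fin.cons l (consPair k (c, p)).1, Fin.cons m (consPair k (c, p)).2))
        (q ^ quadExp a b l m * (rq q ((l : ℤ) - c.1) * qBinom q ((l : ℤ) - c.1 + c.2 + del b) m *
          (q ^ quadExp (a - 1) (b - 1) c.1 c.2 * tail q k (a - 1) (b - 1) c.1 c.2))) := by
      intro c
      refine HasSum.of_eq ((ih (a - 1) (b - 1) c.1 c.2).mul_left (q ^ quadExp a b l m *
        (rq q ((l : ℤ) - c.1) * qBinom q ((l : ℤ) - c.1 + c.2 + del b) m)))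
        (fun p => ?_) (by ring)
      rw [summand_cons, consPair_apply, nth_cons_one, nth_cons_one]
      ring
    have h2 := ((consPair k).hasSum_iff.mpr hs.hasSum).prod_fiberwise h1
    have h3 : HasSum (fun c : ℕ × ℕ => q ^ quadExp a b l m * (rq q ((l : ℤ) - c.1) *
        qBinom q ((l : ℤ) - c.1 + c.2 + del b) m *
          (q ^ quadExp (a - 1) (b - 1) c.1 c.2 * tail q k (a - 1) (b - 1) c.1 c.2)))
        (q ^ quadExp a b l m * tail q (k + 1) a b l m) := by
      rw [tail, ← Finset.sum_product', Finset.mul_sum]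
      refine hasSum_sum_of_ne_finset_zero fun c hc => ?_
      simp only [Finset.mem_product, Finset.mem_range, not_and_or, not_lt] at hc
      by_cases hl : c.1 ≤ l
      · rw [tail_eq_zero q k _ _ _ _ (by omega)]
        ring
      · rw [rq_neg (n := (l : ℤ) - c.1) (by omega)]
        ring
    rw [h3.unique h2]
    exact hs.hasSum

lemma tsum_summand (k a b : ℕ) : ∑' p, summand q (k + 1) a b p = multisum q k a b := by
  have hs := summable_summand (q := q) k a b
  have h := ((consPair k).hasSum_iff.mpr hs.hasSum).prod_fiberwise
    fun c => hasSum_summand_cons k a b c.1 c.2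
  exact h.tsum_eq.symm

lemma chiT_comm (q : ℂ) (K a b : ℕ) : chiT q K a b = chiT q K b a := by
  rw [chiT, chiT, mul_comm (theta (q ^ (a + 1)) _), add_comm a b]

lemma chiT_eq_multisum {k a b : ℕ} (ha : a ≤ k + 1) (hb : b ≤ k + 1) :
    chiT q (3 * (k + 1) + 4) a b =
      multisum q k a b - (if a = 0 ∨ b = 0 then 0 else q * multisum q k (a - 1) (b - 1)) := by
  wlog hab : a ≤ b generalizing a b
  · rw [chiT_comm, this hb ha (by omega), multisum_swap ha hb,
      multisum_swap (show a - 1 ≤ k + 1 by omega) (show b - 1 ≤ k + 1 by omega)]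
    simp only [or_comm]
  · rw [multisum_sub_eq_tsum hab hb, (hasSum_cyc_thetaTerm (k + 1) a b).tsum_eq, chiT, inv_pow]
    ring

end Unroll

section NomeZero

lemma nth_zero (k i : ℕ) : nth (0 : Fin k → ℕ) i = 0 := by
  unfold nth; split <;> rfl

lemma Mext_zero (k i : ℕ) : Mext (0 : Fin k → ℕ) 0 i = 0 := by
  simp only [Mext, nth_zero, ite_self]

lemma qPoch_zero_left (q : ℂ) (n : ℕ) : qPoch 0 q n = 1 := by simp [qPoch]

lemma qPochInf_zero_left (q : ℂ) : qPochInf 0 q = 1 := by simp [qPochInf]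

lemma qBinom_zero_right (n : ℤ) (hn : 0 ≤ n) : qBinom 0 n 0 = 1 := by
  simp [qBinom, hn, qPoch_zero_left]

lemma tsum_mul_prod_zero_pow (k : ℕ) (A : (Fin k → ℕ) × (Fin k → ℕ) → ℂ)
    (B C : (Fin k → ℕ) × (Fin k → ℕ) → ℕ → ℂ) :
    ∑' p : (Fin k → ℕ) × (Fin k → ℕ), A p * ∏ i ∈ Finset.Icc 1 k,
      ((0 : ℂ) ^ (nth p.1 i ^ 2 + nth p.2 i ^ 2 - nth p.1 i * nth p.2 i) * B p i * C p i) =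
    A 0 * ∏ i ∈ Finset.Icc 1 k, (B 0 i * C 0 i) := by
  rw [tsum_eq_single 0]
  · simp [nth_zero]
  · intro p hp
    obtain ⟨i, hi⟩ : ∃ i, ¬(p.1 i = 0 ∧ p.2 i = 0) := by
      by_contra! h
      exact hp (Prod.ext (funext fun i => (h i).1) (funext fun i => (h i).2))
    rw [Finset.prod_eq_zero (i := (i : ℕ) + 1) (Finset.mem_Icc.mpr ⟨by omega, by omega⟩), mul_zero]
    have hn : ∀ f : Fin k → ℕ, nth f ((i : ℕ) + 1) = f i := fun f => by
      rw [nth, dif_pos ⟨by omega, by omega⟩]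
      rfl
    rw [hn, hn, zero_pow, zero_mul, zero_mul]
    zify
    rw [cast_quad]
    intro h
    refine hi ⟨?_, ?_⟩ <;> zify <;> nlinarith [sq_nonneg ((p.1 i : ℤ) - p.2 i)]

lemma chiT_zero (K a b : ℕ) (hK : 1 ≤ K) : chiT 0 K a b = 1 := by
  simp [chiT, theta, qPochInf_zero_left, show K ≠ 0 by omega]

end NomeZero

lemma tsum_shifted_summand {q : ℂ} [Nome q] (k a b : ℕ) :
    (∑' p : (Fin (k + 1) → ℕ) × (Fin (k + 1) → ℕ),
        (if a = 0 ∨ b = 0 then (0 : ℂ) else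
          q ^ (1 + (∑ i ∈ Finset.Icc a (k + 1), nth p.1 i) +
                ∑ i ∈ Finset.Icc b (k + 1), nth p.2 i) /
              qPoch q q (nth p.1 1) *
            ∏ i ∈ Finset.Icc 1 (k + 1),
              (q ^ (nth p.1 i ^ 2 + nth p.2 i ^ 2 - nth p.1 i * nth p.2 i) *
                qBinom q (nth p.1 i) (nth p.1 (i + 1)) *
                qBinom q ((nth p.1 i : ℤ) - (nth p.1 (i + 1) : ℤ) +
                    (Mext p.1 p.2 (i + 1) : ℤ) + (if b = i + 1 then 1 else 0))
                  (nth p.2 i)))) =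
      if a = 0 ∨ b = 0 then 0 else q * multisum q k (a - 1) (b - 1) := by
  split_ifs with h
  · exact tsum_zero
  · rw [not_or] at h
    obtain ⟨a, rfl⟩ := Nat.exists_eq_succ_of_ne_zero h.1
    obtain ⟨b, rfl⟩ := Nat.exists_eq_succ_of_ne_zero h.2
    rw [← tsum_summand, ← tsum_mul_left]
    refine tsum_congr fun p => ?_
    simp only [summand, Nat.succ_eq_add_one, add_left_inj, add_tsub_cancel_right, add_assoc,
      pow_add q 1, pow_one]
    ring

lemma tsum_unshifted_summand {q : ℂ} [Nome q] (k : ℕ) :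
    (∑' p : (Fin (k + 1) → ℕ) × (Fin (k + 1) → ℕ),
        (qPoch q q (nth p.1 1))⁻¹ *
          ∏ i ∈ Finset.Icc 1 (k + 1),
            (q ^ (nth p.1 i ^ 2 + nth p.2 i ^ 2 - nth p.1 i * nth p.2 i) *
              qBinom q (nth p.1 i) (nth p.1 (i + 1)) *
              qBinom q ((nth p.1 i : ℤ) - (nth p.1 (i + 1) : ℤ) +
                  (Mext p.1 p.2 (i + 1) : ℤ))
                (nth p.2 i))) = multisum q k (k + 1) (k + 2) := by
  rw [← tsum_summand]
  refine tsum_congr fun p => ?_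
  rw [summand, Finset.Icc_eq_empty_of_lt (a := k + 1 + 1) (by omega),
    Finset.Icc_eq_empty_of_lt (a := k + 2 + 1) (by omega),
    Finset.sum_empty, Finset.sum_empty, add_zero, pow_zero, one_div]
  congr 1
  refine Finset.prod_congr rfl fun i hi => ?_
  rw [Finset.mem_Icc] at hi
  rw [if_neg (by omega), add_zero]

end Analysis

/-- The `A₂⁽¹⁾` Andrews–Gordon identities for modulus `K = 3k + 4`
(Theorem 7.1 of the paper), together with the simpler expression for
`χ̃_{k,k}^K(q)`. -/
theorem A2_andrews_gordon_I
    (k : ℕ) (hk : 1 ≤ k) (a b : ℕ) (ha : a ≤ k) (hb : b ≤ k)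
    (q : ℂ) (hq : ‖q‖ < 1) :
    (chiT q (3 * k + 4) a b =
      (∑' p : (Fin k → ℕ) × (Fin k → ℕ),
        q ^ ((∑ i ∈ Finset.Icc (a + 1) k, nth p.1 i) +
              ∑ i ∈ Finset.Icc (b + 1) k, nth p.2 i) /
            qPoch q q (nth p.1 1) *
          ∏ i ∈ Finset.Icc 1 k,
            (q ^ (nth p.1 i ^ 2 + nth p.2 i ^ 2 - nth p.1 i * nth p.2 i) *
              qBinom q (nth p.1 i) (nth p.1 (i + 1)) *
              qBinom q ((nth p.1 i : ℤ) - (nth p.1 (i + 1) : ℤ) +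
                  (Mext p.1 p.2 (i + 1) : ℤ) + (if b = i then 1 else 0))
                (nth p.2 i))) -
      (∑' p : (Fin k → ℕ) × (Fin k → ℕ),
        (if a = 0 ∨ b = 0 then (0 : ℂ) else
          q ^ (1 + (∑ i ∈ Finset.Icc a k, nth p.1 i) +
                ∑ i ∈ Finset.Icc b k, nth p.2 i) /
              qPoch q q (nth p.1 1) *
            ∏ i ∈ Finset.Icc 1 k,
              (q ^ (nth p.1 i ^ 2 + nth p.2 i ^ 2 - nth p.1 i * nth p.2 i) *
                qBinom q (nth p.1 i) (nth p.1 (i + 1)) *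
                qBinom q ((nth p.1 i : ℤ) - (nth p.1 (i + 1) : ℤ) +
                    (Mext p.1 p.2 (i + 1) : ℤ) + (if b = i + 1 then 1 else 0))
                  (nth p.2 i))))) ∧
    chiT q (3 * k + 4) k k =
      ∑' p : (Fin k → ℕ) × (Fin k → ℕ),
        (qPoch q q (nth p.1 1))⁻¹ *
          ∏ i ∈ Finset.Icc 1 k,
            (q ^ (nth p.1 i ^ 2 + nth p.2 i ^ 2 - nth p.1 i * nth p.2 i) *
              qBinom q (nth p.1 i) (nth p.1 (i + 1)) *
              qBinom q ((nth p.1 i : ℤ) - (nth p.1 (i + 1) : ℤ) +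
                  (Mext p.1 p.2 (i + 1) : ℤ))
                (nth p.2 i)) := by
  rcases eq_or_ne q 0 with rfl | h0
  · have hδ : ∀ i, (0 : ℤ) ≤ if b = i then 1 else 0 := fun i => by split <;> omega
    have hs : ∀ p : (Fin k → ℕ) × (Fin k → ℕ), ∀ x y : ℂ, (if a = 0 ∨ b = 0 then (0 : ℂ) else
        0 ^ (1 + (∑ i ∈ Finset.Icc a k, nth p.1 i) + ∑ i ∈ Finset.Icc b k, nth p.2 i) / x * y) =
          0 := fun p x y => by
      rw [zero_pow (by omega), zero_div, zero_mul, ite_self]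
    simp only [hs, tsum_zero, sub_zero]
    rw [chiT_zero _ _ _ (by omega), chiT_zero _ _ _ (by omega), tsum_mul_prod_zero_pow k
      (fun p => 0 ^ ((∑ i ∈ Finset.Icc (a + 1) k, nth p.1 i) +
              ∑ i ∈ Finset.Icc (b + 1) k, nth p.2 i) / qPoch 0 0 (nth p.1 1)),
      tsum_mul_prod_zero_pow k (fun p => (qPoch 0 0 (nth p.1 1))⁻¹)]
    simp [nth_zero, Mext_zero, qBinom_zero_right, hδ]
  · have : Nome q := ⟨h0, hq⟩
    obtain ⟨k, rfl⟩ := Nat.exists_eq_add_of_le' hk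
    refine ⟨?_, ?_⟩
    · rw [tsum_shifted_summand, chiT_eq_multisum ha hb, ← tsum_summand (q := q) k a b]
      rfl
    · rw [tsum_unshifted_summand, multisum_diag, chiT_eq_multisum le_rfl le_rfl, if_neg (by omega)]
      rfl

end Stmt1
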